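/- Fix an integer r ≥ 2 and set c_r := 1 / ((2π)^{(r−1)/2} · √r). For every ε > 0 there exists N such that for every integer n ≥ N there exists Q such that for every finite field F_q with q > Q elements and every choice of r distinct polynomials a_1, …, a_r ∈ F_q[T], each of degree < n, one has | q^{−n} · #{ f monic of degree n in F_q[T] : ω(f + a_1) = … = ω(f + a_r) } − c_r / (log n)^{(r−1)/2} | ≤ ε / (log n)^{(r−1)/2}. -/

import Mathlib

open Polynomial

/-- ω(f): the number of distinct monic irreducible divisors of `f`. -/
noncomputable def omegaPoly {F : Type*} [Field F] (f : F[X]) : ℕ :=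
  letI := Classical.decEq F
  letI := Classical.decEq F[X]
  (UniqueFactorizationMonoid.normalizedFactors f).toFinset.card


set_option linter.unusedSectionVars false

namespace Pf

section Red
variable (K : Type*) {L : Type*} [Field K] [CommRing L] [Nontrivial L] [Algebra K L]

/-- weighted filtration -/
def Wf (κ : ℕ) (t : L) (y : ℕ → L) : ℕ → ℕ → Submodule K L
  | 0, D => Submodule.span K ((fun a => t ^ a) '' {a | a ≤ κ * D})
  | k + 1, D => ⨆ e : {e : ℕ // e ≤ D}, Submodule.span K {y k ^ (e : ℕ)} * Wf κ t y k (D - e)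

/-- reduced filtration -/
def Bf (κ : ℕ) (t : L) (y : ℕ → L) (d : ℕ → ℕ) : ℕ → ℕ → Submodule K L
  | 0, D => Submodule.span K ((fun a => t ^ a) '' {a | a ≤ κ * D})
  | k + 1, D => ⨆ e : {e : ℕ // e ≤ D ∧ e < d k},
      Submodule.span K {y k ^ (e : ℕ)} * Bf κ t y d k (D - e)

variable {K} {κ : ℕ} {t : L} {y : ℕ → L} {d : ℕ → ℕ}

lemma Wf_mul_mem_succ {k D e : ℕ} (he : e ≤ D) {u : L} (hu : u ∈ Wf K κ t y k (D - e)) :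
    y k ^ e * u ∈ Wf K κ t y (k+1) D := by
  rw [Wf]
  refine Submodule.mem_iSup_of_mem ⟨e, he⟩ ?_
  exact Submodule.mul_mem_mul (Submodule.mem_span_singleton_self _) hu

lemma Wf_succ_le {k D : ℕ} {P : Submodule K L}
    (h : ∀ e ≤ D, ∀ u ∈ Wf K κ t y k (D - e), y k ^ e * u ∈ P) : Wf K κ t y (k+1) D ≤ P := by
  rw [Wf]
  refine iSup_le fun ⟨e, he⟩ => ?_
  rw [Submodule.mul_le]
  intro m hm v hv
  obtain ⟨c, rfl⟩ := Submodule.mem_span_singleton.1 hm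
  rw [smul_mul_assoc]
  exact P.smul_mem _ (h e he v hv)

lemma Wf_mono (k : ℕ) : ∀ {D D' : ℕ}, D ≤ D' → Wf K κ t y k D ≤ Wf K κ t y k D' := by
  induction k with
  | zero =>
    intro D D' h
    rw [Wf, Wf]
    apply Submodule.span_mono
    apply Set.image_mono
    intro a ha
    exact le_trans (Set.mem_ofPred.1 ha) (Nat.mul_le_mul_left _ h)
  | succ k ih =>
    intro D D' h
    refine Wf_succ_le fun e he u hu => ?_
    exact Wf_mul_mem_succ (he.trans h) (ih (Nat.sub_le_sub_right h e) hu)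

lemma Wf_le_succ (k D : ℕ) : Wf K κ t y k D ≤ Wf K κ t y (k+1) D := by
  intro u hu
  have := Wf_mul_mem_succ (K := K) (κ := κ) (t := t) (y := y) (k := k) (D := D) (e := 0)
    (Nat.zero_le _) (u := u) (by simpa using hu)
  simpa using this

lemma Wf_le_of_le {k k' : ℕ} (h : k ≤ k') (D : ℕ) : Wf K κ t y k D ≤ Wf K κ t y k' D := by
  induction h with
  | refl => exact le_rfl
  | step _ ih => exact ih.trans (Wf_le_succ _ _)

lemma pow_mem_Wf {a D : ℕ} (h : a ≤ κ * D) (k : ℕ) : t ^ a ∈ Wf K κ t y k D := by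
  apply Wf_le_of_le (Nat.zero_le k)
  rw [Wf]
  exact Submodule.subset_span ⟨a, h, rfl⟩

lemma one_mem_Wf (k D : ℕ) : (1 : L) ∈ Wf K κ t y k D := by
  simpa using pow_mem_Wf (K := K) (κ := κ) (t := t) (y := y) (Nat.zero_le (κ * D)) k

lemma Wf_mul (k : ℕ) : ∀ {D D' : ℕ} {u v : L}, u ∈ Wf K κ t y k D → v ∈ Wf K κ t y k D' →
    u * v ∈ Wf K κ t y k (D + D') := by
  induction k with
  | zero =>
    intro D D' u v hu hv
    rw [Wf] at *
    have := Submodule.mul_mem_mul hu hv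
    rw [Submodule.span_mul_span] at this
    refine Submodule.span_mono ?_ this
    rintro _ ⟨_, ⟨a, ha, rfl⟩, _, ⟨b, hb, rfl⟩, rfl⟩
    refine ⟨a + b, ?_, pow_add _ _ _⟩
    simp only [Set.mem_ofPred_eq] at *
    nlinarith
  | succ k ih =>
    intro D D' u v hu hv
    have h1 : Wf K κ t y (k+1) D * Wf K κ t y (k+1) D' ≤ Wf K κ t y (k+1) (D + D') := by
      rw [Submodule.mul_le]
      intro m hm
      suffices h : Wf K κ t y (k+1) D' ≤
          (Wf K κ t y (k+1) (D + D')).comap (LinearMap.mulLeft K m) from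
        fun n hn => h hn
      refine Wf_succ_le fun e he w hw => ?_
      simp only [Submodule.mem_comap, LinearMap.mulLeft_apply]
      suffices h : Wf K κ t y (k+1) D ≤
          (Wf K κ t y (k+1) (D + D')).comap (LinearMap.mulRight K (y k ^ e * w)) from h hm
      refine Wf_succ_le fun e' he' w' hw' => ?_
      simp only [Submodule.mem_comap, LinearMap.mulRight_apply]
      have : y k ^ e' * w' * (y k ^ e * w) = y k ^ (e' + e) * (w' * w) := by ring
      rw [this]
      refine Wf_mul_mem_succ (by omega) ?_
      have := ih hw' hw
      rwa [show D + D' - (e' + e) = D - e' + (D' - e) by omega]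
    exact h1 (Submodule.mul_mem_mul hu hv)

lemma y_mem_Wf {j k : ℕ} (h : j < k) : y j ∈ Wf K κ t y k 1 := by
  apply Wf_le_of_le (Nat.succ_le_of_lt h)
  have := Wf_mul_mem_succ (K := K) (κ := κ) (t := t) (y := y) (k := j) (D := 1) (e := 1)
    le_rfl (u := 1) (one_mem_Wf _ _)
  simpa using this

lemma Bf_mul_mem_succ {k D e : ℕ} (he : e ≤ D) (hd : e < d k) {u : L}
    (hu : u ∈ Bf K κ t y d k (D - e)) :
    y k ^ e * u ∈ Bf K κ t y d (k+1) D := by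
  rw [Bf]
  refine Submodule.mem_iSup_of_mem ⟨e, he, hd⟩ ?_
  exact Submodule.mul_mem_mul (Submodule.mem_span_singleton_self _) hu

lemma Wf_le_Bf (k : ℕ)
    (hred : ∀ j < k, 0 < d j ∧ ∃ a : ℕ → L, (∀ m, a m ∈ Wf K κ t y j m) ∧
      y j ^ d j = ∑ m ∈ Finset.range (d j), a (m+1) * y j ^ (d j - 1 - m)) :
    ∀ D, Wf K κ t y k D ≤ Bf K κ t y d k D := by
  induction k with
  | zero => intro D; rw [Wf, Bf]
  | succ k ih =>
    have ih := ih (fun j hj => hred j (by omega))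
    obtain ⟨hd, a, ha, hy⟩ := hred k (by omega)
    intro D
    refine Wf_succ_le fun e he u hu => ?_
    induction e using Nat.strong_induction_on generalizing u with
    | _ e IH =>
      by_cases hlt : e < d k
      · exact Bf_mul_mem_succ he hlt (ih _ hu)
      · push Not at hlt
        have h1 : y k ^ e * u = ∑ m ∈ Finset.range (d k), y k ^ (e - 1 - m) * (a (m+1) * u) := by
          have : y k ^ e = y k ^ (e - d k) * y k ^ d k := by rw [← pow_add]; congr 1; omega
          rw [this, hy, Finset.mul_sum, Finset.sum_mul]
          refine Finset.sum_congr rfl fun m hm => ?_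
          rw [Finset.mem_range] at hm
          rw [show e - 1 - m = (e - d k) + (d k - 1 - m) by omega, pow_add]
          ring
        rw [h1]
        refine Submodule.sum_mem _ fun m hm => ?_
        rw [Finset.mem_range] at hm
        refine IH _ (by omega) (by omega) _ ?_
        have := Wf_mul k (ha (m+1)) hu
        rwa [show D - (e - 1 - m) = m + 1 + (D - e) by omega]

lemma Bf_le (k : ℕ) : ∀ D, Bf K κ t y d k D ≤ Submodule.span K
    (Set.range fun p : Fin (κ * D + 1) × ((j : Fin k) → Fin (d j)) =>
      t ^ (p.1 : ℕ) * ∏ j : Fin k, y j ^ (p.2 j : ℕ)) := by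
  induction k with
  | zero =>
    intro D
    rw [Bf]
    apply Submodule.span_mono
    rintro _ ⟨a, ha, rfl⟩
    exact ⟨⟨⟨a, Nat.lt_succ_of_le ha⟩, fun j => j.elim0⟩, by simp⟩
  | succ k ih =>
    intro D
    rw [Bf]
    refine iSup_le fun ⟨e, he, hd⟩ => ?_
    refine (mul_le_mul' le_rfl (ih _)).trans ?_
    rw [Submodule.span_mul_span]
    apply Submodule.span_mono
    rintro _ ⟨_, rfl, _, ⟨⟨a, e'⟩, rfl⟩, rfl⟩
    refine ⟨⟨⟨a, ?_⟩, Fin.snoc (α := fun j : Fin (k+1) => Fin (d j)) e' ⟨e, hd⟩⟩, ?_⟩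
    · have : (a : ℕ) < κ * (D - e) + 1 := a.2
      have h2 : κ * (D - e) ≤ κ * D := Nat.mul_le_mul_left _ (Nat.sub_le _ _)
      omega
    · simp only [Fin.prod_univ_castSucc, Fin.snoc_castSucc, Fin.snoc_last, Fin.val_castSucc, Fin.val_last]
      ring


lemma red_coeff (k0 n : ℕ)
    (h0 : ∀ m ≤ n, (∏ j ∈ Finset.Ico 0 n, (X - C (y (k0 + j)))).coeff (n - m) ∈ Wf K κ t y k0 m) :
    ∀ j ≤ n, ∀ m ≤ n - j,
      (∏ j' ∈ Finset.Ico j n, (X - C (y (k0 + j')))).coeff (n - j - m) ∈ Wf K κ t y (k0 + j) m := by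
  intro j
  induction j with
  | zero => intro _ m hm; simpa using h0 m (by simpa using hm)
  | succ j ih =>
    intro hj m
    have ih := ih (by omega)
    have hprod := Finset.prod_eq_prod_Ico_succ_bot (show j < n by omega)
      (fun j' => (X - C (y (k0 + j')) : L[X]))
    set g := ∏ j' ∈ Finset.Ico (j+1) n, (X - C (y (k0 + j')) : L[X]) with hg
    have hgm : g.Monic := monic_prod_of_monic _ _ fun _ _ => monic_X_sub_C _
    have hgd : g.natDegree = n - (j+1) := by
      rw [hg, natDegree_prod_of_monic _ _ fun _ _ => monic_X_sub_C _]
      simp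
    induction m with
    | zero =>
      intro _
      have : g.coeff (n - (j+1) - 0) = 1 := by
        have := hgm.coeff_natDegree
        rwa [hgd] at this
      rw [this]
      exact one_mem_Wf _ _
    | succ m ihm =>
      intro hm
      have h1 := ihm (by omega)
      have h2 := ih (m+1) (by omega)
      rw [hprod, sub_mul, coeff_sub, coeff_C_mul,
        show n - j - (m+1) = (n - (j+1) - (m+1)) + 1 by omega, coeff_X_mul] at h2
      rw [show n - (j+1) - (m+1) + 1 = n - (j+1) - m by omega] at h2
      have h3 : y (k0 + j) * g.coeff (n - (j+1) - m) ∈ Wf K κ t y (k0 + j + 1) (m+1) := by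
        have := Wf_mul (k0 + j + 1) (y_mem_Wf (K := K) (κ := κ) (t := t) (y := y)
          (show k0 + j < k0 + j + 1 by omega)) h1
        rwa [add_comm 1 m] at this
      have h4 := Submodule.add_mem _ (Wf_le_succ _ _ h2) h3
      rw [sub_add_cancel] at h4
      exact h4

lemma red_rel (k0 n : ℕ)
    (h0 : ∀ m ≤ n, (∏ j ∈ Finset.Ico 0 n, (X - C (y (k0 + j)))).coeff (n - m) ∈ Wf K κ t y k0 m)
    (j : ℕ) (hj : j < n) :
    ∃ a : ℕ → L, (∀ m, a m ∈ Wf K κ t y (k0 + j) m) ∧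
      y (k0 + j) ^ (n - j) =
        ∑ m ∈ Finset.range (n - j), a (m+1) * y (k0 + j) ^ (n - j - 1 - m) := by
  have h := red_coeff k0 n h0 j hj.le
  set g := ∏ j' ∈ Finset.Ico j n, (X - C (y (k0 + j')) : L[X]) with hg
  have hgm : g.Monic := monic_prod_of_monic _ _ fun _ _ => monic_X_sub_C _
  have hgd : g.natDegree = n - j := by
    rw [hg, natDegree_prod_of_monic _ _ fun _ _ => monic_X_sub_C _]
    simp
  have hroot : g.eval (y (k0 + j)) = 0 := by
    rw [hg, eval_prod]
    refine Finset.prod_eq_zero (i := j) (by simp [hj]) (by simp)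
  refine ⟨fun m => if m ≤ n - j then - g.coeff (n - j - m) else 0, fun m => ?_, ?_⟩
  · by_cases hm : m ≤ n - j
    · simp only [hm, if_true]; exact Submodule.neg_mem _ (h m hm)
    · simp only [hm, if_false]; exact Submodule.zero_mem _
  · rw [eval_eq_sum_range, hgd, Finset.sum_range_succ] at hroot
    have h1 : g.coeff (n - j) = 1 := by
      have := hgm.coeff_natDegree
      rwa [hgd] at this
    rw [h1, one_mul] at hroot
    rw [eq_neg_of_add_eq_zero_right hroot, ← Finset.sum_range_reflect, ← Finset.sum_neg_distrib]
    refine Finset.sum_congr rfl fun m hm => ?_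
    rw [Finset.mem_range] at hm
    simp only [show m + 1 ≤ n - j by omega, if_true]
    rw [show n - j - (m + 1) = n - j - 1 - m by omega]
    ring

variable (K) in
/-- generating space -/
def Zs {r n : ℕ} (κ : ℕ) (t : L) (x : Fin r → Fin n → L) : Submodule K L :=
  Submodule.span K (((fun a => t ^ a) '' {a | a ≤ κ}) ∪ Set.range (fun p : Fin r × Fin n => x p.1 p.2))

lemma pow_mem_Zs {r n : ℕ} (x : Fin r → Fin n → L) {a : ℕ} (h : a ≤ κ) : t ^ a ∈ Zs K κ t x :=
  Submodule.subset_span (Or.inl ⟨a, h, rfl⟩)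

lemma x_mem_Zs {r n : ℕ} (x : Fin r → Fin n → L) (i : Fin r) (j : Fin n) : x i j ∈ Zs K κ t x :=
  Submodule.subset_span (Or.inr ⟨(i, j), rfl⟩)

lemma one_mem_Zs {r n : ℕ} (x : Fin r → Fin n → L) : (1 : L) ∈ Zs K κ t x := by
  simpa using pow_mem_Zs (K := K) (t := t) x (Nat.zero_le κ)

lemma Zs_pow_mono {r n : ℕ} (x : Fin r → Fin n → L) {D D' : ℕ} (h : D ≤ D') :
    Zs K κ t x ^ D ≤ Zs K κ t x ^ D' := by
  apply pow_le_pow_right' _ h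
  rw [Submodule.one_le]
  exact one_mem_Zs x

lemma Zs_pow_pow_mem {r n : ℕ} (x : Fin r → Fin n → L) {a D : ℕ} (h : a ≤ κ * D) :
    t ^ a ∈ Zs K κ t x ^ D := by
  induction D generalizing a with
  | zero =>
    have h0 : a = 0 := Nat.le_zero.1 (h.trans (le_of_eq (Nat.mul_zero κ)))
    rw [h0, pow_zero, pow_zero]
    exact Submodule.one_le.1 le_rfl
  | succ D ih =>
    by_cases ha : a ≤ κ
    · refine Zs_pow_mono x (show 1 ≤ D + 1 by omega) ?_
      rw [pow_one]; exact pow_mem_Zs x ha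
    · have hle : a - κ ≤ κ * D := by rw [Nat.mul_succ] at h; omega
      have h1 : t ^ a = t ^ (a - κ) * t ^ κ := by rw [← pow_add]; congr 1; omega
      rw [h1, pow_succ (Zs K κ t x)]
      exact Submodule.mul_mem_mul (ih hle) (pow_mem_Zs (K := K) (t := t) x le_rfl)

lemma Zs_mul_mem {r n : ℕ} (x : Fin r → Fin n → L) {D D' : ℕ} {u v : L}
    (hu : u ∈ Zs K κ t x ^ D) (hv : v ∈ Zs K κ t x ^ D') : u * v ∈ Zs K κ t x ^ (D + D') := by
  rw [pow_add]; exact Submodule.mul_mem_mul hu hv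

lemma Zs_pow_mem {r n : ℕ} (x : Fin r → Fin n → L) {D : ℕ} {u : L}
    (hu : u ∈ Zs K κ t x ^ D) (k : ℕ) : u ^ k ∈ Zs K κ t x ^ (k * D) := by
  rw [mul_comm, pow_mul]; exact Submodule.pow_mem_pow _ hu k

lemma Zs_prod_mem {r n : ℕ} (x : Fin r → Fin n → L) {ι : Type*} (s : Finset ι) (D : ι → ℕ) (u : ι → L)
    (hu : ∀ i ∈ s, u i ∈ Zs K κ t x ^ D i) : ∏ i ∈ s, u i ∈ Zs K κ t x ^ (∑ i ∈ s, D i) := by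
  classical
  induction s using Finset.induction_on with
  | empty =>
    rw [Finset.prod_empty, Finset.sum_empty, pow_zero]
    exact Submodule.one_le.1 le_rfl
  | insert a s ha ih =>
    rw [Finset.prod_insert ha, Finset.sum_insert ha]
    exact Zs_mul_mem x (hu a (by simp)) (ih fun i hi => hu i (by simp [hi]))

theorem exists_mon (r n κ : ℕ) (hn : 0 < n) (t : L) (x : Fin r → Fin n → L) (f : Fin r → K[X][X])
    (hmon : ∀ i, (f i).Monic) (hdeg : ∀ i, (f i).natDegree = n)
    (hκ : ∀ i m, ((f i).coeff m).natDegree ≤ κ)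
    (hx : ∀ i, (f i).map (aeval t : K[X] →ₐ[K] L).toRingHom = ∏ j, (X - C (x i j))) :
    ∃ E : Fin (n.factorial ^ r) → Fin r → Fin n → ℕ, ∃ mon : Fin (n.factorial ^ r) → L,
      (∀ e, mon e = ∏ i, ∏ j, x i j ^ E e i j) ∧ (∀ e i j, E e i j ≤ n) ∧ (∃ e, mon e = 1) ∧
      ∀ D, Zs K κ t x ^ D ≤ Submodule.span K
        (Set.range fun p : Fin (κ * D + 1) × Fin (n.factorial ^ r) => t ^ (p.1 : ℕ) * mon p.2) := by
  classical
  set y : ℕ → L := fun k => if h : k < r * n then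
    x ⟨k / n, Nat.div_lt_of_lt_mul (by rwa [mul_comm] at h)⟩ ⟨k % n, Nat.mod_lt _ hn⟩ else 0 with hy
  set d : ℕ → ℕ := fun k => n - k % n with hd
  have hlt : ∀ i < r, ∀ j < n, i * n + j < r * n := fun i hi j hj => by
    have : (i + 1) * n ≤ r * n := Nat.mul_le_mul_right _ hi
    rw [Nat.succ_mul] at this; omega
  have hyx : ∀ (i : Fin r) (j : Fin n), y (i * n + j) = x i j := by
    intro i j
    have h1 := hlt i i.2 j j.2
    have h2 : (i * n + j : ℕ) / n = i := by
      rw [mul_comm, Nat.mul_add_div hn, Nat.div_eq_of_lt j.2]; simp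
    have h3 : (i * n + j : ℕ) % n = j := by
      rw [mul_comm, Nat.mul_add_mod, Nat.mod_eq_of_lt j.2]
    simp only [hy, h1, dif_pos]
    have e1 : ∀ hh, (⟨(i * n + j) / n, hh⟩ : Fin r) = i := fun _ => Fin.ext h2
    have e2 : ∀ hh, (⟨(i * n + j) % n, hh⟩ : Fin n) = j := fun _ => Fin.ext h3
    rw [e1, e2]
  have hpos : ∀ k, 0 < d k := fun k => Nat.sub_pos_of_lt (Nat.mod_lt _ hn)
  have hred : ∀ k < r * n, 0 < d k ∧ ∃ a : ℕ → L, (∀ m, a m ∈ Wf K κ t y k m) ∧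
      y k ^ d k = ∑ m ∈ Finset.range (d k), a (m+1) * y k ^ (d k - 1 - m) := by
    intro k hk
    refine ⟨hpos k, ?_⟩
    have hi : k / n < r := Nat.div_lt_of_lt_mul (by rwa [mul_comm] at hk)
    have hk' : k / n * n + k % n = k := Nat.div_add_mod' k n
    have := red_rel (K := K) (κ := κ) (t := t) (y := y) (k / n * n) n ?_ (k % n) (Nat.mod_lt _ hn)
    · rw [hk'] at this; exact this
    · intro m hm
      have h1 : ∏ j ∈ Finset.Ico 0 n, (X - C (y (k / n * n + j))) =
          (f ⟨k/n, hi⟩).map (aeval t : K[X] →ₐ[K] L).toRingHom := by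
        rw [hx, ← Finset.range_eq_Ico, Finset.prod_range]
        refine Finset.prod_congr rfl fun j _ => ?_
        rw [← hyx ⟨k/n, hi⟩ j]
      rw [h1]
      rcases Nat.eq_zero_or_pos m with rfl | hm0
      · have h2 : (f ⟨k/n, hi⟩).coeff n = 1 := by
          have := (hmon ⟨k/n, hi⟩).coeff_natDegree
          rwa [hdeg] at this
        rw [coeff_map, Nat.sub_zero, h2, map_one]
        exact one_mem_Wf _ _
      · rw [coeff_map]
        change aeval t ((f ⟨k/n, hi⟩).coeff (n - m)) ∈ _
        rw [aeval_eq_sum_range]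
        refine Submodule.sum_mem _ fun a ha => Submodule.smul_mem _ _ (pow_mem_Wf ?_ _)
        have h3 := hκ ⟨k/n, hi⟩ (n - m)
        have h4 : κ * 1 ≤ κ * m := Nat.mul_le_mul_left _ hm0
        rw [Finset.mem_range] at ha; omega
  have hcard : Fintype.card ((k : Fin (r * n)) → Fin (d k)) = n.factorial ^ r := by
    rw [Fintype.card_pi]
    simp only [Fintype.card_fin]
    rw [← (finProdFinEquiv (m := r) (n := n)).prod_comp, Fintype.prod_prod_type]
    have : ∀ i : Fin r, ∏ j : Fin n, d (finProdFinEquiv (i, j) : Fin (r * n)) = n.factorial := by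
      intro i
      have h1 : ∀ j : Fin n, d (finProdFinEquiv (i, j) : Fin (r * n)) = n - j := by
        intro j
        simp only [hd, finProdFinEquiv_apply_val]
        rw [Nat.add_mul_mod_self_left, Nat.mod_eq_of_lt j.2]
      simp only [h1]
      rw [← Finset.prod_range (fun j => n - j), ← Finset.prod_range_reflect,
        ← Finset.prod_range_add_one_eq_factorial]
      refine Finset.prod_congr rfl fun j hj => ?_
      rw [Finset.mem_range] at hj; omega
    rw [Finset.prod_congr rfl fun i _ => this i]
    simp
  let e := Fintype.equivFinOfCardEq hcard
  have hZ1 : Zs K κ t x ≤ Wf K κ t y (r * n) 1 := by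
    rw [Zs, Submodule.span_le]
    rintro _ (⟨a, ha, rfl⟩ | ⟨⟨i, j⟩, rfl⟩)
    · exact pow_mem_Wf (by simpa using ha) _
    · simp only
      rw [← hyx]
      exact y_mem_Wf (hlt i i.2 j j.2)
  have hZ : ∀ D, Zs K κ t x ^ D ≤ Wf K κ t y (r * n) D := by
    intro D
    induction D with
    | zero =>
      rw [pow_zero, Submodule.one_le]; exact one_mem_Wf _ _
    | succ D ih =>
      rw [pow_succ, Submodule.mul_le]
      intro u hu v hv
      exact Wf_mul _ (ih hu) (hZ1 hv)
  refine ⟨fun a i j => e.symm a (finProdFinEquiv (i, j)),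
    fun a => ∏ j : Fin (r * n), y j ^ (e.symm a j : ℕ), fun a => ?_, fun a i j => ?_,
    ⟨e (fun k => ⟨0, hpos k⟩), by simp⟩, fun D => ?_⟩
  · beta_reduce
    rw [← (finProdFinEquiv (m := r) (n := n)).prod_comp, Fintype.prod_prod_type]
    refine Finset.prod_congr rfl fun i _ => Finset.prod_congr rfl fun j _ => ?_
    rw [← hyx]
    congr 2
    rw [finProdFinEquiv_apply_val, mul_comm, add_comm]
  · exact (e.symm a (finProdFinEquiv (i, j))).2.le.trans (Nat.sub_le _ _)
  · refine (hZ D).trans ((Wf_le_Bf _ hred D).trans ((Bf_le _ D).trans ?_))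
    apply Submodule.span_mono
    rintro _ ⟨⟨a, b⟩, rfl⟩
    exact ⟨⟨a, e b⟩, by simp⟩

end Red
end Pf

set_option linter.unusedSectionVars false

namespace Pf

/-- The coordinate ring of the Galois closure of the family, with all structure needed. -/
structure Geo (K : Type) [Field K] (r n κ : ℕ) (f : Fin r → K[X][X]) where
  S : Type
  [cr : CommRing S]
  [dom : IsDomain S]
  [alg : Algebra K S]
  t : S
  x : Fin r → Fin n → S
  φ : (Fin r → Equiv.Perm (Fin n)) →* (S ≃ₐ[K] S)
  φ_t : ∀ g, φ g t = t
  φ_x : ∀ g i j, φ g (x i j) = x i (g i j)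
  hx : ∀ i, (f i).map (aeval t : K[X] →ₐ[K] S).toRingHom = ∏ j, (X - C (x i j))
  E : Fin (n.factorial ^ r) → Fin r → Fin n → ℕ
  mon : Fin (n.factorial ^ r) → S
  mon_eq : ∀ e, mon e = ∏ i, ∏ j, x i j ^ E e i j
  E_le : ∀ e i j, E e i j ≤ n
  mon_one : ∃ e, mon e = 1
  span : ∀ D, Zs K κ t x ^ D ≤ Submodule.span K
        (Set.range fun p : Fin (κ * D + 1) × Fin (n.factorial ^ r) => t ^ (p.1 : ℕ) * mon p.2)
  indep : ∀ p : Fin (n.factorial ^ r) → K[X], ∑ e, aeval t (p e) * mon e = 0 → p = 0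
  inv : ∀ u : S, (∀ g, φ g u = u) → ∃ p q : K[X], q ≠ 0 ∧ aeval t q * u = aeval t p
  emb : ∀ (t₀ : K) (l : Fin r → Fin n → K), (∀ i, Function.Injective (l i)) →
    (∀ i, (f i).map (evalRingHom t₀) = ∏ j, (X - C (l i j))) →
    ∃ θ : S →ₐ[K] PowerSeries K, θ t = PowerSeries.C t₀ + PowerSeries.X ∧
      ∀ i j, PowerSeries.constantCoeff (θ (x i j)) = l i j

attribute [instance] Geo.cr Geo.dom Geo.alg

namespace Geo
variable {K : Type} [Field K] {r n κ : ℕ} {f : Fin r → K[X][X]} (G : Geo K r n κ f)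

/-- filtration space -/
abbrev Z (D : ℕ) : Submodule K G.S := Zs K κ G.t G.x ^ D

lemma φ_Z (g) {D : ℕ} {u : G.S} (hu : u ∈ G.Z D) : G.φ g u ∈ G.Z D := by
  have h1 : (Zs K κ G.t G.x).map ((G.φ g : G.S →ₐ[K] G.S)).toLinearMap ≤ Zs K κ G.t G.x := by
    conv_lhs => rw [Zs]
    rw [Submodule.map_span, Submodule.span_le]
    rintro _ ⟨_, (⟨a, ha, rfl⟩ | ⟨⟨i, j⟩, rfl⟩), rfl⟩
    · simpa [G.φ_t] using pow_mem_Zs (K := K) (t := G.t) G.x ha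
    · simpa [G.φ_x] using x_mem_Zs (K := K) (t := G.t) G.x i (g i j)
  have h2 : (G.Z D).map ((G.φ g : G.S →ₐ[K] G.S)).toLinearMap ≤ G.Z D := by
    rw [Submodule.map_pow]
    exact pow_le_pow_left' h1 D
  exact h2 ⟨u, hu, rfl⟩

lemma mon_mem (e) : G.mon e ∈ G.Z (r * n * n) := by
  rw [G.mon_eq]
  have h1 : ∀ i j, G.x i j ^ G.E e i j ∈ G.Z n := fun i j => by
    have h2 : G.x i j ∈ Zs K κ G.t G.x ^ 1 := by rw [pow_one]; exact x_mem_Zs _ i j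
    have := Zs_pow_mem G.x h2 (G.E e i j)
    exact Zs_pow_mono G.x (by simpa using G.E_le e i j) this
  have h3 := fun i => Zs_prod_mem G.x Finset.univ (fun _ => n) _ (fun j _ => h1 i j)
  have := Zs_prod_mem G.x Finset.univ (fun _ => ∑ _j : Fin n, n) _ (fun i _ => h3 i)
  simpa [mul_assoc] using this

lemma expand {D : ℕ} {u : G.S} (hu : u ∈ G.Z D) :
    ∃ p : Fin (n.factorial ^ r) → K[X], (∀ e, (p e).natDegree ≤ κ * D) ∧
      u = ∑ e, aeval G.t (p e) * G.mon e := by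
  have := G.span D hu
  rw [Submodule.mem_span_range_iff_exists_fun] at this
  obtain ⟨c, hc⟩ := this
  refine ⟨fun e => ∑ a : Fin (κ * D + 1), C (c (a, e)) * X ^ (a : ℕ), fun e => ?_, ?_⟩
  · refine natDegree_sum_le_of_forall_le _ _ fun a _ => ?_
    exact (natDegree_C_mul_X_pow_le _ _).trans (Nat.lt_succ_iff.1 a.2)
  · rw [← hc, Fintype.sum_prod_type, Finset.sum_comm]
    refine Finset.sum_congr rfl fun e _ => ?_
    rw [map_sum, Finset.sum_mul]
    refine Finset.sum_congr rfl fun a _ => ?_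
    simp [Algebra.smul_def, mul_assoc]

lemma t_inj {p : K[X]} (h : aeval G.t p = 0) : p = 0 := by
  obtain ⟨e, he⟩ := G.mon_one
  have := G.indep (fun _ => p) (by simp [h])
  exact congrFun this e

lemma norm {D : ℕ} {u : G.S} (hu : u ∈ G.Z D) (h0 : u ≠ 0) :
    ∃ p : K[X], p ≠ 0 ∧ p.natDegree ≤ κ * (n.factorial ^ r * D) ∧ aeval G.t p = ∏ g, G.φ g u := by
  have hG : Fintype.card (Fin r → Equiv.Perm (Fin n)) = n.factorial ^ r := by
    simp [Fintype.card_perm]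
  have h1 : ∏ g, G.φ g u ∈ G.Z (n.factorial ^ r * D) := by
    have := Zs_prod_mem G.x Finset.univ (fun _ => D) _ (fun g _ => G.φ_Z g hu)
    rw [Finset.sum_const, Finset.card_univ, hG, smul_eq_mul] at this
    exact this
  have h2 : ∀ h, G.φ h (∏ g, G.φ g u) = ∏ g, G.φ g u := by
    intro h
    rw [map_prod, ← Equiv.prod_comp (Equiv.mulLeft h) (fun g => G.φ g u)]
    refine Finset.prod_congr rfl fun g _ => ?_
    simp [map_mul]
  obtain ⟨p, q, hq, hpq⟩ := G.inv _ h2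
  obtain ⟨P, hP, hu'⟩ := G.expand h1
  obtain ⟨e0, he0⟩ := G.mon_one
  have h3 : ∏ g, G.φ g u ≠ 0 := by
    rw [Finset.prod_ne_zero_iff]
    intro g _
    simpa using h0
  have h4 : ∀ e, e ≠ e0 → P e = 0 := by
    intro e he
    have := G.indep (fun e => q * P e - if e = e0 then p else 0) (by
      simp only [map_sub, map_mul, sub_mul, Finset.sum_sub_distrib, mul_assoc]
      rw [← Finset.mul_sum, ← hu', hpq, Finset.sum_eq_single e0]
      · simp [he0]
      · intro b _ hb; simp [hb]
      · simp)
    have := congrFun this e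
    simp [he, hq] at this
    exact this
  have h5 : aeval G.t (P e0) = ∏ g, G.φ g u := by
    rw [hu', Finset.sum_eq_single e0, he0, mul_one]
    · intro b _ hb; simp [h4 b hb]
    · simp
  refine ⟨P e0, ?_, hP e0, h5⟩
  rintro h
  rw [h, map_zero] at h5
  exact h3 h5.symm

end Geo
end Pf

set_option linter.unusedSectionVars false

namespace Pf
lemma prod_mk_aux {ι A B : Type*} [CommRing A] [CommRing B] (s : Finset ι) (f : ι → A) (g : ι → B) :
    ∏ i ∈ s, (f i, g i) = (∏ i ∈ s, f i, ∏ i ∈ s, g i) := Prod.ext (by simp [Prod.fst_prod]) (by simp [Prod.snd_prod])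
lemma sum_mk_aux {ι A B : Type*} [CommRing A] [CommRing B] (s : Finset ι) (f : ι → A) (g : ι → B) :
    ∑ i ∈ s, (f i, g i) = (∑ i ∈ s, f i, ∑ i ∈ s, g i) := Prod.ext (by simp [Prod.fst_sum]) (by simp [Prod.snd_sum])

section pairs
variable {K S : Type*} [Field K] [CommRing S] [Nontrivial S] [Algebra K S] {r n κ : ℕ} {t : S}
  {x : Fin r → Fin n → S}

variable (K κ t x) in
/-- pair filtration -/
def PP (Ψ : S →+* S) : Submodule K (S × S) :=
  Submodule.span K ((fun u => (u, u)) '' (((fun a => t ^ a) '' {a | a ≤ κ}) ∪ Set.range (fun p : Fin r × Fin n => x p.1 p.2))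
    ∪ (fun u => (u, Ψ u)) '' (((fun a => t ^ a) '' {a | a ≤ κ}) ∪ Set.range (fun p : Fin r × Fin n => x p.1 p.2)))

variable {Ψ : S →+* S}

lemma PP_t {a : ℕ} (h : a ≤ κ) : (t ^ a, t ^ a) ∈ PP K κ t x Ψ :=
  Submodule.subset_span (Or.inl ⟨_, Or.inl ⟨a, h, rfl⟩, rfl⟩)
lemma PP_x (i j) : (x i j, x i j) ∈ PP K κ t x Ψ :=
  Submodule.subset_span (Or.inl ⟨_, Or.inr ⟨(i, j), rfl⟩, rfl⟩)
lemma PP_t' {a : ℕ} (h : a ≤ κ) : (t ^ a, Ψ (t ^ a)) ∈ PP K κ t x Ψ :=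
  Submodule.subset_span (Or.inr ⟨_, Or.inl ⟨a, h, rfl⟩, rfl⟩)
lemma PP_x' (i j) : (x i j, Ψ (x i j)) ∈ PP K κ t x Ψ :=
  Submodule.subset_span (Or.inr ⟨_, Or.inr ⟨(i, j), rfl⟩, rfl⟩)
lemma PP_one : (1 : S × S) ∈ PP K κ t x Ψ := by
  have := PP_t (K := K) (t := t) (x := x) (Ψ := Ψ) (Nat.zero_le κ)
  rw [pow_zero] at this; exact this

lemma PP_mono {D D' : ℕ} (h : D ≤ D') : PP K κ t x Ψ ^ D ≤ PP K κ t x Ψ ^ D' := by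
  apply pow_le_pow_right' _ h
  rw [Submodule.one_le]
  exact PP_one

lemma PP_mul {D D' : ℕ} {u v : S × S} (hu : u ∈ PP K κ t x Ψ ^ D) (hv : v ∈ PP K κ t x Ψ ^ D') :
    u * v ∈ PP K κ t x Ψ ^ (D + D') := by
  rw [pow_add]; exact Submodule.mul_mem_mul hu hv

lemma PP_one' : (1 : S × S) ∈ PP K κ t x Ψ ^ 0 := by
  rw [pow_zero]; exact Submodule.one_le.1 le_rfl

lemma PP_prod {ι : Type*} (s : Finset ι) (D : ι → ℕ) (u : ι → S × S)
    (hu : ∀ i ∈ s, u i ∈ PP K κ t x Ψ ^ D i) : ∏ i ∈ s, u i ∈ PP K κ t x Ψ ^ (∑ i ∈ s, D i) := by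
  classical
  induction s using Finset.induction_on with
  | empty =>
    rw [Finset.prod_empty, Finset.sum_empty]; exact PP_one'
  | insert a s ha ih =>
    rw [Finset.prod_insert ha, Finset.sum_insert ha]
    exact PP_mul (hu a (by simp)) (ih fun i hi => hu i (by simp [hi]))

lemma PP_pow {D : ℕ} {u : S × S} (hu : u ∈ PP K κ t x Ψ ^ D) (k : ℕ) :
    u ^ k ∈ PP K κ t x Ψ ^ (k * D) := by
  rw [mul_comm, pow_mul]; exact Submodule.pow_mem_pow _ hu k

lemma PP_fst {D : ℕ} {u v : S} (h : (u, v) ∈ PP K κ t x Ψ ^ D) : u ∈ Zs K κ t x ^ D := by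
  have h1 : (PP K κ t x Ψ).map (AlgHom.fst K S S).toLinearMap ≤ Zs K κ t x := by
    conv_lhs => rw [PP]
    rw [Submodule.map_span, Submodule.span_le]
    rintro _ ⟨_, (⟨u, hu, rfl⟩ | ⟨u, hu, rfl⟩), rfl⟩ <;> exact Submodule.subset_span hu
  have h2 : (PP K κ t x Ψ ^ D).map (AlgHom.fst K S S).toLinearMap ≤ Zs K κ t x ^ D := by
    rw [Submodule.map_pow]
    exact pow_le_pow_left' h1 D
  exact h2 ⟨_, h, rfl⟩

lemma PP_diag {D : ℕ} {u : S} (h : u ∈ Zs K κ t x ^ D) : (u, u) ∈ PP K κ t x Ψ ^ D := by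
  have h1 : (Zs K κ t x).map ((AlgHom.id K S).prod (AlgHom.id K S)).toLinearMap ≤ PP K κ t x Ψ := by
    conv_lhs => rw [Zs]
    rw [Submodule.map_span, Submodule.span_le]
    rintro _ ⟨u, hu, rfl⟩
    exact Submodule.subset_span (Or.inl ⟨u, hu, rfl⟩)
  have h2 : (Zs K κ t x ^ D).map ((AlgHom.id K S).prod (AlgHom.id K S)).toLinearMap ≤ PP K κ t x Ψ ^ D := by
    rw [Submodule.map_pow]
    exact pow_le_pow_left' h1 D
  exact h2 ⟨_, h, rfl⟩

lemma PP_mon {D D' : ℕ} {u v : S} (h : (u, Ψ u) ∈ PP K κ t x Ψ ^ D) (h' : (v, Ψ v) ∈ PP K κ t x Ψ ^ D') :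
    (u * v, Ψ (u * v)) ∈ PP K κ t x Ψ ^ (D + D') := by
  rw [map_mul]; exact PP_mul h h'

lemma PP_mon_pow {D : ℕ} {u : S} (h : (u, Ψ u) ∈ PP K κ t x Ψ ^ D) (k : ℕ) :
    (u ^ k, Ψ (u ^ k)) ∈ PP K κ t x Ψ ^ (k * D) := by
  rw [map_pow]; exact PP_pow h k

lemma PP_mon_prod {ι : Type*} (s : Finset ι) (D : ι → ℕ) (u : ι → S)
    (hu : ∀ i ∈ s, (u i, Ψ (u i)) ∈ PP K κ t x Ψ ^ D i) :
    (∏ i ∈ s, u i, Ψ (∏ i ∈ s, u i)) ∈ PP K κ t x Ψ ^ (∑ i ∈ s, D i) := by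
  have := PP_prod s D (fun i => (u i, Ψ (u i))) hu
  rwa [prod_mk_aux, ← map_prod] at this

lemma PP_tpow {a D : ℕ} (h : a ≤ κ * D) : (t ^ a, Ψ (t ^ a)) ∈ PP K κ t x Ψ ^ D := by
  induction D generalizing a with
  | zero =>
    have h0 : a = 0 := Nat.le_zero.1 (h.trans (le_of_eq (Nat.mul_zero κ)))
    rw [h0, pow_zero t, map_one]
    exact PP_one'
  | succ D ih =>
    by_cases ha : a ≤ κ
    · refine PP_mono (show 1 ≤ D + 1 by omega) ?_
      rw [pow_one]; exact PP_t' ha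
    · have hle : a - κ ≤ κ * D := by rw [Nat.mul_succ] at h; omega
      have h1 : t ^ a = t ^ (a - κ) * t ^ κ := by rw [← pow_add]; congr 1; omega
      rw [h1]
      exact PP_mon (ih hle) (by rw [pow_one]; exact PP_t' le_rfl)

variable (x Ψ) in
/-- the product -/
def PI : S := ∏ p : Fin r × Fin n, ∏ k ∈ Finset.univ.erase p.2, (x p.1 p.2 - Ψ (x p.1 k))

lemma PP_B (i : Fin r) (j : Fin n) (s : Finset (Fin n)) :
    ∃ a, (a, ∏ k ∈ s, (x i j - Ψ (x i k))) ∈ PP K κ t x Ψ ^ n := by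
  have h1 : ∀ k ∈ s, ((x i j, x i j) - (x i k, Ψ (x i k)) : S × S) ∈ PP K κ t x Ψ ^ 1 := by
    intro k _
    rw [pow_one]; exact Submodule.sub_mem _ (PP_x i j) (PP_x' i k)
  have := PP_prod s (fun _ => 1) _ h1
  simp only [Prod.mk_sub_mk, prod_mk_aux] at this
  refine ⟨_, PP_mono ?_ this⟩
  simpa using Finset.card_le_univ s

lemma PP_PI (s : Finset (Fin r × Fin n)) :
    ∃ a, (a, ∏ p ∈ s, ∏ k ∈ Finset.univ.erase p.2, (x p.1 p.2 - Ψ (x p.1 k))) ∈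
      PP K κ t x Ψ ^ (r * n * n) := by
  choose a ha using fun p : Fin r × Fin n => PP_B (K := K) (κ := κ) (t := t) (x := x) (Ψ := Ψ) p.1 p.2 (Finset.univ.erase p.2)
  have := PP_prod s (fun _ => n) _ (fun p _ => ha p)
  rw [prod_mk_aux] at this
  refine ⟨_, PP_mono ?_ this⟩
  rw [Finset.sum_const, smul_eq_mul]
  refine Nat.mul_le_mul_right _ ?_
  simpa using Finset.card_le_univ s

lemma PP_Q {a : ℕ} (h : a ≤ κ) : ∃ b c, (b, c) ∈ PP K κ t x Ψ ^ 2 ∧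
    Ψ t ^ a - t ^ a = (Ψ t - t) * c := by
  have h1 : ∀ i ∈ Finset.range a, ((t ^ i, Ψ (t ^ i)) * (t ^ (a - 1 - i), t ^ (a - 1 - i)) : S × S) ∈
      PP K κ t x Ψ ^ 2 := by
    intro i hi
    rw [Finset.mem_range] at hi
    rw [pow_two]
    exact Submodule.mul_mem_mul (PP_t' (by omega)) (PP_t (by omega))
  have h2 := Submodule.sum_mem _ h1
  simp only [Prod.mk_mul_mk, sum_mk_aux] at h2
  refine ⟨_, _, h2, ?_⟩
  rw [← geom_sum₂_mul, mul_comm]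
  simp only [map_pow]

lemma PP_H (f : K[X][X]) (hdeg : f.natDegree ≤ n) (hκ : ∀ m, (f.coeff m).natDegree ≤ κ) (i : Fin r) (j : Fin n) :
    ∃ b c, (b, c) ∈ PP K κ t x Ψ ^ (n + 2) ∧
      (f.map (aeval (Ψ t) : K[X] →ₐ[K] S).toRingHom).eval (x i j) -
      (f.map (aeval t : K[X] →ₐ[K] S).toRingHom).eval (x i j) = (Ψ t - t) * c := by
  have hQ : ∀ a, ∃ b c, a ≤ κ → (b, c) ∈ PP K κ t x Ψ ^ 2 ∧
    Ψ t ^ a - t ^ a = (Ψ t - t) * c := by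
    intro a
    by_cases h : a ≤ κ
    · obtain ⟨b, c, h⟩ := PP_Q (K := K) (κ := κ) (t := t) (x := x) (Ψ := Ψ) h
      exact ⟨b, c, fun _ => h⟩
    · exact ⟨0, 0, fun h' => absurd h' h⟩
  choose b c hbc using hQ
  have h1 : ∀ m ∈ Finset.range (n + 1), ∀ a ∈ Finset.range (κ + 1),
      ((f.coeff m).coeff a) • ((b a, c a) * (x i j, x i j) ^ m) ∈ PP K κ t x Ψ ^ (n + 2) := by
    intro m hm a ha
    rw [Finset.mem_range] at hm ha
    refine Submodule.smul_mem _ _ ?_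
    have h3 : (x i j, x i j) ∈ PP K κ t x Ψ ^ 1 := by rw [pow_one]; exact PP_x i j
    exact PP_mono (by omega) (PP_mul (hbc a (by omega)).1 (PP_pow h3 m))
  have h2 := Submodule.sum_mem _ fun m hm => Submodule.sum_mem _ (h1 m hm)
  simp only [Prod.pow_mk, Prod.mk_mul_mk, Prod.smul_mk, sum_mk_aux] at h2
  refine ⟨_, _, h2, ?_⟩
  have h4 : ∀ y : S, ∀ m, aeval y (f.coeff m) = ∑ a ∈ Finset.range (κ + 1), ((f.coeff m).coeff a) • y ^ a := by
    intro y m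
    rw [aeval_eq_sum_range' (Nat.lt_succ_of_le (hκ m))]
  have h5 : ∀ y : S, (f.map (aeval y : K[X] →ₐ[K] S).toRingHom).eval (x i j) =
      ∑ m ∈ Finset.range (n + 1), (aeval y (f.coeff m)) * x i j ^ m := by
    intro y
    rw [eval_map, eval₂_eq_sum_range' _ (Nat.lt_succ_of_le hdeg)]
    rfl
  rw [h5, h5, ← Finset.sum_sub_distrib, Finset.mul_sum]
  refine Finset.sum_congr rfl fun m _ => ?_
  rw [h4, h4, ← sub_mul, ← Finset.sum_sub_distrib, Finset.mul_sum, Finset.sum_mul]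
  refine Finset.sum_congr rfl fun a ha => ?_
  rw [← smul_sub, (hbc a (by rw [Finset.mem_range] at ha; omega)).2]
  simp only [Algebra.smul_def]
  ring

theorem PP_main (f : Fin r → K[X][X]) (hdeg : ∀ i, (f i).natDegree ≤ n)
    (hκ : ∀ i m, ((f i).coeff m).natDegree ≤ κ)
    (hx : ∀ i, (f i).map (aeval t : K[X] →ₐ[K] S).toRingHom = ∏ j, (X - C (x i j)))
    (hx' : ∀ i, (f i).map (aeval (Ψ t) : K[X] →ₐ[K] S).toRingHom = ∏ j, (X - C (Ψ (x i j)))) :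
    ∀ D, ∀ u ∈ PP K κ t x Ψ ^ D, ∃ v ∈ PP K κ t x Ψ ^ (D + (r * n * n + n + 2)),
      PI x Ψ * (u.2 - u.1) = (Ψ t - t) * v.2 := by
  -- the set of good elements is a submodule
  set c := r * n * n + n + 2 with hc
  have hsub : ∀ D, ∃ W : Submodule K (S × S), ∀ u, u ∈ W ↔ ∃ v ∈ PP K κ t x Ψ ^ (D + c),
      PI x Ψ * (u.2 - u.1) = (Ψ t - t) * v.2 := by
    intro D
    refine ⟨{ carrier := {u | ∃ v ∈ PP K κ t x Ψ ^ (D + c), PI x Ψ * (u.2 - u.1) = (Ψ t - t) * v.2},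
              add_mem' := ?_, zero_mem' := ?_, smul_mem' := ?_ }, fun u => Iff.rfl⟩
    · rintro a b ⟨v, hv, h1⟩ ⟨w, hw, h2⟩
      refine ⟨v + w, Submodule.add_mem _ hv hw, ?_⟩
      simp only [Prod.snd_add, Prod.fst_add, mul_add, ← h1, ← h2]; ring
    · exact ⟨0, Submodule.zero_mem _, by simp⟩
    · rintro k a ⟨v, hv, h1⟩
      refine ⟨k • v, Submodule.smul_mem _ _ hv, ?_⟩
      simp only [Prod.smul_snd, Prod.smul_fst, ← smul_sub, mul_smul_comm, h1]
  have h1 : ∀ u ∈ PP K κ t x Ψ, ∃ v ∈ PP K κ t x Ψ ^ c, PI x Ψ * (u.2 - u.1) = (Ψ t - t) * v.2 := by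
    obtain ⟨W, hW⟩ := hsub 0
    rw [zero_add] at hW
    suffices h : PP K κ t x Ψ ≤ W from fun u hu => (hW u).1 (h hu)
    rw [PP, Submodule.span_le]
    rintro _ (⟨u, hu, rfl⟩ | ⟨u, (⟨a, ha, rfl⟩ | ⟨⟨i, j⟩, rfl⟩), rfl⟩)
    · exact (hW _).2 ⟨0, Submodule.zero_mem _, by simp⟩
    · obtain ⟨b, e, h1, h2⟩ := PP_Q (K := K) (κ := κ) (t := t) (x := x) (Ψ := Ψ) ha
      obtain ⟨a', h3⟩ := PP_PI (K := K) (κ := κ) (t := t) (x := x) (Ψ := Ψ) Finset.univ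
      refine (hW _).2 ⟨_, PP_mono (show r * n * n + 2 ≤ c by omega) (PP_mul h3 h1), ?_⟩
      simp only [Prod.mk_mul_mk, map_pow, h2]
      rw [PI]; ring
    · obtain ⟨b, e, h1, h2⟩ := PP_H (K := K) (κ := κ) (t := t) (x := x) (Ψ := Ψ) (f i) (hdeg i) (hκ i) i j
      obtain ⟨a', h3⟩ := PP_PI (K := K) (κ := κ) (t := t) (x := x) (Ψ := Ψ) (Finset.univ.erase (i, j))
      refine (hW _).2 ⟨_, PP_mono (show r * n * n + (n + 2) ≤ c by omega) (Submodule.neg_mem _ (PP_mul h3 h1)), ?_⟩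
      rw [hx, hx', eval_prod, eval_prod, Finset.prod_eq_zero (i := j) (f := fun k => eval (x i j) (X - C (x i k))) (Finset.mem_univ j) (by simp), sub_zero,
        ← Finset.mul_prod_erase _ _ (Finset.mem_univ j)] at h2
      simp only [eval_sub, eval_X, eval_C] at h2
      simp only [Prod.mk_mul_mk, Prod.snd_neg]
      rw [PI, ← Finset.mul_prod_erase _ _ (Finset.mem_univ (i, j))]
      linear_combination (- ∏ p ∈ Finset.univ.erase (i, j), ∏ k ∈ Finset.univ.erase p.2, (x p.1 p.2 - Ψ (x p.1 k))) * h2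
  intro D
  induction D with
  | zero =>
    intro u hu
    rw [pow_zero, Submodule.mem_one] at hu
    obtain ⟨k, rfl⟩ := hu
    exact ⟨0, Submodule.zero_mem _, by simp⟩
  | succ D ih =>
    obtain ⟨W, hW⟩ := hsub (D + 1)
    suffices h : PP K κ t x Ψ ^ (D + 1) ≤ W from fun u hu => (hW u).1 (h hu)
    rw [pow_succ, Submodule.mul_le]
    rintro ⟨a1, b1⟩ hu ⟨a2, b2⟩ hv
    rw [hW]
    obtain ⟨v1, hv1, h2⟩ := ih _ hu
    obtain ⟨v2, hv2, h3⟩ := h1 _ hv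
    have h4 : v1 * (a2, b2) + (a1, a1) * v2 ∈ PP K κ t x Ψ ^ (D + 1 + c) := by
      refine Submodule.add_mem _ ?_ ?_
      · have := PP_mul hv1 (show _ ∈ PP K κ t x Ψ ^ 1 by rw [pow_one]; exact hv)
        convert this using 2; ring
      · have := PP_mul (PP_diag (Ψ := Ψ) (PP_fst hu)) hv2
        exact PP_mono (by omega) this
    refine ⟨_, h4, ?_⟩
    simp only [Prod.mk_mul_mk, Prod.snd_add, Prod.snd_mul] at h2 h3 ⊢
    linear_combination b2 * h2 + a1 * h3

end pairs
end Pf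

set_option linter.unusedSectionVars false

namespace Pf

section ps
variable {K : Type*} [Field K]

lemma aeval_ps (t₀ : K) (p : K[X]) :
    aeval (PowerSeries.C t₀ + PowerSeries.X) p = ((taylor t₀ p : K[X]) : PowerSeries K) := by
  rw [taylor_apply, comp, ← coeToPowerSeries.ringHom_apply, hom_eval₂, aeval_def]
  congr 1
  · ext x
    simp
  · simp [add_comm]

lemma ps_mult {t₀ : K} {p : K[X]} (hp : p ≠ 0) {N : ℕ}
    (h : PowerSeries.X ^ N ∣ aeval (PowerSeries.C t₀ + PowerSeries.X) p) :
    N ≤ p.rootMultiplicity t₀ := by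
  rw [aeval_ps, PowerSeries.X_pow_dvd_iff] at h
  rw [rootMultiplicity_eq_natTrailingDegree]
  apply le_natTrailingDegree
  · intro h0
    have : taylor t₀ p = 0 := h0
    exact hp (by simpa using this)
  · intro k hk
    have := h k hk
    rw [Polynomial.coeff_coe] at this
    exact this

lemma ps_key (p k : ℕ) [Fact p.Prime] [CharP K p] {ι : Type*} [Fintype ι]
    (w z : ι → PowerSeries K) (h : ∑ i, w i * z i ^ (p ^ k) = 0) (hz : ∃ i, z i ≠ 0) :
    ∃ c : ι → K, (∃ i, c i ≠ 0) ∧ PowerSeries.X ^ (p ^ k) ∣ ∑ i, PowerSeries.C (c i) * w i := by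
  classical
  have hex : ∃ v : ℕ, ¬ ∀ i, PowerSeries.X ^ (v + 1) ∣ z i := by
    obtain ⟨i, hi⟩ := hz
    refine ⟨(z i).order.toNat, fun h => ?_⟩
    have h1 := PowerSeries.X_pow_dvd_iff.1 (h i) _ (Nat.lt_succ_self _)
    exact PowerSeries.coeff_order hi h1
  obtain ⟨v, h1, h2⟩ : ∃ v : ℕ, (¬ ∀ i, PowerSeries.X ^ (v + 1) ∣ z i) ∧ ∀ i, PowerSeries.X ^ v ∣ z i := by
    refine ⟨Nat.find hex, Nat.find_spec hex, ?_⟩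
    rcases Nat.eq_zero_or_pos (Nat.find hex) with h0 | h0
    · rw [h0]; simp
    · have := Nat.find_min hex (m := Nat.find hex - 1) (by omega)
      rw [not_not] at this
      rwa [show Nat.find hex - 1 + 1 = Nat.find hex by omega] at this
  choose z' hz' using h2
  choose y hy using fun i => PowerSeries.X_dvd_iff.2 (show PowerSeries.constantCoeff (z' i - PowerSeries.C (PowerSeries.constantCoeff (z' i))) = 0 by simp)
  have : CharP (PowerSeries K) p := charP_of_injective_algebraMap (algebraMap K (PowerSeries K)).injective p
  have h3 : ∀ i, z' i ^ (p ^ k) = PowerSeries.C (PowerSeries.constantCoeff (z' i) ^ (p ^ k)) + PowerSeries.X ^ (p ^ k) * y i ^ (p ^ k) := by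
    intro i
    have := eq_add_of_sub_eq' (hy i)
    conv_lhs => rw [this]
    rw [add_pow_char_pow, mul_pow, map_pow]
  refine ⟨fun i => PowerSeries.constantCoeff (z' i) ^ (p ^ k), ?_, ?_⟩
  · push Not at h1
    obtain ⟨i, hi⟩ := h1
    refine ⟨i, pow_ne_zero _ fun h0 => hi ?_⟩
    rw [← PowerSeries.X_dvd_iff] at h0
    rw [hz' i, pow_succ]
    exact mul_dvd_mul_left _ h0
  · have h4 : ∑ i, w i * z' i ^ (p ^ k) = 0 := by
      have : PowerSeries.X ^ (v * p ^ k) * ∑ i, w i * z' i ^ (p ^ k) = 0 := by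
        rw [← h, Finset.mul_sum]
        refine Finset.sum_congr rfl fun i _ => ?_
        rw [hz' i, mul_pow, pow_mul]; ring
      exact (mul_eq_zero.1 this).resolve_left (pow_ne_zero _ PowerSeries.X_ne_zero)
    refine ⟨- ∑ i, w i * y i ^ (p ^ k), ?_⟩
    rw [← sub_eq_zero, ← h4, mul_neg, sub_neg_eq_add, Finset.mul_sum, ← Finset.sum_add_distrib]
    refine Finset.sum_congr rfl fun i _ => ?_
    rw [h3]; ring
end ps

lemma sum_rootMult_le {K : Type*} [Field K] (p : K[X]) (hp : p ≠ 0) (T : Finset K) :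
    ∑ t ∈ T, p.rootMultiplicity t ≤ p.natDegree := by
  classical
  refine le_trans ?_ (card_roots' p)
  rw [← Multiset.toFinset_sum_count_eq]
  simp only [count_roots]
  refine Finset.sum_le_sum_of_ne_zero fun t _ ht => ?_
  rw [Multiset.mem_toFinset, mem_roots hp]
  by_contra h
  exact ht (rootMultiplicity_eq_zero h)

namespace Geo
variable {K : Type} [Field K] {r n κ : ℕ} {f : Fin r → K[X][X]} (G : Geo K r n κ f)

lemma indep' {N : ℕ} (c : Fin N × Fin (n.factorial ^ r) → K)
    (h : ∑ β, c β • (G.t ^ (β.1 : ℕ) * G.mon β.2) = 0) : c = 0 := by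
  have := G.indep (fun e => ∑ a : Fin N, C (c (a, e)) * X ^ (a : ℕ)) (by
    rw [← h, Fintype.sum_prod_type, Finset.sum_comm]
    refine Finset.sum_congr rfl fun e _ => ?_
    rw [map_sum, Finset.sum_mul]
    refine Finset.sum_congr rfl fun a _ => ?_
    simp [Algebra.smul_def, mul_assoc])
  funext ⟨a, e⟩
  have h1 := congrArg (fun p : K[X] => p.coeff a) (congrFun this e)
  simp only [Pi.zero_apply, coeff_zero, finsetSum_coeff, coeff_C_mul, coeff_X_pow] at h1
  rw [Finset.sum_eq_single a] at h1
  · simpa using h1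
  · intro b _ hb
    have : (a : ℕ) ≠ b := fun h => hb (Fin.ext h.symm)
    simp [this]
  · simp

lemma θ_inj {t₀ : K} (θ : G.S →ₐ[K] PowerSeries K) (hθ : θ G.t = PowerSeries.C t₀ + PowerSeries.X)
    {D : ℕ} {u : G.S} (hu : u ∈ G.Z D) (h0 : u ≠ 0) : θ u ≠ 0 := by
  intro h
  obtain ⟨p, hp, -, h1⟩ := G.norm hu h0
  have h2 : aeval (PowerSeries.C t₀ + PowerSeries.X) p = 0 := by
    rw [← hθ, aeval_algHom_apply, h1, map_prod]
    refine Finset.prod_eq_zero (Finset.mem_univ 1) ?_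
    rw [map_one]; exact h
  have := ps_mult (N := p.natDegree + 1) hp (by rw [h2]; exact dvd_zero _)
  have h3 := sum_rootMult_le p hp {t₀}
  simp at h3
  omega

lemma nonvanish {t₀ : K} (θ : G.S →ₐ[K] PowerSeries K) (hθ : θ G.t = PowerSeries.C t₀ + PowerSeries.X)
    (p k : ℕ) [Fact p.Prime] [CharP K p] (N l : ℕ) (hN : N ≤ κ * l + 1)
    (hq : κ * (n.factorial ^ r * (l + r * n * n)) < p ^ k) {D : ℕ}
    (z : Fin N × Fin (n.factorial ^ r) → G.S) (hzD : ∀ a, z a ∈ G.Z D)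
    (h : ∑ a, G.t ^ (a.1 : ℕ) * G.mon a.2 * z a ^ (p ^ k) = 0) : z = 0 := by
  by_contra hz
  obtain ⟨a₀, ha₀⟩ := Function.ne_iff.1 hz
  obtain ⟨c, ⟨a₁, hc⟩, hdvd⟩ := ps_key p k (fun a => θ (G.t ^ (a.1 : ℕ) * G.mon a.2)) (fun a => θ (z a))
    (by rw [← map_zero θ, ← h, map_sum]; simp only [map_mul, map_pow]) ⟨a₀, G.θ_inj θ hθ (hzD a₀) ha₀⟩
  set u := ∑ a, c a • (G.t ^ (a.1 : ℕ) * G.mon a.2) with hu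
  have hu0 : u ≠ 0 := fun h0 => hc (congrFun (G.indep' c h0) a₁)
  have huZ : u ∈ G.Z (l + r * n * n) := by
    refine Submodule.sum_mem _ fun a _ => Submodule.smul_mem _ _ (Zs_mul_mem _ (Zs_pow_pow_mem _ ?_) (G.mon_mem _))
    have := a.1.2; omega
  obtain ⟨P, hP, hdeg, h1⟩ := G.norm huZ hu0
  have h2 : PowerSeries.X ^ (p ^ k) ∣ aeval (PowerSeries.C t₀ + PowerSeries.X) P := by
    rw [← hθ, aeval_algHom_apply, h1, map_prod]
    refine Dvd.dvd.trans ?_ (Finset.dvd_prod_of_mem _ (Finset.mem_univ 1))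
    rw [map_one]
    convert hdvd using 1
    change θ u = _
    rw [hu, map_sum]
    refine Finset.sum_congr rfl fun a _ => ?_
    rw [map_smul, PowerSeries.smul_eq_C_mul]
  have h3 := ps_mult hP h2
  have h4 := sum_rootMult_le P hP {t₀}
  simp at h4
  omega

end Geo
end Pf

set_option linter.unusedSectionVars false

namespace Pf

lemma exists_kernel {K : Type*} [Field K] {A B : Type*} [Fintype A] [Fintype B]
    (h : Fintype.card B < Fintype.card A) (m : A → B → K) :
    ∃ c : A → K, c ≠ 0 ∧ ∀ b, ∑ a, c a * m a b = 0 := by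
  let T : (A → K) →ₗ[K] (B → K) :=
    { toFun := fun c b => ∑ a, c a * m a b
      map_add' := fun c c' => by
        funext b; simp [add_mul, Finset.sum_add_distrib]
      map_smul' := fun k c => by
        funext b; simp [Finset.mul_sum, mul_assoc] }
  have := LinearMap.ker_ne_bot_of_finrank_lt (f := T) (by simpa using h)
  obtain ⟨c, hc, hc0⟩ := Submodule.exists_mem_ne_zero_of_ne_bot this
  exact ⟨c, hc0, fun b => congrFun (LinearMap.mem_ker.1 hc) b⟩

namespace Geo
variable {K : Type} [Field K] {r n κ : ℕ} {f : Fin r → K[X][X]} (G : Geo K r n κ f)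

/-- twisted Frobenius -/
noncomputable def Psi (p k : ℕ) [Fact p.Prime] [CharP K p] (σ : Fin r → Equiv.Perm (Fin n)) : G.S →+* G.S :=
  haveI : CharP G.S p := charP_of_injective_algebraMap (algebraMap K G.S).injective p
  (iterateFrobenius G.S p k).comp (G.φ σ : G.S →+* G.S)

variable (p k : ℕ) [Fact p.Prime] [CharP K p] (σ : Fin r → Equiv.Perm (Fin n))

lemma Psi_apply (u : G.S) : G.Psi p k σ u = (G.φ σ u) ^ (p ^ k) := by
  have : CharP G.S p := charP_of_injective_algebraMap (algebraMap K G.S).injective p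
  simp [Psi, iterateFrobenius_def]

lemma Psi_smul (c : K) (u : G.S) : G.Psi p k σ (c • u) = c ^ (p ^ k) • G.Psi p k σ u := by
  rw [Psi_apply, Psi_apply, map_smul, _root_.smul_pow]

lemma Psi_aeval (c : K[X]) (hc : ∀ a, c.coeff a ^ (p ^ k) = c.coeff a) :
    G.Psi p k σ (aeval G.t c) = aeval (G.Psi p k σ G.t) c := by
  rw [aeval_eq_sum_range, aeval_eq_sum_range, map_sum]
  refine Finset.sum_congr rfl fun a _ => ?_
  rw [Psi_smul, hc, map_pow]

lemma hx' (hrat : ∀ i m a, ((f i).coeff m).coeff a ^ (p ^ k) = ((f i).coeff m).coeff a) (i) :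
    (f i).map (aeval (G.Psi p k σ G.t) : K[X] →ₐ[K] G.S).toRingHom =
      ∏ j, (X - C (G.Psi p k σ (G.x i j))) := by
  have h := congrArg (Polynomial.map (G.Psi p k σ)) (G.hx i)
  rw [Polynomial.map_prod] at h
  simp only [Polynomial.map_sub, map_X, map_C] at h
  rw [← h]
  ext m
  simp only [coeff_map]
  exact (G.Psi_aeval p k σ _ (hrat i m)).symm

lemma exists_seq (hdeg : ∀ i, (f i).natDegree ≤ n) (hκ : ∀ i m, ((f i).coeff m).natDegree ≤ κ)
    (hrat : ∀ i m a, ((f i).coeff m).coeff a ^ (p ^ k) = ((f i).coeff m).coeff a)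
    (D : ℕ) (u : G.S × G.S) (hu : u ∈ PP K κ G.t G.x (G.Psi p k σ) ^ D) :
    ∃ s : ℕ → G.S × G.S, s 0 = u ∧
      (∀ j, s j ∈ PP K κ G.t G.x (G.Psi p k σ) ^ (D + j * (r * n * n + n + 2))) ∧
      ∀ j, PI G.x (G.Psi p k σ) * ((s j).2 - (s j).1) = (G.Psi p k σ G.t - G.t) * (s (j + 1)).2 := by
  have main := PP_main f hdeg hκ G.hx (G.hx' p k σ hrat)
  have : ∀ j : ℕ, ∀ u : G.S × G.S, ∃ v, u ∈ PP K κ G.t G.x (G.Psi p k σ) ^ (D + j * (r * n * n + n + 2)) →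
      v ∈ PP K κ G.t G.x (G.Psi p k σ) ^ (D + (j + 1) * (r * n * n + n + 2)) ∧
      PI G.x (G.Psi p k σ) * (u.2 - u.1) = (G.Psi p k σ G.t - G.t) * v.2 := by
    intro j u
    by_cases h : u ∈ PP K κ G.t G.x (G.Psi p k σ) ^ (D + j * (r * n * n + n + 2))
    · obtain ⟨v, hv, h1⟩ := main _ u h
      refine ⟨v, fun _ => ⟨?_, h1⟩⟩
      rw [Nat.succ_mul, ← add_assoc]; exact hv
    · exact ⟨0, fun h' => absurd h' h⟩
  choose nx hnx using this
  let s : ℕ → G.S × G.S := fun j => Nat.rec u (fun j v => nx j v) j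
  have hs : ∀ j, s j ∈ PP K κ G.t G.x (G.Psi p k σ) ^ (D + j * (r * n * n + n + 2)) := by
    intro j
    induction j with
    | zero =>
      rw [zero_mul, add_zero]; exact hu
    | succ j ih => exact (hnx j _ ih).1
  exact ⟨s, rfl, hs, fun j => (hnx j _ (hs j)).2⟩

lemma mon_PP (e) : (G.mon e, G.Psi p k σ (G.mon e)) ∈ PP K κ G.t G.x (G.Psi p k σ) ^ (r * n * n) := by
  rw [G.mon_eq]
  have h1 : ∀ i j, (G.x i j ^ G.E e i j, G.Psi p k σ (G.x i j ^ G.E e i j)) ∈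
      PP K κ G.t G.x (G.Psi p k σ) ^ n := fun i j => by
    have h2 : (G.x i j, G.Psi p k σ (G.x i j)) ∈ PP K κ G.t G.x (G.Psi p k σ) ^ 1 := by
      rw [pow_one]; exact PP_x' i j
    have := PP_mon_pow h2 (G.E e i j)
    exact PP_mono (by simpa using G.E_le e i j) this
  have h3 := fun i => PP_mon_prod Finset.univ (fun _ => n) _ (fun j _ => h1 i j)
  have := PP_mon_prod Finset.univ (fun _ => ∑ _j : Fin n, n) _ (fun i _ => h3 i)
  simpa [mul_assoc] using this

/-- existence of the auxiliary function -/
lemma exists_aux (hκ1 : 1 ≤ κ) (hdeg : ∀ i, (f i).natDegree ≤ n) (hκ : ∀ i m, ((f i).coeff m).natDegree ≤ κ)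
    (hrat : ∀ i m a, ((f i).coeff m).coeff a ^ (p ^ k) = ((f i).coeff m).coeff a)
    (m M C' l : ℕ) (hM : M + 1 = κ * m * n.factorial ^ r)
    (hC' : C' = 2 * (r * n * n) + m + M * (r * n * n + n + 2))
    (hl : l = M * (κ * C' + 1) + 1) :
    ∃ c : (Fin (κ * l) × Fin (n.factorial ^ r)) → (Fin (κ * m) × Fin (n.factorial ^ r)) → K, c ≠ 0 ∧ ∃ F',
      PI G.x (G.Psi p k σ) ^ M * (∑ a, ∑ β, c a β • ((G.t ^ (a.1 : ℕ) * G.mon a.2) *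
        G.Psi p k σ (G.t ^ (β.1 : ℕ) * G.mon β.2))) = (G.Psi p k σ G.t - G.t) ^ M * F' := by
  classical
  set d := n.factorial ^ r with hd
  have hseq := fun (β : Fin (κ * m) × Fin d) =>
    G.exists_seq p k σ hdeg hκ hrat (m + r * n * n) _
      (PP_mon (PP_tpow (K := K) (x := G.x) (t := G.t) (Ψ := G.Psi p k σ) (a := β.1) (D := m) β.1.2.le) (G.mon_PP p k σ β.2))
  choose s hs0 hs1 hs2 using hseq
  have hw : ∀ a : Fin (κ * l) × Fin d, G.t ^ (a.1 : ℕ) * G.mon a.2 ∈ G.Z (l + r * n * n) := fun a =>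
    Zs_mul_mem _ (Zs_pow_pow_mem _ a.1.2.le) (G.mon_mem _)
  have h1 : ∀ (a : Fin (κ * l) × Fin d) (β : Fin (κ * m) × Fin d) (j : Fin M),
      (G.t ^ (a.1 : ℕ) * G.mon a.2) * (s β j).1 ∈ G.Z (l + C') := by
    intro a β j
    refine Zs_pow_mono _ ?_ (Zs_mul_mem _ (hw a) (PP_fst (hs1 β j)))
    have : (j : ℕ) * (r * n * n + n + 2) ≤ M * (r * n * n + n + 2) := Nat.mul_le_mul_right _ j.2.le
    omega
  have h2 := fun a β j => (Submodule.mem_span_range_iff_exists_fun K).1 (G.span _ (h1 a β j))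
  choose co hco using h2
  obtain ⟨c, hc0, hc⟩ := exists_kernel (K := K)
    (A := (Fin (κ * l) × Fin d) × (Fin (κ * m) × Fin d))
    (B := Fin M × (Fin (κ * (l + C') + 1) × Fin d)) (by
      simp only [Fintype.card_prod, Fintype.card_fin]
      rw [← hM]
      have hdpos : 0 < d := pow_pos (Nat.factorial_pos _) _
      have h3 : M * (κ * (l + C') + 1) < κ * l * (M + 1) := by
        have : M * (κ * C' + 1) < κ * l := by
          calc M * (κ * C' + 1) < l := by omega
            _ = 1 * l := (one_mul l).symm
            _ ≤ κ * l := Nat.mul_le_mul_right _ hκ1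
        calc M * (κ * (l + C') + 1) = M * (κ * C' + 1) + κ * l * M := by ring
          _ < κ * l + κ * l * M := by omega
          _ = _ := by ring
      calc M * ((κ * (l + C') + 1) * d) = d * (M * (κ * (l + C') + 1)) := by ring
        _ < d * (κ * l * (M + 1)) := Nat.mul_lt_mul_of_pos_left h3 hdpos
        _ = _ := by ring) (fun q b => co q.1 q.2 b.1 b.2)
  refine ⟨fun a β => c (a, β), fun h => hc0 (funext fun q => congrFun (congrFun h q.1) q.2), ?_⟩
  have h3 : ∀ j < M, ∑ a, ∑ β, c (a, β) • ((G.t ^ (a.1 : ℕ) * G.mon a.2) * (s β j).1) = 0 := by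
    intro j hj
    have h4 : ∀ a β, c (a, β) • ((G.t ^ (a.1 : ℕ) * G.mon a.2) * (s β j).1) =
        ∑ b, (c (a, β) * co a β ⟨j, hj⟩ b) • (G.t ^ (b.1 : ℕ) * G.mon b.2) := by
      intro a β
      have h5 := hco a β ⟨j, hj⟩
      simp only at h5
      rw [← h5, Finset.smul_sum]
      simp only [smul_smul]
    simp only [h4]
    simp_rw [← Fintype.sum_prod_type' (f := fun a β => ∑ b, (c (a, β) * co a β ⟨j, hj⟩ b) • (G.t ^ (b.1 : ℕ) * G.mon b.2))]
    rw [Finset.sum_comm]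
    refine Finset.sum_eq_zero fun b _ => ?_
    rw [← Finset.sum_smul, hc (⟨j, hj⟩, b), zero_smul]
  have h4 : ∀ j ≤ M, PI G.x (G.Psi p k σ) ^ j * (∑ a, ∑ β, c (a, β) • ((G.t ^ (a.1 : ℕ) * G.mon a.2) *
        G.Psi p k σ (G.t ^ (β.1 : ℕ) * G.mon β.2))) = (G.Psi p k σ G.t - G.t) ^ j *
        (∑ a, ∑ β, c (a, β) • ((G.t ^ (a.1 : ℕ) * G.mon a.2) * (s β j).2)) := by
    intro j
    induction j with
    | zero => intro _; simp [hs0]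
    | succ j ih =>
      intro hj
      have ih := ih (by omega)
      rw [pow_succ' (PI G.x (G.Psi p k σ)), mul_assoc, ih, pow_succ (G.Psi p k σ G.t - G.t)]
      have h5 := h3 j (by omega)
      have h6 : PI G.x (G.Psi p k σ) * (∑ a, ∑ β, c (a, β) • ((G.t ^ (a.1 : ℕ) * G.mon a.2) * (s β j).2)) =
          (G.Psi p k σ G.t - G.t) * (∑ a, ∑ β, c (a, β) • ((G.t ^ (a.1 : ℕ) * G.mon a.2) * (s β (j+1)).2)) := by
        rw [← sub_zero (∑ a, ∑ β, c (a, β) • ((G.t ^ (a.1 : ℕ) * G.mon a.2) * (s β j).2)), ← h5,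
          ← Finset.sum_sub_distrib, Finset.mul_sum, Finset.mul_sum]
        refine Finset.sum_congr rfl fun a _ => ?_
        rw [← Finset.sum_sub_distrib, Finset.mul_sum, Finset.mul_sum]
        refine Finset.sum_congr rfl fun β _ => ?_
        rw [← smul_sub, mul_smul_comm, mul_smul_comm]
        congr 1
        linear_combination (G.t ^ (a.1 : ℕ) * G.mon a.2) * hs2 β j
      linear_combination (G.Psi p k σ G.t - G.t) ^ j * h6
  exact ⟨_, h4 M le_rfl⟩

lemma aux_ne_zero [IsAlgClosed K] {t₀ : K} (θ : G.S →ₐ[K] PowerSeries K)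
    (hθ : θ G.t = PowerSeries.C t₀ + PowerSeries.X) (m l : ℕ)
    (hq : κ * (n.factorial ^ r * (l + r * n * n)) < p ^ k)
    (c : (Fin (κ * l) × Fin (n.factorial ^ r)) → (Fin (κ * m) × Fin (n.factorial ^ r)) → K) (hc : c ≠ 0) :
    (∑ a, ∑ β, c a β • ((G.t ^ (a.1 : ℕ) * G.mon a.2) *
        G.Psi p k σ (G.t ^ (β.1 : ℕ) * G.mon β.2))) ≠ 0 := by
  intro h0
  have hpk : 0 < p ^ k := pow_pos (Fact.out : p.Prime).pos _
  choose c' hc' using fun a β => IsAlgClosed.exists_pow_nat_eq (c a β) hpk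
  have hz : ∀ a, ∑ β, c a β • G.Psi p k σ (G.t ^ (β.1 : ℕ) * G.mon β.2) =
      (G.φ σ (∑ β, c' a β • (G.t ^ (β.1 : ℕ) * G.mon β.2))) ^ (p ^ k) := by
    intro a
    rw [← Psi_apply, map_sum]
    refine Finset.sum_congr rfl fun β _ => ?_
    rw [Psi_smul, hc']
  have h1 := G.nonvanish θ hθ p k (κ * l) l (Nat.le_succ _) hq (D := m + r * n * n)
    (fun a => G.φ σ (∑ β, c' a β • (G.t ^ (β.1 : ℕ) * G.mon β.2)))
    (fun a => G.φ_Z σ (Submodule.sum_mem _ fun β _ => Submodule.smul_mem _ _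
      (Zs_mul_mem _ (Zs_pow_pow_mem _ β.1.2.le) (G.mon_mem _)))) (by
      rw [← h0]
      refine Finset.sum_congr rfl fun a _ => ?_
      rw [← hz, Finset.mul_sum]
      simp only [mul_smul_comm])
  apply hc
  funext a
  have h2 := congrFun h1 a
  simp only [Pi.zero_apply, EmbeddingLike.map_eq_zero_iff] at h2
  have h3 := G.indep' _ h2
  funext β
  rw [← hc' a β, congrFun h3 β, Pi.zero_apply, zero_pow hpk.ne', Pi.zero_apply, Pi.zero_apply]

theorem stepanov (G : Geo K r n κ f) [IsAlgClosed K] (hκ1 : 1 ≤ κ) (hdeg : ∀ i, (f i).natDegree ≤ n)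
    (hκ : ∀ i m, ((f i).coeff m).natDegree ≤ κ)
    (hrat : ∀ i m a, ((f i).coeff m).coeff a ^ (p ^ k) = ((f i).coeff m).coeff a)
    (m M C' l : ℕ) (hM : M + 1 = κ * m * n.factorial ^ r)
    (hC' : C' = 2 * (r * n * n) + m + M * (r * n * n + n + 2))
    (hl : l = M * (κ * C' + 1) + 1)
    (hq : κ * (n.factorial ^ r * (l + r * n * n)) < p ^ k)
    (T : Finset K) (hT : ∀ t ∈ T, t ^ (p ^ k) = t) (ℓ : K → Fin r → Fin n → K)
    (τ : K → Fin r → Equiv.Perm (Fin n)) (hinj : ∀ t ∈ T, ∀ i, Function.Injective (ℓ t i))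
    (hfac : ∀ t ∈ T, ∀ i, (f i).map (evalRingHom t) = ∏ j, (X - C (ℓ t i j)))
    (hτ : ∀ t ∈ T, ∀ i j, ℓ t i (τ t i j) ^ (p ^ k) = ℓ t i j) :
    (∑ t ∈ T, (Finset.univ.filter fun g => g * σ = τ t * g).card) * M ≤
      κ * (n.factorial ^ r * ((l + r * n * n) + p ^ k * (m + r * n * n))) := by
  classical
  rcases T.eq_empty_or_nonempty with rfl | ⟨t₁, ht₁⟩
  · simp
  obtain ⟨c, hc, F', hF'⟩ := G.exists_aux p k σ hκ1 hdeg hκ hrat m M C' l hM hC' hl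
  obtain ⟨θ₁, hθ₁, -⟩ := G.emb t₁ (ℓ t₁) (hinj t₁ ht₁) (hfac t₁ ht₁)
  have hF0 := G.aux_ne_zero p k σ θ₁ hθ₁ m l hq c hc
  set F := (∑ a, ∑ β, c a β • ((G.t ^ (a.1 : ℕ) * G.mon a.2) *
        G.Psi p k σ (G.t ^ (β.1 : ℕ) * G.mon β.2))) with hF
  have hFZ : F ∈ G.Z ((l + r * n * n) + p ^ k * (m + r * n * n)) := by
    refine Submodule.sum_mem _ fun a _ => Submodule.sum_mem _ fun β _ => Submodule.smul_mem _ _ ?_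
    refine Zs_mul_mem _ (Zs_mul_mem _ (Zs_pow_pow_mem _ a.1.2.le) (G.mon_mem _)) ?_
    rw [Psi_apply]
    exact Zs_pow_mem _ (G.φ_Z _ (Zs_mul_mem _ (Zs_pow_pow_mem _ β.1.2.le) (G.mon_mem _))) _
  obtain ⟨P, hP, hdegP, hnorm⟩ := G.norm hFZ hF0
  refine le_trans ?_ hdegP
  refine le_trans ?_ (sum_rootMult_le P hP T)
  rw [Finset.sum_mul]
  refine Finset.sum_le_sum fun t₀ ht₀ => ps_mult hP ?_
  obtain ⟨θ, hθ, hθx⟩ := G.emb t₀ (ℓ t₀) (hinj t₀ ht₀) (hfac t₀ ht₀)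
  rw [← hθ, aeval_algHom_apply, hnorm, map_prod]
  refine Dvd.dvd.trans ?_ (Finset.prod_dvd_prod_of_subset _ _ _ (Finset.filter_subset (fun g => g * σ = τ t₀ * g) _))
  rw [mul_comm, pow_mul, ← Finset.prod_const]
  refine Finset.prod_dvd_prod_of_dvd _ _ fun g hg => ?_
  rw [Finset.mem_filter] at hg
  have hg := hg.2
  have hpk : p ^ k ≠ 0 := (pow_pos (Fact.out : p.Prime).pos _).ne'
  have e1 := congrArg (fun u => θ (G.φ g u)) hF'
  simp only [map_mul, map_pow] at e1
  have hu : IsUnit (θ (G.φ g (PI G.x (G.Psi p k σ)))) := by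
    rw [PowerSeries.isUnit_iff_constantCoeff, isUnit_iff_ne_zero, PI]
    simp only [map_prod, map_sub, Psi_apply, map_pow, φ_x, hθx]
    rw [Finset.prod_ne_zero_iff]
    rintro ⟨i, j⟩ _
    rw [Finset.prod_ne_zero_iff]
    intro a ha
    have h5 : g i (σ i a) = τ t₀ i (g i a) := by
      have := congrFun hg i
      have := congrArg (fun e => e a) this
      simpa using this
    rw [h5, hτ t₀ ht₀, sub_ne_zero]
    intro h6
    have := (g i).injective (hinj t₀ ht₀ i h6)
    exact (Finset.mem_erase.1 ha).1 this.symm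
  have hρ : PowerSeries.X ∣ θ (G.φ g (G.Psi p k σ G.t - G.t)) := by
    rw [Psi_apply, φ_t, map_sub, map_sub, map_pow, map_pow, φ_t, hθ, PowerSeries.X_dvd_iff]
    simp [hT t₀ ht₀]
  have h7 : PowerSeries.X ^ M ∣ θ (G.φ g (PI G.x (G.Psi p k σ))) ^ M * θ (G.φ g F) := by
    rw [e1]
    exact Dvd.dvd.mul_right (pow_dvd_pow_of_dvd hρ _) _
  exact ((hu.pow M).dvd_mul_left).1 h7

end Geo
end Pf

set_option linter.unusedSectionVars false

namespace Pf

theorem stepanov_asymp (r n κ : ℕ) (hκ1 : 1 ≤ κ) (ε : ℝ) (hε : 0 < ε) :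
    ∃ Q : ℕ, ∀ (K : Type) [Field K] [IsAlgClosed K] (p k : ℕ) [Fact p.Prime] [CharP K p]
      (f : Fin r → K[X][X]) (_ : Geo K r n κ f), Q < p ^ k →
      (∀ i, (f i).natDegree ≤ n) → (∀ i m, ((f i).coeff m).natDegree ≤ κ) →
      (∀ i m a, ((f i).coeff m).coeff a ^ (p ^ k) = ((f i).coeff m).coeff a) →
      ∀ (T : Finset K) (ℓ : K → Fin r → Fin n → K) (τ : K → Fin r → Equiv.Perm (Fin n)),
      (∀ t ∈ T, t ^ (p ^ k) = t) → (∀ t ∈ T, ∀ i, Function.Injective (ℓ t i)) →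
      (∀ t ∈ T, ∀ i, (f i).map (evalRingHom t) = ∏ j, (X - C (ℓ t i j))) →
      (∀ t ∈ T, ∀ i j, ℓ t i (τ t i j) ^ (p ^ k) = ℓ t i j) → ∀ σ : Fin r → Equiv.Perm (Fin n),
      ((∑ t ∈ T, (Finset.univ.filter fun g => g * σ = τ t * g).card : ℕ) : ℝ) ≤ (1 + ε) * (p ^ k : ℕ) := by
  set d := n.factorial ^ r with hd
  have hd1 : 1 ≤ d := Nat.one_le_iff_ne_zero.2 (pow_ne_zero _ (Nat.factorial_ne_zero _))
  set c1 := r * n * n with hc1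
  have hA : (1:ℝ) ≤ κ * d := by exact_mod_cast Nat.mul_le_mul hκ1 hd1
  obtain ⟨m0, hm0⟩ := exists_nat_ge ((κ * d * c1 + 1 + ε / 2) / (ε / 2))
  set m := m0 + 2 with hm
  have hm1 : κ * d * c1 + 1 + ε / 2 ≤ (ε / 2) * m := by
    rw [div_le_iff₀ (by positivity)] at hm0
    have : (m : ℝ) = m0 + 2 := by rw [hm]; push_cast; ring
    rw [this]; nlinarith
  have h2 : 2 ≤ κ * m * d := by
    calc 2 = 1 * 2 * 1 := by norm_num
      _ ≤ κ * m * d := Nat.mul_le_mul (Nat.mul_le_mul hκ1 (by omega)) hd1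
  set M := κ * m * d - 1 with hM
  have hM1 : M + 1 = κ * m * d := by omega
  have hMr : (M : ℝ) = κ * m * d - 1 := by
    have : ((M + 1 : ℕ) : ℝ) = κ * m * d := by rw [hM1]; push_cast; ring
    push_cast at this; linarith
  have hMpos : (1 : ℝ) ≤ M := by exact_mod_cast (show 1 ≤ M by omega)
  set C' := 2 * c1 + m + M * (c1 + n + 2) with hC'
  set l := M * (κ * C' + 1) + 1 with hl
  obtain ⟨Q1, hQ1⟩ := exists_nat_ge ((κ * d * (l + c1)) / (ε / 2) : ℝ)
  refine ⟨max Q1 (κ * (d * (l + c1))), ?_⟩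
  intro K _ _ p k _ _ f G hQ hdeg hκ hrat T ℓ τ hT hinj hfac hτ σ
  have hQ2 : κ * (d * (l + c1)) < p ^ k := lt_of_le_of_lt (le_max_right _ _) hQ
  have hQ3 : (Q1 : ℝ) ≤ (p ^ k : ℕ) := by exact_mod_cast ((le_max_left _ _).trans hQ.le)
  have := Geo.stepanov p k σ G hκ1 hdeg hκ hrat m M C' l hM1 hC' hl hQ2 T hT ℓ τ hinj hfac hτ
  set N := ∑ t ∈ T, (Finset.univ.filter fun g => g * σ = τ t * g).card with hN
  have h3 : (N : ℝ) * M ≤ κ * (d * ((l + c1) + (p ^ k : ℕ) * (m + c1))) := by exact_mod_cast this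
  set q : ℝ := ((p ^ k : ℕ) : ℝ) with hq
  have hq0 : 0 ≤ q := by rw [hq]; positivity
  have h4 : κ * d * (l + c1) ≤ ε / 2 * q := by
    have := hQ1.trans hQ3
    rw [div_le_iff₀ (by positivity)] at this
    linarith
  have h5 : (κ : ℝ) * d * (m + c1) ≤ (1 + ε / 2) * M := by
    rw [hMr]
    have : (ε / 2) * m ≤ (ε / 2) * m * (κ * d) := le_mul_of_one_le_right (by positivity) hA
    nlinarith
  have h6 : (N : ℝ) * M ≤ ((1 + ε) * q) * M := by
    calc (N : ℝ) * M ≤ κ * d * (l + c1) + (κ * d * (m + c1)) * q := by linarith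
      _ ≤ ε / 2 * q + ((1 + ε / 2) * M) * q := by gcongr
      _ ≤ ε / 2 * q * M + ((1 + ε / 2) * M) * q := by
        have : ε / 2 * q ≤ ε / 2 * q * M := le_mul_of_one_le_right (by positivity) hMpos
        linarith
      _ = _ := by ring
  exact le_of_mul_le_mul_right h6 (by linarith)

/-- Upper bound for conjugation invariant events. -/
theorem equidist_upper (r n κ : ℕ) (hκ1 : 1 ≤ κ) (ε : ℝ) (hε : 0 < ε) :
    ∃ Q : ℕ, ∀ (K : Type) [Field K] [IsAlgClosed K] (p k : ℕ) [Fact p.Prime] [CharP K p]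
      (f : Fin r → K[X][X]) (_ : Geo K r n κ f), Q < p ^ k →
      (∀ i, (f i).natDegree ≤ n) → (∀ i m, ((f i).coeff m).natDegree ≤ κ) →
      (∀ i m a, ((f i).coeff m).coeff a ^ (p ^ k) = ((f i).coeff m).coeff a) →
      ∀ (T : Finset K) (ℓ : K → Fin r → Fin n → K) (τ : K → Fin r → Equiv.Perm (Fin n)),
      (∀ t ∈ T, t ^ (p ^ k) = t) → (∀ t ∈ T, ∀ i, Function.Injective (ℓ t i)) →
      (∀ t ∈ T, ∀ i, (f i).map (evalRingHom t) = ∏ j, (X - C (ℓ t i j))) →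
      (∀ t ∈ T, ∀ i j, ℓ t i (τ t i j) ^ (p ^ k) = ℓ t i j) →
      ∀ E : Finset (Fin r → Equiv.Perm (Fin n)), (∀ g s, s ∈ E → g⁻¹ * s * g ∈ E) →
      (n.factorial ^ r : ℕ) * ((T.filter fun t => τ t ∈ E).card : ℝ) ≤ (1 + ε) * (p ^ k : ℕ) * E.card := by
  obtain ⟨Q, hQ⟩ := stepanov_asymp r n κ hκ1 ε hε
  refine ⟨Q, ?_⟩
  intro K _ _ p k _ _ f G hQ' hdeg hκ hrat T ℓ τ hT hinj hfac hτ E hE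
  have h1 := hQ K p k f G hQ' hdeg hκ hrat T ℓ τ hT hinj hfac hτ
  have hG : Fintype.card (Fin r → Equiv.Perm (Fin n)) = n.factorial ^ r := by
    simp [Fintype.card_perm]
  have h2 : n.factorial ^ r * (T.filter fun t => τ t ∈ E).card ≤
      ∑ σ ∈ E, ∑ t ∈ T, (Finset.univ.filter fun g => g * σ = τ t * g).card := by
    rw [Finset.sum_comm, Finset.card_filter, Finset.mul_sum]
    refine Finset.sum_le_sum fun t _ => ?_
    split_ifs with h
    · rw [mul_one, ← hG, ← Finset.card_univ]
      have : (Finset.univ : Finset (Fin r → Equiv.Perm (Fin n))) ⊆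
          E.biUnion fun σ => Finset.univ.filter fun g => g * σ = τ t * g := by
        intro g _
        rw [Finset.mem_biUnion]
        exact ⟨g⁻¹ * τ t * g, hE g _ h, by simp [mul_assoc]⟩
      exact (Finset.card_le_card this).trans Finset.card_biUnion_le
    · simp
  have h3 : ((n.factorial ^ r * (T.filter fun t => τ t ∈ E).card : ℕ) : ℝ) ≤
      ∑ σ ∈ E, (1 + ε) * (p ^ k : ℕ) := by
    refine (Nat.cast_le.2 h2).trans ?_
    rw [Nat.cast_sum]
    exact Finset.sum_le_sum fun σ _ => h1 σ
  rw [Finset.sum_const, nsmul_eq_mul] at h3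
  push_cast at h3 ⊢
  linarith

end Pf

set_option linter.unusedSectionVars false

namespace Pf

section loc
variable {K : Type} [Field K]

/-- the substitution t ↦ t₀ + s -/
noncomputable def iota (t₀ : K) : K[X] →+* PowerSeries K :=
  (aeval (PowerSeries.C t₀ + PowerSeries.X : PowerSeries K) : K[X] →ₐ[K] PowerSeries K).toRingHom

lemma iota_eq (t₀ : K) (P : K[X]) : iota t₀ P = ((taylor t₀ P : K[X]) : PowerSeries K) := by
  have : iota t₀ = (Polynomial.coeToPowerSeries.ringHom).comp (taylorAlgHom t₀ : K[X] →ₐ[K] K[X]).toRingHom := by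
    apply Polynomial.ringHom_ext
    · intro a
      simp [iota]
    · simp [iota, add_comm]
  rw [this]; rfl

lemma iota_inj (t₀ : K) : Function.Injective (iota t₀) := by
  intro P Q h
  rw [iota_eq, iota_eq] at h
  exact taylor_injective t₀ (Polynomial.coe_injective K h)

lemma iota_const (t₀ : K) (P : K[X]) : PowerSeries.constantCoeff (iota t₀ P) = P.eval t₀ := by
  rw [iota_eq]; simp

lemma iota_coeff_one (t₀ : K) (P : K[X]) :
    PowerSeries.coeff 1 (iota t₀ P) = P.derivative.eval t₀ := by
  rw [iota_eq, Polynomial.coeff_coe, taylor_coeff_one]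

lemma hensel_factor (D : Finset K) : ∀ (G : (PowerSeries K)[X]) (h : K[X]), G.Monic → (∀ d ∈ D, h.eval d ≠ 0) →
    G.map PowerSeries.constantCoeff = h * ∏ d ∈ D, (X - C d) →
    ∃ (ξ : K → PowerSeries K) (g : (PowerSeries K)[X]), g.Monic ∧
      (∀ d ∈ D, PowerSeries.constantCoeff (ξ d) = d) ∧
      G = g * ∏ d ∈ D, (X - C (ξ d)) ∧ g.map PowerSeries.constantCoeff = h := by
  classical
  induction D using Finset.induction_on with
  | empty =>
    intro G h hG _ hm
    exact ⟨fun _ => 0, G, hG, by simp, by simp, by simpa using hm⟩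
  | insert d D hd ih =>
    intro G h hG hh hm
    rw [Finset.prod_insert hd] at hm
    have hev : ∀ P : (PowerSeries K)[X], PowerSeries.constantCoeff (P.eval (PowerSeries.C d)) =
        (P.map PowerSeries.constantCoeff).eval d := by
      intro P
      have := Polynomial.eval_map_apply (PowerSeries.constantCoeff (R := K)) (p := P) (PowerSeries.C d)
      simpa using this.symm
    have hmem : ∀ a : PowerSeries K, a ∈ Ideal.span {(PowerSeries.X : PowerSeries K)} ↔
        PowerSeries.constantCoeff a = 0 := by
      intro a
      rw [Ideal.mem_span_singleton, PowerSeries.X_dvd_iff]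
    have hroot : PowerSeries.constantCoeff (G.eval (PowerSeries.C d)) = 0 := by
      rw [hev, hm]; simp
    have hder : PowerSeries.constantCoeff (G.derivative.eval (PowerSeries.C d)) ≠ 0 := by
      rw [hev, ← Polynomial.derivative_map, hm]
      have e1 : h * ((X - C d) * ∏ d ∈ D, (X - C d)) = (X - C d) * (h * ∏ d ∈ D, (X - C d)) := by ring
      rw [e1, derivative_mul]
      simp only [derivative_sub, derivative_X, derivative_C, sub_zero, one_mul, eval_add, eval_mul,
        eval_sub, eval_X, eval_C, sub_self, zero_mul, add_zero, eval_prod]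
      refine mul_ne_zero (hh d (by simp)) (Finset.prod_ne_zero_iff.2 fun a ha => ?_)
      rw [sub_ne_zero]; rintro rfl; exact hd ha
    have hH : HenselianRing (PowerSeries K) (Ideal.span {(PowerSeries.X : PowerSeries K)}) :=
      IsAdicComplete.henselianRing _ _
    obtain ⟨a, ha, ha2⟩ := hH.is_henselian G hG (PowerSeries.C d) ((hmem _).2 hroot)
      (((PowerSeries.isUnit_iff_constantCoeff.2 (isUnit_iff_ne_zero.2 hder))).map _)
    have ha3 : PowerSeries.constantCoeff a = d := by
      have := (hmem _).1 ha2
      simpa [sub_eq_zero] using this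
    obtain ⟨G1, hG1⟩ := Polynomial.dvd_iff_isRoot.2 ha
    have hG1m : G1.Monic := by
      rw [hG1] at hG
      exact (monic_X_sub_C a).of_mul_monic_left hG
    have hm1 : G1.map PowerSeries.constantCoeff = h * ∏ d ∈ D, (X - C d) := by
      have : (X - C d) * G1.map PowerSeries.constantCoeff = (X - C d) * (h * ∏ d ∈ D, (X - C d)) := by
        rw [hG1] at hm
        rw [Polynomial.map_mul] at hm
        simp only [Polynomial.map_sub, map_X, map_C, ha3] at hm
        rw [hm]; ring
      exact mul_left_cancel₀ (X_sub_C_ne_zero d) this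
    obtain ⟨ξ, g, hg, hξ, hfac, hgm⟩ := ih G1 h hG1m (fun e he => hh e (by simp [he])) hm1
    refine ⟨Function.update ξ d a, g, hg, ?_, ?_, hgm⟩
    · intro e he
      by_cases hed : e = d
      · subst hed; simpa using ha3
      · rw [Function.update_of_ne hed]
        exact hξ e (by simpa [hed] using he)
    · rw [Finset.prod_insert hd, Function.update_self, hG1, hfac]
      have : ∏ e ∈ D, (X - C (Function.update ξ d a e)) = ∏ e ∈ D, (X - C (ξ e)) := by
        refine Finset.prod_congr rfl fun e he => ?_
        rw [Function.update_of_ne]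
        rintro rfl; exact hd he
      rw [this]; ring

lemma eis_irred (g : (PowerSeries K)[X]) (hg : g.Monic) (c : K) (k : ℕ) (hk : 0 < k)
    (hgm : g.map PowerSeries.constantCoeff = (X - C c) ^ k)
    (h1 : PowerSeries.coeff 1 (g.eval (PowerSeries.C c)) ≠ 0) :
    Irreducible (g.map (algebraMap (PowerSeries K) (FractionRing (PowerSeries K)))) := by
  rw [← Polynomial.Monic.irreducible_iff_irreducible_map_fraction_map hg]
  have hdeg : g.natDegree = k := by
    have := hg.natDegree_map (PowerSeries.constantCoeff (R := K))
    rw [hgm, natDegree_pow, natDegree_X_sub_C] at this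
    omega
  set g' := taylor (PowerSeries.C c) g with hg'
  have hirr : Irreducible g' := by
    have hmem : ∀ a : PowerSeries K, a ∈ Ideal.span {(PowerSeries.X : PowerSeries K)} ↔
        PowerSeries.constantCoeff a = 0 := by
      intro a
      rw [Ideal.mem_span_singleton, PowerSeries.X_dvd_iff]
    have hg'm : g'.Monic := by rw [hg']; rw [Monic, leadingCoeff_taylor]; exact hg
    have hg'd : g'.natDegree = k := by rw [hg', natDegree_taylor, hdeg]
    have hg'c : g'.map PowerSeries.constantCoeff = X ^ k := by
      rw [hg', taylor_apply, Polynomial.map_comp, hgm]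
      simp
    have hE : g'.IsEisensteinAt (Ideal.span {(PowerSeries.X : PowerSeries K)}) := by
      refine ⟨?_, ?_, ?_⟩
      · rw [hg'm.leadingCoeff, hmem]; simp
      · intro m hm
        rw [hmem, ← coeff_map, hg'c, coeff_X_pow, if_neg (by omega)]
      · rw [Ideal.span_singleton_pow, Ideal.mem_span_singleton, PowerSeries.X_pow_dvd_iff]
        intro h
        have := h 1 (by norm_num)
        rw [hg', taylor_coeff_zero] at this
        exact h1 this
    refine hE.irreducible ?_ hg'm.isPrimitive (by omega)
    exact (Ideal.span_singleton_prime PowerSeries.X_ne_zero).2 PowerSeries.X_prime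
  have := (MulEquiv.irreducible_iff (taylorEquiv (PowerSeries.C c)) (x := g)).1
  exact this hirr

end loc
end Pf

set_option linter.unusedSectionVars false

namespace Pf

lemma group_top {r n : ℕ} (H : Subgroup (Fin r → Equiv.Perm (Fin n)))
    (hA : ∀ i j j', ∃ g ∈ H, g i j = j')
    (hB : ∀ i, ∃ j0, ∀ j j', j ≠ j0 → j' ≠ j0 → ∃ g ∈ H, g i j0 = j0 ∧ g i j = j')
    (hC : ∀ i : Fin r, ∃ j k : Fin n, j ≠ k ∧ (Pi.mulSingle i (Equiv.swap j k) : Fin r → Equiv.Perm (Fin n)) ∈ H) : H = ⊤ := by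
  classical
  have h2 : ∀ i a b a' b', a ≠ b → a' ≠ b' → ∃ g ∈ H, g i a = a' ∧ g i b = b' := by
    intro i a b a' b' hab hab'
    obtain ⟨j0, hj0⟩ := hB i
    obtain ⟨g1, hg1, e1⟩ := hA i a j0
    obtain ⟨g2, hg2, e2⟩ := hA i a' j0
    obtain ⟨m, hm, em, em2⟩ := hj0 (g1 i b) (g2 i b') (by
      rw [← e1]; exact fun h => hab ((g1 i).injective h).symm) (by
      rw [← e2]; exact fun h => hab' ((g2 i).injective h).symm)
    refine ⟨g2⁻¹ * m * g1, H.mul_mem (H.mul_mem (H.inv_mem hg2) hm) hg1, ?_, ?_⟩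
    · simp only [Pi.mul_apply, Pi.inv_apply, Equiv.Perm.mul_apply, e1, em]
      rw [Equiv.Perm.inv_eq_iff_eq]; exact e2.symm
    · simp only [Pi.mul_apply, Pi.inv_apply, Equiv.Perm.mul_apply, em2]
      simp
  have h3 : ∀ (i : Fin r) (a b : Fin n), a ≠ b → (Pi.mulSingle i (Equiv.swap a b) : Fin r → Equiv.Perm (Fin n)) ∈ H := by
    intro i a b hab
    obtain ⟨j, k, hjk, hs⟩ := hC i
    obtain ⟨g, hg, e1, e2⟩ := h2 i j k a b hjk hab
    have := H.mul_mem (H.mul_mem hg hs) (H.inv_mem hg)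
    convert this using 1
    funext i'
    by_cases hi : i' = i
    · subst hi
      simp only [Pi.mulSingle_eq_same, Pi.mul_apply, Pi.inv_apply]
      rw [← e1, ← e2, Equiv.swap_apply_apply]
    · simp [Pi.mulSingle_eq_of_ne hi]
  have h4 : ∀ i (σ : Equiv.Perm (Fin n)), (Pi.mulSingle i σ : Fin r → Equiv.Perm (Fin n)) ∈ H := by
    intro i σ
    have : (⊤ : Subgroup (Equiv.Perm (Fin n))) ≤ H.comap (MonoidHom.mulSingle (fun _ : Fin r => Equiv.Perm (Fin n)) i) := by
      rw [← Equiv.Perm.closure_isSwap, Subgroup.closure_le]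
      rintro _ ⟨a, b, hab, rfl⟩
      exact h3 i a b hab
    exact this (Subgroup.mem_top σ)
  rw [eq_top_iff]
  intro g _
  exact Subgroup.pi_mem_of_mulSingle_mem g (fun i => h4 i _)
end Pf

set_option linter.unusedSectionVars false

namespace Pf

abbrev E0 (K : Type) [Field K] := FractionRing K[X]
abbrev Fr (K : Type) [Field K] := FractionRing (PowerSeries K)
abbrev Om (K : Type) [Field K] := AlgebraicClosure (Fr K)

section gal
variable {K : Type} [Field K] {L : Type} [Field L] [Algebra (E0 K) L]

/-- K[t] → L -/
noncomputable def tt (K : Type) [Field K] (L : Type) [Field L] [Algebra (E0 K) L] : K[X] →+* L :=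
  (algebraMap (E0 K) L).comp (algebraMap K[X] (E0 K))

lemma tt_inj : Function.Injective (tt K L) :=
  (algebraMap (E0 K) L).injective.comp (IsFractionRing.injective K[X] (E0 K))

/-- K[[s]] → Ω -/
noncomputable def aO (K : Type) [Field K] : PowerSeries K →+* Om K :=
  (algebraMap (Fr K) (Om K)).comp (algebraMap (PowerSeries K) (Fr K))

lemma aO_inj : Function.Injective (aO K) :=
  (algebraMap (Fr K) (Om K)).injective.comp (IsFractionRing.injective (PowerSeries K) (Fr K))

lemma loc_abs {E P O M : Type} [Field E] [Field P] [Field O] [Field M] [Algebra P O] [Algebra E M]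
    [IsAlgClosed O] [Normal E M] (e : E →+* P) : ∃ ψ : M →+* O,
    (∀ z, ψ (algebraMap E M z) = algebraMap P O (e z)) ∧
    ∀ τ : O ≃ₐ[P] O, ∃ σ : M ≃ₐ[E] M, ∀ u, ψ (σ u) = τ (ψ u) := by
  let _ : Algebra E O := ((algebraMap P O).comp e).toAlgebra
  have halg : ∀ z, algebraMap E O z = algebraMap P O (e z) := fun z => rfl
  let ψ : M →ₐ[E] O := IsAlgClosed.lift
  let _ : Algebra M O := ψ.toRingHom.toAlgebra
  have hψ : ∀ u, algebraMap M O u = ψ u := fun _ => rfl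
  have : IsScalarTower E M O := IsScalarTower.of_algebraMap_eq fun z => by
    rw [hψ, ψ.commutes]
  refine ⟨ψ.toRingHom, ?_, ?_⟩
  · intro z
    exact ψ.commutes z
  · intro τ
    let τ' : O ≃ₐ[E] O := AlgEquiv.ofRingEquiv (f := τ.toRingEquiv) (fun z => by
      rw [halg]; exact τ.commutes _)
    refine ⟨τ'.restrictNormal M, fun u => ?_⟩
    exact AlgEquiv.restrictNormal_commutes τ' M u

lemma loc_exists [Normal (E0 K) L] (t₀ : K) : ∃ ψ : L →+* Om K,
    (∀ P : K[X], ψ (tt K L P) = aO K (iota t₀ P)) ∧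
    ∀ τ : Om K ≃ₐ[Fr K] Om K, ∃ σ : L ≃ₐ[E0 K] L, ∀ u, ψ (σ u) = τ (ψ u) := by
  have hinj : Function.Injective ((algebraMap (PowerSeries K) (Fr K)).comp (iota t₀)) :=
    (IsFractionRing.injective (PowerSeries K) (Fr K)).comp (iota_inj t₀)
  let e : E0 K →+* Fr K := IsFractionRing.lift hinj
  obtain ⟨ψ, h1, h2⟩ := loc_abs (M := L) (O := Om K) e
  refine ⟨ψ, fun P => ?_, h2⟩
  change ψ (algebraMap (E0 K) L (algebraMap K[X] (E0 K) P)) = _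
  rw [h1]
  change algebraMap (Fr K) (Om K) (IsFractionRing.lift hinj _) = _
  rw [IsFractionRing.lift_algebraMap]; rfl

variable {r n : ℕ} (f : Fin r → K[X][X]) (x : Fin r → Fin n → L)

lemma perm_of (hx : ∀ i, (f i).map (tt K L) = ∏ j, (X - C (x i j)))
    (hinj : ∀ i, Function.Injective (x i)) (σ : L ≃ₐ[E0 K] L) :
    ∃ g : Fin r → Equiv.Perm (Fin n), ∀ i j, σ (x i j) = x i (g i j) := by
  have h1 : ∀ i j, ∃ j', σ (x i j) = x i j' := by
    intro i j
    have h2 : ((f i).map (tt K L)).eval (σ (x i j)) = 0 := by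
      have h3 : ((f i).map (tt K L)).map (σ : L →+* L) = (f i).map (tt K L) := by
        rw [Polynomial.map_map]
        congr 1
        ext z <;> simp [tt]
      rw [← h3]
      have : (((f i).map (tt K L)).map (σ : L →+* L)).eval ((σ : L →+* L) (x i j)) = 0 := by
        rw [Polynomial.eval_map_apply, hx]
        rw [eval_prod, Finset.prod_eq_zero (Finset.mem_univ j) (by simp), map_zero]
      exact this
    rw [hx, eval_prod, Finset.prod_eq_zero_iff] at h2
    obtain ⟨j', _, hj'⟩ := h2
    exact ⟨j', by simpa [sub_eq_zero] using hj'⟩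
  choose g hg using h1
  refine ⟨fun i => Equiv.ofBijective (g i) (Finite.injective_iff_bijective.1 ?_), fun i j => by simp [hg]⟩
  intro a b hab
  apply hinj i
  apply σ.injective
  rw [hg, hg, hab]

/-- group of realized permutations -/
def Hg (K : Type) [Field K] {L : Type} [Field L] [Algebra (E0 K) L] {r n : ℕ} (x : Fin r → Fin n → L) :
    Subgroup (Fin r → Equiv.Perm (Fin n)) where
  carrier := {g | ∃ σ : L ≃ₐ[E0 K] L, ∀ i j, σ (x i j) = x i (g i j)}
  one_mem' := ⟨1, by simp⟩
  mul_mem' := by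
    rintro a b ⟨σ, hσ⟩ ⟨τ, hτ⟩
    exact ⟨σ * τ, fun i j => by simp [hσ, hτ, AlgEquiv.mul_apply]⟩
  inv_mem' := by
    rintro a ⟨σ, hσ⟩
    refine ⟨σ⁻¹, fun i j => ?_⟩
    apply σ.injective
    rw [hσ, ← AlgEquiv.mul_apply, mul_inv_cancel]
    simp

lemma loc_Hg [Normal (E0 K) L] (hx : ∀ i, (f i).map (tt K L) = ∏ j, (X - C (x i j)))
    (hinj : ∀ i, Function.Injective (x i)) (t₀ : K) : ∃ ψ : L →+* Om K,
    (∀ P : K[X], ψ (tt K L P) = aO K (iota t₀ P)) ∧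
    ∀ τ : Om K ≃ₐ[Fr K] Om K, ∃ g ∈ Hg K x, ∀ i j, ψ (x i (g i j)) = τ (ψ (x i j)) := by
  obtain ⟨ψ, h1, h2⟩ := loc_exists (L := L) t₀
  refine ⟨ψ, h1, fun τ => ?_⟩
  obtain ⟨σ, hσ⟩ := h2 τ
  obtain ⟨g, hg⟩ := perm_of f x hx hinj σ
  exact ⟨g, ⟨σ, hg⟩, fun i j => by rw [← hg, hσ]⟩

lemma map_psi {F : K[X][X]} {y : Fin n → L} (hx : F.map (tt K L) = ∏ j, (X - C (y j))) {t₀ : K} (ψ : L →+* Om K)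
    (hψ : ∀ P : K[X], ψ (tt K L P) = aO K (iota t₀ P)) :
    (F.map (iota t₀)).map (aO K) = ∏ j, (X - C (ψ (y j))) := by
  have := congrArg (Polynomial.map ψ) hx
  rw [Polynomial.map_map, Polynomial.map_prod] at this
  rw [Polynomial.map_map]
  have e : ψ.comp (tt K L) = (aO K).comp (iota t₀) := RingHom.ext hψ
  rw [e] at this
  simpa using this

lemma iota_map_const (F : K[X][X]) (t₀ : K) :
    (F.map (iota t₀)).map PowerSeries.constantCoeff = F.map (evalRingHom t₀) := by
  rw [Polynomial.map_map]
  congr 1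
  ext z <;> simp [iota]

/-- ramification data -/
def Ram (F : K[X][X]) (t₀ c : K) (k : ℕ) (D : Finset K) : Prop :=
  c ∉ D ∧ F.map (evalRingHom t₀) = (X - C c) ^ k * ∏ d ∈ D, (X - C d) ∧
    (F.eval (C c)).derivative.eval t₀ ≠ 0

lemma eval_C_map (F : K[X][X]) (t₀ c : K) :
    (F.map (iota t₀)).eval (PowerSeries.C c) = iota t₀ (F.eval (C c)) := by
  rw [← Polynomial.eval_map_apply]
  congr 1
  simp [iota]

lemma ram_factor (F : K[X][X]) (hF : F.Monic) {t₀ c : K} {k : ℕ} (hk : 0 < k) {D : Finset K} (h : Ram F t₀ c k D) :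
    ∃ (ξ : K → PowerSeries K) (g : (Fr K)[X]), g.Monic ∧ Irreducible g ∧ g.natDegree = k ∧
      (F.map (iota t₀)).map (aO K) = g.map (algebraMap (Fr K) (Om K)) * ∏ d ∈ D, (X - C (aO K (ξ d))) := by
  obtain ⟨hc, hfac, htr⟩ := h
  obtain ⟨ξ, g, hg, hξ, hG, hgm⟩ := hensel_factor D (F.map (iota t₀)) ((X - C c) ^ k) (hF.map _)
    (fun d hd => by simp [sub_eq_zero]; intro h; exact absurd (h ▸ hd) hc) (by rw [iota_map_const, hfac])
  have hcoef : PowerSeries.coeff 1 (g.eval (PowerSeries.C c)) ≠ 0 := by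
    have e1 := congrArg (Polynomial.eval (PowerSeries.C c)) hG
    rw [eval_C_map, eval_mul] at e1
    have e2 : PowerSeries.constantCoeff (g.eval (PowerSeries.C c)) = 0 := by
      have := Polynomial.eval_map_apply (PowerSeries.constantCoeff (R := K)) (p := g) (PowerSeries.C c)
      rw [hgm] at this
      rw [← this]; simp [hk.ne']
    intro h0
    have e3 : (PowerSeries.X : PowerSeries K) ^ 2 ∣ g.eval (PowerSeries.C c) := by
      rw [PowerSeries.X_pow_dvd_iff]
      intro m hm
      interval_cases m
      · simpa using e2
      · exact h0
    have e4 : (PowerSeries.X : PowerSeries K) ^ 2 ∣ iota t₀ (F.eval (C c)) := by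
      rw [e1]; exact e3.mul_right _
    rw [PowerSeries.X_pow_dvd_iff] at e4
    have := e4 1 (by norm_num)
    rw [iota_coeff_one] at this
    exact htr this
  refine ⟨ξ, g.map (algebraMap _ _), hg.map _, eis_irred g hg c k hk hgm hcoef, ?_, ?_⟩
  · have := hg.natDegree_map (PowerSeries.constantCoeff (R := K))
    rw [hgm, natDegree_pow, natDegree_X_sub_C] at this
    rw [hg.natDegree_map]; omega
  · rw [hG, Polynomial.map_mul, Polynomial.map_prod, Polynomial.map_map]
    simp [aO]

lemma unram_factor (F : K[X][X]) (hF : F.Monic) {t₀ : K} {D : Finset K}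
    (h : F.map (evalRingHom t₀) = ∏ d ∈ D, (X - C d)) :
    ∃ (ξ : K → PowerSeries K), (∀ d ∈ D, PowerSeries.constantCoeff (ξ d) = d) ∧
      F.map (iota t₀) = ∏ d ∈ D, (X - C (ξ d)) := by
  obtain ⟨ξ, g, hg, hξ, hG, hgm⟩ := hensel_factor D (F.map (iota t₀)) 1 (hF.map _)
    (fun d hd => by simp) (by rw [iota_map_const, h, one_mul])
  refine ⟨ξ, hξ, ?_⟩
  have : g.natDegree = 0 := by
    rw [← hg.natDegree_map (PowerSeries.constantCoeff (R := K)), hgm, natDegree_one]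
  rw [hG, hg.natDegree_eq_zero.1 this, one_mul]

lemma trans_roots {g : (Fr K)[X]} (hg : g.Monic) (hi : Irreducible g) {y y' : Om K}
    (hy : (g.map (algebraMap (Fr K) (Om K))).eval y = 0)
    (hy' : (g.map (algebraMap (Fr K) (Om K))).eval y' = 0) : ∃ τ : Om K ≃ₐ[Fr K] Om K, τ y = y' := by
  rw [eval_map_algebraMap] at hy hy'
  apply minpoly.exists_algEquiv_of_root' (Algebra.IsAlgebraic.isAlgebraic y)
  rw [← minpoly.eq_of_irreducible_of_monic hi hy hg]
  exact hy'

lemma tau_aO (τ : Om K ≃ₐ[Fr K] Om K) (a : PowerSeries K) : τ (aO K a) = aO K a := τ.commutes _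

end gal
end Pf

set_option linter.unusedSectionVars false

namespace Pf
section
variable {K : Type} [Field K] {L : Type} [Field L] [Algebra (E0 K) L] {r n : ℕ}
  (f : Fin r → K[X][X]) (x : Fin r → Fin n → L)

lemma root_psi {F : (Om K)[X]} {n : ℕ} {y : Fin n → Om K} (h : F = ∏ j, (X - C (y j))) (j) :
    F.eval (y j) = 0 := by
  rw [h, eval_prod, Finset.prod_eq_zero (Finset.mem_univ j) (by simp)]

theorem Hg_top [Normal (E0 K) L] (hn : 2 ≤ n) (hmon : ∀ i, (f i).Monic)
    (hx : ∀ i, (f i).map (tt K L) = ∏ j, (X - C (x i j)))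
    (hinj : ∀ i, Function.Injective (x i))
    (hA : ∀ i, ∃ t₀ c, Ram (f i) t₀ c n ∅)
    (hB : ∀ i, ∃ t₀ c d, Ram (f i) t₀ c (n-1) {d})
    (hC : ∀ i, ∃ t₀ c D, Ram (f i) t₀ c 2 D ∧ ∀ j, j ≠ i → ∃ D' : Finset K,
      (f j).map (evalRingHom t₀) = ∏ d ∈ D', (X - C d)) : Hg K x = ⊤ := by
  classical
  apply group_top
  · intro i j j'
    obtain ⟨t₀, c, hR⟩ := hA i
    obtain ⟨ξ, g, hg, hgi, hgd, hfac⟩ := ram_factor (f i) (hmon i) (by omega) hR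
    obtain ⟨ψ, hψ, hτ⟩ := loc_Hg f x hx hinj t₀
    have hm := map_psi (hx i) ψ hψ
    rw [hfac, Finset.prod_empty, mul_one] at hm
    obtain ⟨τ, h1⟩ := trans_roots hg hgi (root_psi hm j) (root_psi hm j')
    obtain ⟨p, hp, hpe⟩ := hτ τ
    refine ⟨p, hp, hinj i (ψ.injective ?_)⟩
    rw [hpe, h1]
  · intro i
    obtain ⟨t₀, c, d, hR⟩ := hB i
    obtain ⟨ξ, g, hg, hgi, hgd, hfac⟩ := ram_factor (f i) (hmon i) (by omega) hR
    obtain ⟨ψ, hψ, hτ⟩ := loc_Hg f x hx hinj t₀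
    have hm := map_psi (hx i) ψ hψ
    rw [hfac, Finset.prod_singleton] at hm
    have h0 : ∃ j0, ψ (x i j0) = aO K (ξ d) := by
      have := congrArg (Polynomial.eval (aO K (ξ d))) hm
      rw [eval_mul, eval_prod] at this
      simp only [eval_sub, eval_X, eval_C, sub_self, mul_zero] at this
      obtain ⟨j0, _, hj0⟩ := Finset.prod_eq_zero_iff.1 this.symm
      exact ⟨j0, (sub_eq_zero.1 hj0).symm⟩
    obtain ⟨j0, hj0⟩ := h0
    have hroot : ∀ j, j ≠ j0 → (g.map (algebraMap (Fr K) (Om K))).eval (ψ (x i j)) = 0 := by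
      intro j hj
      have := root_psi hm j
      rw [eval_mul] at this
      simp only [eval_sub, eval_X, eval_C] at this
      refine (mul_eq_zero.1 this).resolve_right fun h => hj (hinj i (ψ.injective ?_))
      rw [hj0, sub_eq_zero.1 h]
    refine ⟨j0, fun j j' hj hj' => ?_⟩
    obtain ⟨τ, h1⟩ := trans_roots hg hgi (hroot j hj) (hroot j' hj')
    obtain ⟨p, hp, hpe⟩ := hτ τ
    refine ⟨p, hp, hinj i (ψ.injective ?_), hinj i (ψ.injective ?_)⟩
    · rw [hpe, hj0, tau_aO]
    · rw [hpe, h1]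
  · intro i
    obtain ⟨t₀, c, D, hR, hoth⟩ := hC i
    obtain ⟨ξ, g, hg, hgi, hgd, hfac⟩ := ram_factor (f i) (hmon i) (by omega) hR
    obtain ⟨ψ, hψ, hτ⟩ := loc_Hg f x hx hinj t₀
    have hm := map_psi (hx i) ψ hψ
    rw [hfac] at hm
    have hinj' : Function.Injective fun j => ψ (x i j) := ψ.injective.comp (hinj i)
    have hcase : ∀ j, (g.map (algebraMap (Fr K) (Om K))).eval (ψ (x i j)) = 0 ∨
        ∃ d ∈ D, ψ (x i j) = aO K (ξ d) := by
      intro j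
      have := root_psi hm j
      rw [eval_mul, eval_prod] at this
      rcases mul_eq_zero.1 this with h | h
      · exact Or.inl h
      · obtain ⟨d, hd, hd2⟩ := Finset.prod_eq_zero_iff.1 h
        exact Or.inr ⟨d, hd, by simpa [sub_eq_zero] using hd2⟩
    have hcard : D.card + 2 = n := by
      have := congrArg natDegree hm
      rw [natDegree_mul (hg.map _).ne_zero (Finset.prod_ne_zero_iff.2 fun d _ => X_sub_C_ne_zero _),
        hg.natDegree_map, hgd, natDegree_prod_of_monic _ _ (fun d _ => monic_X_sub_C _),
        natDegree_prod_of_monic _ _ (fun d _ => monic_X_sub_C _)] at this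
      simp at this
      omega
    set g' := g.map (algebraMap (Fr K) (Om K)) with hg'
    set J := Finset.univ.filter fun j => g'.eval (ψ (x i j)) = 0 with hJ
    have hJ1 : n ≤ J.card + D.card := by
      have h1 : (Finset.univ : Finset (Fin n)).card ≤ J.card + (Jᶜ).card := by
        rw [Finset.card_add_card_compl]; simp
      have h2 : (Jᶜ).card ≤ D.card := by
        have : (Jᶜ).image (fun j => ψ (x i j)) ⊆ D.image (fun d => aO K (ξ d)) := by
          intro z hz
          obtain ⟨j, hj, rfl⟩ := Finset.mem_image.1 hz
          have hj' : ¬ g'.eval (ψ (x i j)) = 0 := by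
            intro h; rw [Finset.mem_compl, hJ] at hj; exact hj (by simp [h])
          obtain ⟨d, hd, e⟩ := (hcase j).resolve_left hj'
          exact Finset.mem_image.2 ⟨d, hd, e.symm⟩
        calc (Jᶜ).card = ((Jᶜ).image (fun j => ψ (x i j))).card := (Finset.card_image_of_injective _ hinj').symm
          _ ≤ _ := Finset.card_le_card this
          _ ≤ _ := Finset.card_image_le
      simp only [Finset.card_univ, Fintype.card_fin] at h1
      omega
    have hJ2 : J.card ≤ 2 := by
      have : (J.image (fun j => ψ (x i j))).val ⊆ g'.roots := by
        intro z hz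
        obtain ⟨j, hj, rfl⟩ := Finset.mem_image.1 (by simpa only [Finset.mem_val] using hz)
        rw [mem_roots (hg.map _).ne_zero]
        exact (Finset.mem_filter.1 hj).2
      have h3 := Multiset.card_le_card ((Multiset.le_iff_subset (Finset.nodup _)).2 this)
      have h4 := Polynomial.card_roots' g'
      rw [hg', hg.natDegree_map, hgd] at h4
      have h5 := Finset.card_image_of_injective J hinj'
      rw [Finset.card_val, h5] at h3
      exact h3.trans h4
    have hJ3 : J.card = 2 := by omega
    obtain ⟨j, k, hjk, hJe⟩ := Finset.card_eq_two.1 hJ3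
    have hj : j ∈ J := by rw [hJe]; simp
    have hk : k ∈ J := by rw [hJe]; simp
    have hj' := (Finset.mem_filter.1 hj).2
    have hk' := (Finset.mem_filter.1 hk).2
    obtain ⟨τ, h1⟩ := trans_roots hg hgi hj' hk'
    obtain ⟨p, hp, hpe⟩ := hτ τ
    refine ⟨j, k, hjk, ?_⟩
    have hpj : p i j = k := hinj i (ψ.injective (by rw [hpe, h1]))
    have hfix : ∀ m, m ≠ j → m ≠ k → p i m = m := by
      intro m hmj hmk
      have hmJ : m ∉ J := by rw [hJe]; simp [hmj, hmk]
      obtain ⟨d, hd, e⟩ := (hcase m).resolve_left (fun h => hmJ (by simp [hJ, h]))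
      exact hinj i (ψ.injective (by rw [hpe, e, tau_aO]))
    have hpi : p i = Equiv.swap j k := by
      apply Equiv.ext
      intro m
      by_cases hmj : m = j
      · rw [hmj, hpj, Equiv.swap_apply_left]
      by_cases hmk : m = k
      · rw [hmk, Equiv.swap_apply_right]
        by_contra hne
        by_cases h2 : p i k = k
        · exact hjk ((p i).injective (by rw [hpj, h2]))
        · have := hfix (p i k) hne h2
          exact h2 ((p i).injective this)
      · rw [hfix m hmj hmk, Equiv.swap_apply_of_ne_of_ne hmj hmk]
    have hpo : ∀ i', i' ≠ i → p i' = 1 := by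
      intro i' hi'
      obtain ⟨D', hD'⟩ := hoth i' hi'
      obtain ⟨ζ, hζ, hG⟩ := unram_factor (f i') (hmon i') hD'
      have hm' := map_psi (hx i') ψ hψ
      rw [hG, Polynomial.map_prod] at hm'
      apply Equiv.ext
      intro m
      have h3 := root_psi hm' m
      rw [eval_prod] at h3
      obtain ⟨d, hd, hd2⟩ := Finset.prod_eq_zero_iff.1 h3
      have e : ψ (x i' m) = aO K (ζ d) := by simpa [sub_eq_zero] using hd2
      exact hinj i' (ψ.injective (by rw [hpe, e, tau_aO]; exact e.symm))
    convert hp using 1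
    funext i'
    by_cases hi : i' = i
    · subst hi; rw [Pi.mulSingle_eq_same, hpi]
    · rw [Pi.mulSingle_eq_of_ne hi, hpo i' hi]
end
end Pf

set_option linter.unusedSectionVars false

namespace Pf

theorem geo_of {K : Type} [Field K] {L : Type} [Field L] [Algebra (E0 K) L] [Algebra K L] [Normal (E0 K) L]
    [FiniteDimensional (E0 K) L]
    (hKL : ∀ a, algebraMap K L a = tt K L (C a))
    {r n κ : ℕ} (hn : 0 < n) (f : Fin r → K[X][X]) (x : Fin r → Fin n → L)
    (hmon : ∀ i, (f i).Monic) (hdeg : ∀ i, (f i).natDegree = n)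
    (hκ : ∀ i m, ((f i).coeff m).natDegree ≤ κ)
    (hx : ∀ i, (f i).map (tt K L) = ∏ j, (X - C (x i j)))
    (hinj : ∀ i, Function.Injective (x i))
    (hadj : Algebra.adjoin (E0 K) (Set.range fun p : Fin r × Fin n => x p.1 p.2) = ⊤)
    (htop : Hg K x = ⊤) : Nonempty (Geo K r n κ f) := by
  classical
  set t : L := tt K L X with ht
  have haev : ∀ P : K[X], aeval t P = tt K L P := by
    have : (aeval t : K[X] →ₐ[K] L).toRingHom = tt K L := by
      apply Polynomial.ringHom_ext
      · intro a; simp [hKL]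
      · simp [ht]
    intro P; rw [← this]; rfl
  set S : Subalgebra K L := Algebra.adjoin K (insert t (Set.range fun p : Fin r × Fin n => x p.1 p.2)) with hS
  have htS : t ∈ S := Algebra.subset_adjoin (by simp)
  have hxS : ∀ i j, x i j ∈ S := fun i j => Algebra.subset_adjoin (Or.inr ⟨(i, j), rfl⟩)
  let tS : S := ⟨t, htS⟩
  let xS : Fin r → Fin n → S := fun i j => ⟨x i j, hxS i j⟩
  have haevS : ∀ P : K[X], ((aeval tS P : S) : L) = tt K L P := by
    intro P
    rw [← haev, ← Subalgebra.aeval_coe]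
  have hxSS : ∀ i, (f i).map (aeval tS : K[X] →ₐ[K] S).toRingHom = ∏ j, (X - C (xS i j)) := by
    intro i
    apply Polynomial.map_injective (S.val : S →+* L) Subtype.val_injective
    rw [Polynomial.map_map, Polynomial.map_prod]
    have e : (S.val : S →+* L).comp (aeval tS : K[X] →ₐ[K] S).toRingHom = tt K L := by
      ext P
      · simpa using haevS (C P)
      · simpa using haevS X
    rw [e, hx]
    simp [xS]
  obtain ⟨E, mon, hmoneq, hEle, hone, hspan⟩ := exists_mon r n κ hn tS xS f hmon hdeg hκ hxSS
  -- spanning over E0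
  have hspE : Submodule.span (E0 K) (Set.range fun e => (mon e : L)) = ⊤ := by
    rw [eq_top_iff]
    have h1 : ∀ u ∈ Submonoid.closure (Set.range fun p : Fin r × Fin n => x p.1 p.2),
        ∃ (D : ℕ) (v : S), v ∈ Zs K κ tS xS ^ D ∧ (v : L) = u := by
      intro u hu
      induction hu using Submonoid.closure_induction with
      | mem u hu =>
        obtain ⟨p, rfl⟩ := hu
        exact ⟨1, xS p.1 p.2, by rw [pow_one]; exact x_mem_Zs _ _ _, rfl⟩
      | one => exact ⟨1, 1, by rw [pow_one]; exact one_mem_Zs _, rfl⟩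
      | mul a b _ _ ha hb =>
        obtain ⟨D, v, hv, rfl⟩ := ha
        obtain ⟨D', v', hv', rfl⟩ := hb
        exact ⟨D + D', v * v', Zs_mul_mem _ hv hv', rfl⟩
    have h2 : ∀ (D : ℕ) (v : S), v ∈ Zs K κ tS xS ^ D →
        (v : L) ∈ Submodule.span (E0 K) (Set.range fun e => (mon e : L)) := by
      intro D v hv
      have h3 := hspan D hv
      refine Submodule.span_induction (p := fun (v : S) _ => (v : L) ∈ Submodule.span (E0 K) (Set.range fun e => (mon e : L)))
        ?_ ?_ ?_ ?_ h3
      · rintro _ ⟨p, rfl⟩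
        have e : ((tS ^ (p.1 : ℕ) * mon p.2 : S) : L) =
            (algebraMap K[X] (E0 K) (X ^ (p.1 : ℕ))) • (mon p.2 : L) := by
          rw [Algebra.smul_def]
          change t ^ (p.1 : ℕ) * _ = tt K L (X ^ (p.1 : ℕ)) * _
          rw [map_pow]
        change ((tS ^ (p.1 : ℕ) * mon p.2 : S) : L) ∈ _
        rw [e]
        exact Submodule.smul_mem _ _ (Submodule.subset_span ⟨p.2, rfl⟩)
      · simp
      · intro a b _ _ ha hb
        simpa using Submodule.add_mem _ ha hb
      · intro a v _ hv
        have e : ((a • v : S) : L) = (algebraMap K[X] (E0 K) (C a)) • (v : L) := by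
          rw [Algebra.smul_def (algebraMap K[X] (E0 K) (C a))]
          change ((a • v : S) : L) = tt K L (C a) * _
          rw [← hKL, ← Algebra.smul_def]; rfl
        rw [e]
        exact Submodule.smul_mem _ _ hv
    intro u _
    have hu : u ∈ Subalgebra.toSubmodule (Algebra.adjoin (E0 K) (Set.range fun p : Fin r × Fin n => x p.1 p.2)) := by
      rw [hadj]; exact Submodule.mem_top
    rw [Algebra.adjoin_eq_span] at hu
    have hle : Submodule.span (E0 K) (Submonoid.closure (Set.range fun p : Fin r × Fin n => x p.1 p.2) : Set L) ≤
        Submodule.span (E0 K) (Set.range fun e => (mon e : L)) := by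
      rw [Submodule.span_le]
      intro z hz
      obtain ⟨D, v, hv, rfl⟩ := h1 z hz
      exact h2 D v hv
    exact hle hu
  -- automorphisms
  have hall : ∀ g : Fin r → Equiv.Perm (Fin n), ∃ σ : L ≃ₐ[E0 K] L, ∀ i j, σ (x i j) = x i (g i j) := by
    intro g
    have : g ∈ Hg K x := by rw [htop]; exact Subgroup.mem_top _
    exact this
  choose σ hσ using hall
  have huniq : ∀ a b : L ≃ₐ[E0 K] L, (∀ i j, a (x i j) = b (x i j)) → a = b := by
    intro a b h
    have := AlgHom.ext_of_adjoin_eq_top hadj (φ₁ := (a : L →ₐ[E0 K] L)) (φ₂ := (b : L →ₐ[E0 K] L)) (by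
      rintro _ ⟨p, rfl⟩; exact h _ _)
    ext z
    exact DFunLike.congr_fun this z
  have hσmul : ∀ g h, σ (g * h) = σ g * σ h := by
    intro g h
    apply huniq
    intro i j
    rw [AlgEquiv.mul_apply, hσ, hσ, hσ]; rfl
  have hσone : σ 1 = 1 := by
    apply huniq; intro i j; rw [hσ]; rfl
  have hσsurj : Function.Surjective σ := by
    intro a
    obtain ⟨g, hg⟩ := perm_of f x hx hinj a
    exact ⟨g, huniq _ _ fun i j => by rw [hσ, hg]⟩
  have hσinj : Function.Injective σ := by
    intro g h hgh
    funext i; apply Equiv.ext; intro j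
    apply hinj i
    rw [← hσ, ← hσ, hgh]
  have hcardG : Fintype.card (Fin r → Equiv.Perm (Fin n)) = n.factorial ^ r := by
    simp [Fintype.card_perm]
  have hcardA : Fintype.card (L ≃ₐ[E0 K] L) = n.factorial ^ r := by
    rw [← hcardG]
    exact (Fintype.card_of_bijective ⟨hσinj, hσsurj⟩).symm
  have hfr : Module.finrank (E0 K) L = n.factorial ^ r := by
    apply le_antisymm
    · simpa using finrank_le_of_span_eq_top hspE
    · rw [← hcardA]; exact AlgEquiv.card_le
  have hGal : IsGalois (E0 K) L := IsGalois.of_card_aut_eq_finrank _ _ (by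
    rw [Nat.card_eq_fintype_card, hcardA, hfr])
  have hli : LinearIndependent (E0 K) (fun e => (mon e : L)) :=
    linearIndependent_of_top_le_span_of_card_eq_finrank hspE.ge (by simp [hfr])
  have hσtt : ∀ g P, σ g (tt K L P) = tt K L P := fun g P => (σ g).commutes _
  have hσS : ∀ g, ∀ u ∈ S, σ g u ∈ S := by
    intro g u hu
    induction hu using Algebra.adjoin_induction with
    | mem u hu =>
      rcases hu with rfl | ⟨p, rfl⟩
      · rw [ht, hσtt]; exact htS
      · change σ g (x p.1 p.2) ∈ S
        rw [hσ]; exact hxS _ _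
    | algebraMap a => rw [hKL, hσtt, ← hKL]; exact S.algebraMap_mem a
    | add a b _ _ ha hb => rw [map_add]; exact S.add_mem ha hb
    | mul a b _ _ ha hb => rw [map_mul]; exact S.mul_mem ha hb
  let ρ : (Fin r → Equiv.Perm (Fin n)) → (S →ₐ[K] S) := fun g =>
    { toFun := fun u => ⟨σ g u, hσS g u u.2⟩
      map_one' := by ext; simp
      map_mul' := by intro a b; ext; simp
      map_zero' := by ext; simp
      map_add' := by intro a b; ext; simp
      commutes' := by
        intro a; ext
        change σ g (algebraMap K L a) = algebraMap K L a
        rw [hKL, hσtt] }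
  have hρmul : ∀ g h, ρ (g * h) = (ρ g).comp (ρ h) := by
    intro g h; ext u
    change σ (g * h) u = σ g (σ h u)
    rw [hσmul]; rfl
  have hρone : ρ 1 = AlgHom.id K S := by
    ext u
    change σ 1 u = u
    rw [hσone]; rfl
  let φ : (Fin r → Equiv.Perm (Fin n)) →* (S ≃ₐ[K] S) :=
    { toFun := fun g => AlgEquiv.ofAlgHom (ρ g) (ρ g⁻¹) (by rw [← hρmul, mul_inv_cancel, hρone])
        (by rw [← hρmul, inv_mul_cancel, hρone])
      map_one' := by
        ext u
        change σ 1 u = u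
        rw [hσone]; rfl
      map_mul' := by
        intro g h; ext u
        change σ (g * h) u = σ g (σ h u)
        rw [hσmul]; rfl }
  have hφ : ∀ g (u : S), ((φ g u : S) : L) = σ g u := fun g u => rfl
  refine ⟨{ S := S, t := tS, x := xS, φ := φ, φ_t := ?_, φ_x := ?_, hx := hxSS, E := E, mon := mon,
            mon_eq := hmoneq, E_le := hEle, mon_one := hone, span := hspan, indep := ?_, inv := ?_, emb := ?_ }⟩
  · intro g
    apply Subtype.ext
    rw [hφ]
    exact hσtt g X
  · intro g i j
    apply Subtype.ext
    rw [hφ]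
    exact hσ g i j
  · intro p hp
    have h1 : ∑ e, (algebraMap K[X] (E0 K) (p e)) • (mon e : L) = 0 := by
      have h2 := congrArg (fun u : S => (u : L)) hp
      simp only [AddSubmonoidClass.coe_finsetSum, MulMemClass.coe_mul, ZeroMemClass.coe_zero] at h2
      rw [← h2]
      refine Finset.sum_congr rfl fun e _ => ?_
      rw [Algebra.smul_def, haevS]; rfl
    have h3 := Fintype.linearIndependent_iff.1 hli _ h1
    funext e
    exact IsFractionRing.injective K[X] (E0 K) (by rw [h3 e]; simp)
  · intro u hu
    have h1 : (u : L) ∈ (⊥ : IntermediateField (E0 K) L) := by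
      rw [IsGalois.mem_bot_iff_fixed]
      intro a
      obtain ⟨g, rfl⟩ := hσsurj a
      rw [← hφ, hu]
    obtain ⟨z, hz⟩ := IntermediateField.mem_bot.1 h1
    obtain ⟨p, q, hq, rfl⟩ := IsFractionRing.div_surjective (A := K[X]) z
    have hq0 : q ≠ 0 := nonZeroDivisors.ne_zero hq
    refine ⟨p, q, hq0, Subtype.ext ?_⟩
    have hq1 : tt K L q ≠ 0 := fun h => hq0 (tt_inj (L := L) (by rw [h, map_zero]))
    rw [MulMemClass.coe_mul, haevS, haevS, ← hz, map_div₀]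
    change tt K L q * (tt K L p / tt K L q) = _
    field_simp
  · intro t₀ l hl hfac
    obtain ⟨ψ, hψ, -⟩ := loc_Hg f x hx hinj t₀
    have h1 : ∀ i, ∃ ξ : K → PowerSeries K, (∀ j, PowerSeries.constantCoeff (ξ (l i j)) = l i j) ∧
        (f i).map (iota t₀) = ∏ j, (X - C (ξ (l i j))) := by
      intro i
      obtain ⟨ξ, h2, h3⟩ := unram_factor (f i) (hmon i) (t₀ := t₀) (D := Finset.univ.image (l i)) (by
        rw [hfac, Finset.prod_image (fun a _ b _ h => hl i h)])
      refine ⟨ξ, fun j => h2 _ (by simp), ?_⟩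
      rw [h3, Finset.prod_image (fun a _ b _ h => hl i h)]
    choose ξ hξ hξf using h1
    have h2 : ∀ i j, ∃ j', ψ (x i j) = aO K (ξ i (l i j')) := by
      intro i j
      have hm := map_psi (hx i) ψ hψ
      rw [hξf, Polynomial.map_prod] at hm
      have h3 := root_psi hm j
      rw [eval_prod] at h3
      obtain ⟨d, hd, hd2⟩ := Finset.prod_eq_zero_iff.1 h3
      exact ⟨d, by simpa [sub_eq_zero] using hd2⟩
    choose π hπ using h2
    have hπinj : ∀ i, Function.Injective (π i) := by
      intro i a b hab
      exact hinj i (ψ.injective (by rw [hπ, hπ, hab]))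
    have h4 : ∀ u : S, ∃ v : PowerSeries K, aO K v = ψ u := by
      rintro ⟨u, hu⟩
      change ∃ v : PowerSeries K, aO K v = ψ u
      induction hu using Algebra.adjoin_induction with
      | mem u hu =>
        rcases hu with rfl | ⟨p, rfl⟩
        · exact ⟨_, (hψ X).symm⟩
        · exact ⟨_, (hπ _ _).symm⟩
      | algebraMap a => exact ⟨_, by rw [hKL]; exact (hψ (C a)).symm⟩
      | add a b _ _ ha hb =>
        obtain ⟨v, hv⟩ := ha
        obtain ⟨w, hw⟩ := hb
        exact ⟨v + w, by rw [map_add, map_add, hv, hw]⟩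
      | mul a b _ _ ha hb =>
        obtain ⟨v, hv⟩ := ha
        obtain ⟨w, hw⟩ := hb
        exact ⟨v * w, by rw [map_mul, map_mul, hv, hw]⟩
    choose θ0 hθ0 using h4
    let θ : S →ₐ[K] PowerSeries K :=
      { toFun := θ0
        map_one' := aO_inj (by rw [hθ0]; simp)
        map_mul' := fun a b => aO_inj (by rw [hθ0, map_mul, hθ0, hθ0]; simp)
        map_zero' := aO_inj (by rw [hθ0]; simp)
        map_add' := fun a b => aO_inj (by rw [hθ0, map_add, hθ0, hθ0]; simp)
        commutes' := fun a => aO_inj (by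
          rw [hθ0]
          change ψ (algebraMap K L a) = _
          rw [hKL, hψ]; simp [iota]) }
    have hθ : ∀ u, aO K (θ u) = ψ u := hθ0
    let g : Fin r → Equiv.Perm (Fin n) := fun i =>
      (Equiv.ofBijective (π i) (Finite.injective_iff_bijective.1 (hπinj i)))⁻¹
    have hg : ∀ i j, π i (g i j) = j := fun i j =>
      (Equiv.ofBijective (π i) (Finite.injective_iff_bijective.1 (hπinj i))).apply_symm_apply j
    refine ⟨θ.comp (φ g : S →ₐ[K] S), ?_, ?_⟩
    · apply aO_inj
      change aO K (θ (φ g tS)) = _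
      rw [hθ, hφ]
      change ψ (σ g (tt K L X)) = _
      rw [hσtt, hψ]; simp [iota]
    · intro i j
      change PowerSeries.constantCoeff (θ (φ g (xS i j))) = _
      have e : θ (φ g (xS i j)) = ξ i (l i j) := by
        apply aO_inj
        rw [hθ, hφ]
        change ψ (σ g (x i j)) = _
        rw [hσ, hπ, hg]
      rw [e, hξ]
end Pf

set_option linter.unusedSectionVars false

namespace Pf

lemma exists_roots_fin {L : Type} [Field L] (h : L[X]) (hm : h.Monic) (n : ℕ) (hd : h.natDegree = n)
    (hs : h.Splits) : ∃ x : Fin n → L, h = ∏ j, (X - C (x j)) := by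
  have h1 := hs.eq_prod_roots_of_monic hm
  have h2 := hs.natDegree_eq_card_roots
  obtain ⟨l, hl⟩ := Quot.exists_rep h.roots
  have hl' : h.roots = (l : Multiset L) := hl.symm
  have hlen : l.length = n := by rw [← hd, h2, hl']; rfl
  subst hlen
  refine ⟨fun j => l.get j, ?_⟩
  conv_lhs => rw [h1, hl']
  rw [Multiset.map_coe, Multiset.prod_coe, ← List.prod_ofFn]
  congr 1
  conv_lhs => rw [← List.ofFn_get l]
  rw [List.map_ofFn]; rfl

lemma exists_split_field (E : Type) [Field E] {r n : ℕ} (h : Fin r → E[X]) (hm : ∀ i, (h i).Monic)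
    (hd : ∀ i, (h i).natDegree = n) :
    ∃ (L : Type) (_ : Field L) (_ : Algebra E L) (_ : Normal E L) (_ : FiniteDimensional E L)
      (x : Fin r → Fin n → L), (∀ i, (h i).map (algebraMap E L) = ∏ j, (X - C (x i j))) ∧
      Algebra.adjoin E (Set.range fun p : Fin r × Fin n => x p.1 p.2) = ⊤ := by
  classical
  set P := ∏ i, h i with hP
  have hP0 : P ≠ 0 := Finset.prod_ne_zero_iff.2 fun i _ => (hm i).ne_zero
  have hs : ∀ i, ((h i).map (algebraMap E P.SplittingField)).Splits := fun i =>
    Polynomial.Splits.of_dvd (SplittingField.splits P) (Polynomial.map_ne_zero hP0)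
      (Polynomial.map_dvd _ (Finset.dvd_prod_of_mem h (Finset.mem_univ i)))
  choose x hx using fun i => exists_roots_fin _ ((hm i).map (algebraMap E P.SplittingField)) n
    (by rw [(hm i).natDegree_map, hd]) (hs i)
  refine ⟨P.SplittingField, inferInstance, inferInstance, Normal.of_isSplittingField P, inferInstance, x, hx, ?_⟩
  rw [eq_top_iff, ← IsSplittingField.adjoin_rootSet P.SplittingField P]
  apply Algebra.adjoin_mono
  intro z hz
  have hz2 := (mem_rootSet.1 hz).2
  have hz3 : aeval z (∏ i, h i) = 0 := hz2
  rw [map_prod, Finset.prod_eq_zero_iff] at hz3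
  obtain ⟨i, _, hi⟩ := hz3
  rw [← eval_map_algebraMap, hx, eval_prod, Finset.prod_eq_zero_iff] at hi
  obtain ⟨j, _, hj⟩ := hi
  exact ⟨(i, j), by simpa [sub_eq_zero, eq_comm] using hj⟩

theorem exists_geo {K : Type} [Field K] {r n κ : ℕ} (hn : 2 ≤ n) (f : Fin r → K[X][X])
    (hmon : ∀ i, (f i).Monic) (hdeg : ∀ i, (f i).natDegree = n)
    (hκ : ∀ i m, ((f i).coeff m).natDegree ≤ κ)
    (hsep : ∀ i, ∃ (t₁ : K) (D' : Finset K), (f i).map (evalRingHom t₁) = ∏ d ∈ D', (X - C d))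
    (hA : ∀ i, ∃ t₀ c, Ram (f i) t₀ c n ∅)
    (hB : ∀ i, ∃ t₀ c d, Ram (f i) t₀ c (n-1) {d})
    (hC : ∀ i, ∃ t₀ c D, Ram (f i) t₀ c 2 D ∧ ∀ j, j ≠ i → ∃ D' : Finset K,
      (f j).map (evalRingHom t₀) = ∏ d ∈ D', (X - C d)) : Nonempty (Geo K r n κ f) := by
  obtain ⟨L, _, _, _, _, x, hx, hadj⟩ := exists_split_field (E0 K) (fun i => (f i).map (algebraMap K[X] (E0 K)))
    (n := n) (fun i => (hmon i).map _) (fun i => by rw [(hmon i).natDegree_map, hdeg])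
  have hx' : ∀ i, (f i).map (tt K L) = ∏ j, (X - C (x i j)) := by
    intro i; rw [← hx, Polynomial.map_map]; rfl
  have hinj : ∀ i, Function.Injective (x i) := by
    intro i
    obtain ⟨t₁, D', hD'⟩ := hsep i
    obtain ⟨ζ, hζ, hG⟩ := unram_factor (f i) (hmon i) hD'
    obtain ⟨ψ, hψ, -⟩ := loc_exists (L := L) t₁
    have hm := map_psi (hx' i) ψ hψ
    rw [hG, Polynomial.map_prod] at hm
    have hr := congrArg Polynomial.roots hm
    simp only [Polynomial.map_sub, map_X, map_C] at hr
    rw [roots_prod _ _ (Finset.prod_ne_zero_iff.2 fun _ _ => X_sub_C_ne_zero _),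
      roots_prod _ _ (Finset.prod_ne_zero_iff.2 fun _ _ => X_sub_C_ne_zero _)] at hr
    simp only [roots_X_sub_C] at hr
    rw [Multiset.bind_singleton, Multiset.bind_singleton] at hr
    have hnd : (Multiset.map (fun d => aO K (ζ d)) D'.val).Nodup := by
      refine Multiset.Nodup.map_on ?_ D'.nodup
      intro a ha b hb hab
      have := aO_inj hab
      rw [← hζ a ha, ← hζ b hb, this]
    rw [hr] at hnd
    intro a b hab
    have := Multiset.inj_on_of_nodup_map hnd a (Finset.mem_univ_val a) b (Finset.mem_univ_val b)
    exact this (by rw [hab])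
  let _ : Algebra K L := ((tt K L).comp C).toAlgebra
  exact geo_of (fun a => rfl) (by omega) f x hmon hdeg hκ hx' hinj hadj (Hg_top f x hn hmon hx' hinj hA hB hC)
end Pf

set_option linter.unusedSectionVars false

namespace Pf

/-- number of cycles, counting fixed points -/
noncomputable def cyc {α : Type*} (σ : Equiv.Perm α) : ℕ :=
  Nat.card (Quotient (Equiv.Perm.SameCycle.setoid σ))

section om
variable {F : Type} [Field F] [Fintype F] {K : Type} [Field K] [Algebra F K]

lemma mem_range_of_pow (c : K) (hc : c ^ Fintype.card F = c) : ∃ a : F, algebraMap F K a = c := by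
  classical
  set q := Fintype.card F
  have hq : 1 < q := Fintype.one_lt_card
  have hne : (X ^ q - X : K[X]) ≠ 0 := FiniteField.X_pow_card_sub_X_ne_zero K hq
  set I : Finset K := Finset.univ.image (algebraMap F K) with hI
  have hsub : I ⊆ (X ^ q - X : K[X]).roots.toFinset := by
    intro z hz
    obtain ⟨a, _, rfl⟩ := Finset.mem_image.1 hz
    rw [Multiset.mem_toFinset, mem_roots hne]
    simp only [IsRoot.def, eval_sub, eval_pow, eval_X, ← map_pow, q, FiniteField.pow_card, sub_self]
  have hcard : I.card = q := by
    rw [hI, Finset.card_image_of_injective _ (algebraMap F K).injective]; simp [q]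
  have hle : (X ^ q - X : K[X]).roots.toFinset.card ≤ I.card := by
    rw [hcard]
    refine (Multiset.toFinset_card_le _).trans ((Polynomial.card_roots' _).trans ?_)
    rw [FiniteField.X_pow_card_sub_X_natDegree_eq K hq]
  have heq := Finset.eq_of_subset_of_card_le hsub hle
  have : c ∈ I := by
    rw [heq, Multiset.mem_toFinset, mem_roots hne]
    simp [hc]
  obtain ⟨a, _, ha⟩ := Finset.mem_image.1 this
  exact ⟨a, ha⟩

variable {n : ℕ} (h : F[X]) (l : Fin n → K)

lemma frob_aeval (P : F[X]) (a : K) : aeval (a ^ Fintype.card F) P = (aeval a P) ^ Fintype.card F := by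
  have := Polynomial.aeval_algHom_apply (FiniteField.frobeniusAlgHom F K) a P
  simpa [FiniteField.coe_frobeniusAlgHom] using this

lemma exists_frob_perm (hl : Function.Injective l) (hfac : h.map (algebraMap F K) = ∏ j, (X - C (l j))) :
    ∃ τ : Equiv.Perm (Fin n), ∀ j, l (τ j) ^ Fintype.card F = l j := by
  have hroot : ∀ z : K, aeval z h = 0 ↔ ∃ j, z = l j := by
    intro z
    rw [← eval_map_algebraMap, hfac, eval_prod, Finset.prod_eq_zero_iff]
    simp [sub_eq_zero]
  have h1 : ∀ j, ∃ j', l j ^ Fintype.card F = l j' := by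
    intro j
    rw [← hroot, frob_aeval, (hroot _).2 ⟨j, rfl⟩, zero_pow Fintype.card_ne_zero]
  choose π hπ using h1
  have hinj : Function.Injective π := by
    intro a b hab
    apply hl
    have : l a ^ Fintype.card F = l b ^ Fintype.card F := by rw [hπ, hπ, hab]
    exact (FiniteField.frobeniusAlgHom F K).injective (by simpa [FiniteField.coe_frobeniusAlgHom] using this)
  refine ⟨(Equiv.ofBijective π (Finite.injective_iff_bijective.1 hinj))⁻¹, fun j => ?_⟩
  rw [hπ]
  congr 1
  exact (Equiv.ofBijective π (Finite.injective_iff_bijective.1 hinj)).apply_symm_apply j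

lemma minpoly_iff (hintg : ∀ j, IsIntegral F (l j)) (hl : Function.Injective l) (τ : Equiv.Perm (Fin n))
    (hτ : ∀ j, l (τ j) ^ Fintype.card F = l j) (i j : Fin n) :
    minpoly F (l i) = minpoly F (l j) ↔ τ.SameCycle i j := by
  classical
  have hstep : ∀ j, minpoly F (l (τ j)) = minpoly F (l j) := by
    intro j
    have h1 : aeval (l j) (minpoly F (l (τ j))) = 0 := by
      rw [← hτ, frob_aeval, minpoly.aeval, zero_pow Fintype.card_ne_zero]
    exact minpoly.eq_of_irreducible_of_monic (minpoly.irreducible (hintg _)) h1 (minpoly.monic (hintg _))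
  constructor
  · intro he
    set P : K[X] := ∏ m ∈ Finset.univ.filter (fun m => τ.SameCycle i m), (X - C (l m)) with hP
    have hPmap : P.map (FiniteField.frobeniusAlgHom F K : K →+* K) = P := by
      rw [hP, Polynomial.map_prod]
      simp only [Polynomial.map_sub, map_X, map_C]
      refine Finset.prod_bij' (fun m _ => τ⁻¹ m) (fun m _ => τ m) ?_ ?_ ?_ ?_ ?_
      · intro m hm; simpa using hm
      · intro m hm; simpa using hm
      · intro m hm; simp
      · intro m hm; simp
      · intro m hm
        have := hτ (τ⁻¹ m)
        simp at this
        simp [FiniteField.coe_frobeniusAlgHom, this]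
    have hlift : P ∈ Polynomial.lifts (algebraMap F K) := by
      rw [Polynomial.lifts_iff_coeff_lifts]
      intro m
      have := congrArg (fun Q => Q.coeff m) hPmap
      simp only [coeff_map] at this
      obtain ⟨a, ha⟩ := mem_range_of_pow (F := F) (P.coeff m) (by
        simpa [FiniteField.coe_frobeniusAlgHom] using this)
      exact ⟨a, ha⟩
    obtain ⟨Q, hQ⟩ := (Polynomial.mem_lifts _).1 hlift
    have hroot : ∀ z, aeval z Q = 0 ↔ ∃ m, τ.SameCycle i m ∧ z = l m := by
      intro z
      rw [← eval_map_algebraMap, hQ, hP, eval_prod, Finset.prod_eq_zero_iff]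
      simp [sub_eq_zero]
    have h1 : aeval (l i) Q = 0 := (hroot _).2 ⟨i, Equiv.Perm.SameCycle.refl _ _, rfl⟩
    have h2 := minpoly.dvd F (l i) h1
    rw [he] at h2
    obtain ⟨R, hR⟩ := h2
    have h3 : aeval (l j) Q = 0 := by rw [hR, map_mul, minpoly.aeval, zero_mul]
    obtain ⟨m, hm, hm2⟩ := (hroot _).1 h3
    rw [hl hm2]; exact hm
  · rintro ⟨k, rfl⟩
    have hz : ∀ (k : ℕ) (j : Fin n), minpoly F (l ((τ ^ k) j)) = minpoly F (l j) := by
      intro k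
      induction k with
      | zero => intro j; simp
      | succ k ih => intro j; rw [pow_succ', Equiv.Perm.mul_apply, hstep, ih]
    rcases k with k | k
    · simp [hz]
    · rw [zpow_negSucc]
      have := hz (k+1) ((τ ^ (k+1))⁻¹ i)
      rw [← Equiv.Perm.mul_apply, mul_inv_cancel, Equiv.Perm.one_apply] at this
      exact this

theorem omega_eq (hmon : h.Monic) (hl : Function.Injective l) (hfac : h.map (algebraMap F K) = ∏ j, (X - C (l j)))
    (τ : Equiv.Perm (Fin n)) (hτ : ∀ j, l (τ j) ^ Fintype.card F = l j) : omegaPoly h = cyc τ := by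
  classical
  have hroot : ∀ z : K, aeval z h = 0 ↔ ∃ j, z = l j := by
    intro z
    rw [← eval_map_algebraMap, hfac, eval_prod, Finset.prod_eq_zero_iff]
    simp [sub_eq_zero]
  have hintg : ∀ j, IsIntegral F (l j) := fun j => ⟨h, hmon, (hroot _).2 ⟨j, rfl⟩⟩
  have hset : ∀ p : F[X], p ∈ UniqueFactorizationMonoid.normalizedFactors h ↔ ∃ j, minpoly F (l j) = p := by
    intro p
    rw [Polynomial.mem_normalizedFactors_iff hmon.ne_zero]
    constructor
    · rintro ⟨hi, hm, hd⟩
      have hd' : p.map (algebraMap F K) ∣ ∏ j, (X - C (l j)) := by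
        rw [← hfac]; exact Polynomial.map_dvd _ hd
      have hs : (p.map (algebraMap F K)).Splits := by
        refine Polynomial.Splits.of_dvd ?_ (Finset.prod_ne_zero_iff.2 fun j _ => X_sub_C_ne_zero _) hd'
        exact Polynomial.Splits.prod fun j _ => Polynomial.Splits.X_sub_C _
      obtain ⟨z, hz⟩ := Polynomial.Splits.exists_eval_eq_zero hs (by
        rw [degree_map]; exact (degree_pos_of_irreducible hi).ne')
      rw [eval_map_algebraMap] at hz
      obtain ⟨R, hR⟩ := hd
      obtain ⟨j, rfl⟩ := (hroot z).1 (by rw [hR, map_mul, hz, zero_mul])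
      exact ⟨j, (minpoly.eq_of_irreducible_of_monic hi hz hm).symm⟩
    · rintro ⟨j, rfl⟩
      exact ⟨minpoly.irreducible (hintg j), minpoly.monic (hintg j), minpoly.dvd _ _ ((hroot _).2 ⟨j, rfl⟩)⟩
  have e1 : omegaPoly h = (Finset.univ.image fun j => minpoly F (l j)).card := by
    unfold omegaPoly
    refine Finset.card_bij (fun p _ => p) ?_ (fun _ _ _ _ h => h) ?_
    · intro p hp
      have := (@Multiset.mem_toFinset _ (Classical.decEq F[X]) _ _).1 hp
      simpa using (hset p).1 this
    · intro p hp
      exact ⟨p, (@Multiset.mem_toFinset _ (Classical.decEq F[X]) _ _).2 ((hset p).2 (by simpa using hp)), rfl⟩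
  rw [e1, cyc]
  let φ : Quotient (Equiv.Perm.SameCycle.setoid τ) → (Finset.univ.image fun j => minpoly F (l j)) :=
    fun z => Quotient.liftOn z (fun j => ⟨minpoly F (l j), by simp⟩)
      (fun a b hab => Subtype.ext ((minpoly_iff l hintg hl τ hτ a b).2 hab))
  have hφ : Function.Bijective φ := by
    constructor
    · intro a b
      induction a using Quotient.inductionOn
      induction b using Quotient.inductionOn
      intro hab
      exact Quotient.sound ((minpoly_iff l hintg hl τ hτ _ _).1 (Subtype.ext_iff.1 hab))
    · rintro ⟨p, hp⟩
      obtain ⟨j, _, rfl⟩ := Finset.mem_image.1 hp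
      exact ⟨Quotient.mk _ j, rfl⟩
  rw [Nat.card_eq_of_bijective φ hφ, Nat.card_eq_fintype_card, Fintype.card_coe]
end om
end Pf

set_option linter.unusedSectionVars false

namespace Pf

lemma cyc_conj {α : Type*} (g s : Equiv.Perm α) : cyc (g⁻¹ * s * g) = cyc s := by
  unfold cyc
  refine Nat.card_congr (Quotient.congr g ?_)
  intro a b
  change Equiv.Perm.SameCycle _ a b ↔ Equiv.Perm.SameCycle s (g a) (g b)
  have := Equiv.Perm.sameCycle_conj (g := g⁻¹) (f := s) (x := a) (y := b)
  rw [inv_inv] at this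
  exact this

/-- monic polynomial with given lower coefficients -/
noncomputable def mp {R : Type*} [CommRing R] {n : ℕ} (v : Fin n → R) : R[X] :=
  X ^ n + ∑ j, C (v j) * X ^ (j : ℕ)

section mp
variable {R : Type*} [CommRing R] {n : ℕ}

lemma mp_map {R' : Type*} [CommRing R'] (φ : R →+* R') (v : Fin n → R) : (mp v).map φ = mp (fun j => φ (v j)) := by
  simp [mp, Polynomial.map_sum]

lemma deg_low (v : Fin n → R) : (∑ j, C (v j) * X ^ (j : ℕ)).degree < (n : WithBot ℕ) := by
  exact degree_sum_fin_lt v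

lemma mp_monic (v : Fin n → R) : (mp v).Monic := monic_X_pow_add (deg_low v)

lemma mp_natDegree [Nontrivial R] (v : Fin n → R) : (mp v).natDegree = n := by
  unfold mp
  exact natDegree_eq_of_degree_eq_some (by
    rw [degree_add_eq_left_of_degree_lt (by rw [degree_X_pow]; exact deg_low v), degree_X_pow])

lemma low_coeff (v : Fin n → R) (j : Fin n) : (∑ j, C (v j) * X ^ (j : ℕ)).coeff j = v j := by
  rw [finsetSum_coeff, Finset.sum_eq_single j]
  · simp
  · intro b _ hb
    rw [coeff_C_mul, coeff_X_pow, if_neg (fun h => hb (Fin.ext h.symm)), mul_zero]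
  · simp

lemma mp_coeff (v : Fin n → R) (j : Fin n) : (mp v).coeff j = v j := by
  rw [mp, coeff_add, low_coeff, coeff_X_pow, if_neg (by have := j.2; omega), zero_add]

lemma low_eq (p : R[X]) (hp : p.degree < (n : WithBot ℕ)) : ∑ j : Fin n, C (p.coeff j) * X ^ (j : ℕ) = p := by
  ext m
  by_cases hm : m < n
  · exact low_coeff (fun j : Fin n => p.coeff j) ⟨m, hm⟩
  · rw [coeff_eq_zero_of_degree_lt (lt_of_lt_of_le (deg_low _) (by exact_mod_cast (not_lt.1 hm))),
      coeff_eq_zero_of_degree_lt (lt_of_lt_of_le hp (by exact_mod_cast (not_lt.1 hm)))]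

lemma mp_add (v : Fin n → R) (p : R[X]) (hp : p.degree < (n : WithBot ℕ)) :
    mp v + p = mp (fun j => v j + p.coeff j) := by
  conv_lhs => rw [← low_eq p hp]
  simp only [mp, map_add, add_mul, Finset.sum_add_distrib, add_assoc]

lemma exists_mp (p : R[X]) (hp : p.Monic) (hd : p.natDegree = n) : ∃ v : Fin n → R, mp v = p := by
  nontriviality R
  refine ⟨fun j => (p - X ^ n).coeff j, ?_⟩
  have : (p - X ^ n).degree < (n : WithBot ℕ) := by
    have h1 : p.degree = (n : WithBot ℕ) := by rw [degree_eq_natDegree hp.ne_zero, hd]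
    rw [← h1]
    apply degree_sub_lt (by rw [h1, degree_X_pow]) hp.ne_zero
    rw [hp.leadingCoeff, (monic_X_pow n).leadingCoeff]
  rw [mp, low_eq _ this]; ring

lemma mp_inj : Function.Injective (mp : (Fin n → R) → R[X]) := by
  intro v w h
  funext j
  rw [← mp_coeff v, h, mp_coeff]

lemma mp_eval (v : Fin n → R) (c : R) : (mp v).eval c = c ^ n + ∑ j, v j * c ^ (j : ℕ) := by
  simp [mp, eval_finsetSum]

end mp

section count
variable {F : Type} [Field F] [Fintype F] [DecidableEq F] {n : ℕ}

lemma dcount (P : (Fin n → F) → Prop) [DecidablePred P] (e : Fin n → F) (m : ℕ)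
    (h : ∀ v, (Finset.univ.filter fun s : F => P (v + s • e)).card ≤ m) :
    Fintype.card F * (Finset.univ.filter P).card ≤ m * Fintype.card F ^ n := by
  have h1 : ∑ v : Fin n → F, (Finset.univ.filter fun s : F => P (v + s • e)).card =
      Fintype.card F * (Finset.univ.filter P).card := by
    simp only [Finset.card_filter]
    rw [Finset.sum_comm]
    rw [Finset.sum_congr rfl (g := fun _ => ∑ v : Fin n → F, if P v then 1 else 0)]
    · simp
    · intro s _
      exact Fintype.sum_equiv (Equiv.addRight (s • e)) _ _ (fun v => rfl)
  rw [← h1]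
  refine (Finset.sum_le_card_nsmul _ _ m fun v _ => h v).trans ?_
  simp [mul_comm]

/-- pencil lemma -/
lemma pencil (A B : F[X]) (hcop : IsCoprime A B) (N : ℕ) (hW : derivative A * B - A * derivative B ≠ 0)
    (hN : (derivative A * B - A * derivative B).natDegree ≤ N) (S : Finset F)
    (hS : ∀ s ∈ S, ¬ (A + C s * B).Separable) : S.card ≤ N := by
  classical
  let K := AlgebraicClosure F
  set W := derivative A * B - A * derivative B with hWd
  have h1 : ∀ s ∈ S, ∃ z : K, aeval z W = 0 ∧ aeval z B ≠ 0 ∧ algebraMap F K s = - aeval z A / aeval z B := by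
    intro s hs
    have h2 := hS s hs
    have h3 : ∃ z : K, aeval z (A + C s * B) = 0 ∧ aeval z (derivative (A + C s * B)) = 0 := by
      by_contra hcon
      apply h2
      rw [Polynomial.Separable]
      apply (Polynomial.isCoprime_map (algebraMap F K)).1
      by_contra hnc
      apply hcon
      obtain ⟨d, hd1, hd2, hd3⟩ : ∃ d : K[X], ¬ IsUnit d ∧ d ∣ (A + C s * B).map (algebraMap F K) ∧
          d ∣ (derivative (A + C s * B)).map (algebraMap F K) := by
        rw [← EuclideanDomain.gcd_isUnit_iff] at hnc
        exact ⟨_, hnc, EuclideanDomain.gcd_dvd_left _ _, EuclideanDomain.gcd_dvd_right _ _⟩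
      have hd0 : d.degree ≠ 0 := by
        intro h0
        exact hd1 (isUnit_iff_degree_eq_zero.2 h0)
      obtain ⟨z, hz⟩ := IsAlgClosed.exists_root d hd0
      refine ⟨z, ?_, ?_⟩
      · rw [← eval_map_algebraMap]
        exact hz.dvd hd2
      · rw [← eval_map_algebraMap]
        exact hz.dvd hd3
    obtain ⟨z, hz1, hz2⟩ := h3
    simp only [derivative_add, derivative_mul, derivative_C, zero_mul, zero_add, map_add, map_mul, aeval_C] at hz1 hz2
    refine ⟨z, ?_, ?_, ?_⟩
    · rw [hWd, map_sub, map_mul, map_mul]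
      linear_combination (aeval z B) * hz2 - (aeval z (derivative B)) * hz1
    · intro hB
      rw [hB, mul_zero, add_zero] at hz1
      obtain ⟨u, w, huw⟩ := hcop
      have := congrArg (aeval z) huw
      simp [hz1, hB] at this
    · have hB : aeval z B ≠ 0 := by
        intro hB
        rw [hB, mul_zero, add_zero] at hz1
        obtain ⟨u, w, huw⟩ := hcop
        have := congrArg (aeval z) huw
        simp [hz1, hB] at this
      rw [eq_div_iff hB]
      linear_combination hz1
  choose! z hz1 hz2 hz3 using h1
  have h4 : S.card ≤ (W.map (algebraMap F K)).roots.toFinset.card := by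
    apply Finset.card_le_card_of_injOn z
    · intro s hs
      simp only [Finset.mem_coe, Multiset.mem_toFinset]
      rw [mem_roots (Polynomial.map_ne_zero hW), IsRoot.def, eval_map_algebraMap]
      exact hz1 s hs
    · intro s hs s' hs' hss
      apply (algebraMap F K).injective
      rw [hz3 s hs, hz3 s' hs', hss]
  refine h4.trans ((Multiset.toFinset_card_le _).trans ((card_roots' _).trans ?_))
  rw [natDegree_map]; exact hN

/-- number of inseparable monic polynomials -/
lemma card_insep (hn : 2 ≤ n) (S : Finset (Fin n → F)) (hS : ∀ v ∈ S, ¬ (mp v).Separable) :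
    Fintype.card F * S.card ≤ (n + 1) * Fintype.card F ^ n := by
  classical
  let i0 : Fin n := ⟨0, by omega⟩
  let i1 : Fin n := ⟨1, by omega⟩
  have hmpadd : ∀ (v : Fin n → F) (s : F), mp (v + s • Pi.single i0 1) = mp v + C s * 1 := by
    intro v s
    rw [mul_one, mp_add v (C s) (lt_of_le_of_lt degree_C_le (by exact_mod_cast (by omega : 0 < n)))]
    congr 1
    funext j
    by_cases hj : j = i0
    · subst hj; simp [i0]
    · have : (j : ℕ) ≠ 0 := fun h => hj (Fin.ext h)
      simp [hj, coeff_C, this]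
  have h1 := dcount (F := F) (n := n) (fun v => ¬ (mp v).Separable ∧ derivative (mp v) ≠ 0) (Pi.single i0 1) n (by
    intro v
    by_cases hd : derivative (mp v) = 0
    · rw [Finset.card_eq_zero.2]
      · omega
      · rw [Finset.filter_eq_empty_iff]
        intro s _ h
        rw [hmpadd] at h
        exact h.2 (by simp [hd])
    · apply pencil (mp v) 1 isCoprime_one_right n
      · simpa using hd
      · simp only [mul_one, derivative_one, mul_zero, sub_zero]
        exact (natDegree_derivative_le _).trans (by rw [mp_natDegree]; omega)
      · intro s hs
        have := (Finset.mem_filter.1 hs).2.1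
        rwa [hmpadd] at this)
  have h2 := dcount (F := F) (n := n) (fun v => v i1 = 0) (Pi.single i1 1) 1 (by
    intro v
    rw [Finset.card_le_one]
    intro a ha b hb
    have ha' := (Finset.mem_filter.1 ha).2
    have hb' := (Finset.mem_filter.1 hb).2
    simp at ha' hb'
    linear_combination ha' - hb')
  have h3 : S ⊆ (Finset.univ.filter fun v => ¬ (mp v).Separable ∧ derivative (mp v) ≠ 0) ∪
      Finset.univ.filter fun v => v i1 = 0 := by
    intro v hv
    by_cases hd : derivative (mp v) = 0
    · apply Finset.mem_union_right
      have := congrArg (fun p => p.coeff 0) hd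
      simp only [coeff_derivative, coeff_zero] at this
      have h5 := mp_coeff v i1
      simp only [i1] at h5
      simp only [zero_add] at this
      rw [h5] at this
      simpa [i1] using this
    · apply Finset.mem_union_left
      simp [hS v hv, hd]
  have h4 := (Finset.card_le_card h3).trans (Finset.card_union_le _ _)
  calc _ ≤ Fintype.card F * (_ + _) := Nat.mul_le_mul_left _ h4
    _ ≤ _ := by rw [mul_add, add_mul]; exact Nat.add_le_add h1 h2

end count
end Pf

set_option linter.unusedSectionVars false

namespace Pf

section choice
variable {F : Type} [Field F] [Fintype F] {n : ℕ}

lemma exists_notMem_of_lt (S : Finset F) (h : S.card < Fintype.card F) : ∃ x, x ∉ S := by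
  by_contra hcon
  push Not at hcon
  rw [← Finset.card_univ] at h
  exact absurd (Finset.card_le_card (fun x _ => hcon x : Finset.univ ⊆ S)) (by omega)

lemma choose_c {ι : Type*} (D : Finset ι) (d : ι → F[X]) (hd : ∀ i ∈ D, d i ≠ 0)
    (hdeg : ∀ i ∈ D, (d i).natDegree ≤ n) (hq : D.card * n < Fintype.card F) :
    ∃ c : F, ∀ i ∈ D, (d i).eval c ≠ 0 := by
  classical
  obtain ⟨c, hc⟩ := exists_notMem_of_lt (D.biUnion fun i => (d i).roots.toFinset) (by
    refine lt_of_le_of_lt (Finset.card_biUnion_le_card_mul _ _ n ?_) hq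
    intro i hi
    exact (Multiset.toFinset_card_le _).trans ((card_roots' _).trans (hdeg i hi)))
  refine ⟨c, fun i hi h0 => hc ?_⟩
  rw [Finset.mem_biUnion]
  exact ⟨i, hi, by rw [Multiset.mem_toFinset, mem_roots (hd i hi)]; exact h0⟩

lemma choose_g {ι : Type*} (hn : 4 ≤ n) (c : F) (D : Finset ι) (d : ι → F[X]) (hd : ∀ i ∈ D, (d i).eval c ≠ 0)
    (hdeg : ∀ i ∈ D, (d i).natDegree ≤ n) (hq : (D.card + 1) * (2 * n + 1) < Fintype.card F) :
    ∃ g : F[X], g.Monic ∧ g.natDegree = n - 2 ∧ g.eval c ≠ 0 ∧ g.Separable ∧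
      ∀ i ∈ D, ((X - C c) ^ 2 * g + d i).Separable := by
  classical
  set B : F[X] := (X - C c) ^ 2 with hB
  have hBm : B.Monic := (monic_X_sub_C c).pow 2
  have hBd : B.natDegree = 2 := by rw [hB, natDegree_pow, natDegree_X_sub_C]
  -- choose u
  let W : ι → F → F[X] := fun i u =>
    derivative (B * (X ^ (n - 2) + C u * X) + d i) * B - (B * (X ^ (n - 2) + C u * X) + d i) * derivative B
  have hWu : ∀ i u, W i u = W i 0 + C u * B ^ 2 := by
    intro i u
    simp only [W, derivative_add, derivative_mul, derivative_C, derivative_X, map_zero]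
    ring
  obtain ⟨u, hu⟩ := exists_notMem_of_lt (insert 0 (D.biUnion fun i => Finset.univ.filter fun u : F => W i u = 0)) (by
    refine lt_of_le_of_lt (Finset.card_insert_le _ _) ?_
    have : (D.biUnion fun i => Finset.univ.filter fun u : F => W i u = 0).card ≤ D.card * 1 := by
      apply Finset.card_biUnion_le_card_mul
      intro i hi
      rw [Finset.card_le_one]
      intro a ha b hb
      have ha := (Finset.mem_filter.1 ha).2
      have hb := (Finset.mem_filter.1 hb).2
      rw [hWu] at ha hb
      have h3 : (C (a - b)) * B ^ 2 = 0 := by rw [C_sub]; linear_combination ha - hb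
      rcases mul_eq_zero.1 h3 with h | h
      · rw [C_eq_zero] at h; exact sub_eq_zero.1 h
      · exact absurd h (hBm.pow 2).ne_zero
    nlinarith)
  rw [Finset.mem_insert, not_or] at hu
  obtain ⟨hu0, hu1⟩ := hu
  have hWne : ∀ i ∈ D, W i u ≠ 0 := by
    intro i hi h
    exact hu1 (Finset.mem_biUnion.2 ⟨i, hi, by simp [h]⟩)
  -- choose s
  set A : F[X] := X ^ (n - 2) + C u * X with hA
  have hAdeg : A.natDegree ≤ n - 2 := by
    refine (natDegree_add_le _ _).trans (max_le (by simp) ?_)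
    exact (natDegree_C_mul_le _ _).trans (by rw [natDegree_X]; omega)
  have hAB : ∀ i ∈ D, (B * A + d i).natDegree ≤ n := by
    intro i hi
    refine (natDegree_add_le _ _).trans (max_le ?_ (hdeg i hi))
    exact natDegree_mul_le.trans (by omega)
  have key : ∀ i ∈ D, (Finset.univ.filter fun s : F => ¬ ((B * A + d i) + C s * B).Separable).card ≤ 2 * n := by
    intro i hi
    apply pencil (B * A + d i) B
    · rw [hB]
      apply IsCoprime.pow_right
      apply IsCoprime.symm
      rw [(irreducible_X_sub_C c).coprime_iff_not_dvd, dvd_iff_isRoot, IsRoot.def]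
      simpa using hd i hi
    · exact hWne i hi
    · refine (natDegree_sub_le _ _).trans (max_le ?_ ?_)
      · refine natDegree_mul_le.trans ?_
        have := (natDegree_derivative_le (B * A + d i))
        have := hAB i hi
        omega
      · refine natDegree_mul_le.trans ?_
        have := (natDegree_derivative_le B)
        have := hAB i hi
        omega
    · intro s hs; exact (Finset.mem_filter.1 hs).2
  have key0 : (Finset.univ.filter fun s : F => ¬ (A + C s * 1).Separable).card ≤ n := by
    apply pencil A 1 isCoprime_one_right
    · intro h0
      have := congrArg (fun p => p.coeff 0) h0
      simp only [mul_one, derivative_one, mul_zero, sub_zero, coeff_derivative, hA, coeff_add, coeff_X_pow, coeff_C_mul, coeff_X, coeff_zero] at this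
      rw [if_neg (by omega)] at this
      simp at this
      exact hu0 this
    · simp only [mul_one, derivative_one, mul_zero, sub_zero]
      exact (natDegree_derivative_le _).trans (by omega)
    · intro s hs; exact (Finset.mem_filter.1 hs).2
  obtain ⟨s, hs⟩ := exists_notMem_of_lt (insert (- A.eval c) ((Finset.univ.filter fun s : F => ¬ (A + C s * 1).Separable) ∪
      D.biUnion fun i => Finset.univ.filter fun s : F => ¬ ((B * A + d i) + C s * B).Separable)) (by
    refine lt_of_le_of_lt (Finset.card_insert_le _ _) ?_
    have h1 := Finset.card_union_le (Finset.univ.filter fun s : F => ¬ (A + C s * 1).Separable)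
      (D.biUnion fun i => Finset.univ.filter fun s : F => ¬ ((B * A + d i) + C s * B).Separable)
    have h2 := Finset.card_biUnion_le_card_mul D (fun i => Finset.univ.filter fun s : F => ¬ ((B * A + d i) + C s * B).Separable) (2 * n) key
    nlinarith)
  simp only [Finset.mem_insert, Finset.mem_union, Finset.mem_biUnion, Finset.mem_filter, Finset.mem_univ, true_and, not_or, not_exists, not_and, not_not] at hs
  obtain ⟨hs1, hs2, hs3⟩ := hs
  have hdeg2 : (C u * X + C s : F[X]).degree < ((n - 2 : ℕ) : WithBot ℕ) := by
    refine lt_of_le_of_lt degree_linear_le ?_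
    exact_mod_cast (by omega : 1 < n - 2)
  have hgeq : A + C s * 1 = X ^ (n - 2) + (C u * X + C s) := by rw [hA]; ring
  refine ⟨A + C s * 1, ?_, ?_, ?_, hs2, ?_⟩
  · rw [hgeq]; exact monic_X_pow_add hdeg2
  · rw [hgeq]; exact natDegree_eq_of_degree_eq_some (by
      rw [degree_add_eq_left_of_degree_lt (by rw [degree_X_pow]; exact hdeg2), degree_X_pow])
  · intro h
    apply hs1
    simp at h
    linear_combination h
  · intro i hi
    have := hs3 i hi
    convert this using 1
    ring

end choice
end Pf

set_option linter.unusedSectionVars false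

namespace Pf

lemma sep_finset {K : Type*} [Field K] [IsAlgClosed K] (h : K[X]) (hm : h.Monic) (hs : h.Separable) :
    ∃ D : Finset K, h = ∏ d ∈ D, (X - C d) := by
  classical
  refine ⟨h.roots.toFinset, ?_⟩
  have h1 := (IsAlgClosed.splits h).eq_prod_roots_of_monic hm
  conv_lhs => rw [h1]
  rw [Finset.prod, Multiset.toFinset_val, Multiset.dedup_eq_self.2 (nodup_roots hs)]

section curve
variable {F : Type} [Field F] [Fintype F] {r n : ℕ}

/-- special data for the curves -/
structure Spec (α : Fin r → Fin n → F) where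
  t : Fin r × Fin 3 → F
  ht : Function.Injective t
  b : Fin r × Fin 3 → Fin n → F
  c : Fin r → F
  g : Fin r → F[X]
  h0 : ∀ i, mp (b (i, 0) + α i) = X ^ n
  h1 : ∀ i, mp (b (i, 1) + α i) = X ^ (n - 1) * (X - C 1)
  h2 : ∀ i, mp (b (i, 2) + α i) = (X - C (c i)) ^ 2 * g i
  hg : ∀ i, (g i).Monic
  hgs : ∀ i, (g i).Separable
  hgc : ∀ i, (g i).eval (c i) ≠ 0
  h3 : ∀ i j, j ≠ i → (mp (b (i, 2) + α j)).Separable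

lemma exists_with (α₀ : Fin n → F) (P : F[X]) (hP : P.Monic) (hd : P.natDegree = n) :
    ∃ b : Fin n → F, mp (b + α₀) = P := by
  obtain ⟨w, hw⟩ := exists_mp P hP hd
  exact ⟨w - α₀, by rw [sub_add_cancel, hw]⟩

lemma mp_add' (v w : Fin n → F) : mp (v + w) = mp v + ∑ j, C (w j) * X ^ (j : ℕ) := by
  simp only [mp, Pi.add_apply, map_add, add_mul, Finset.sum_add_distrib, add_assoc]

theorem exists_spec (hn : 4 ≤ n) (α : Fin r → Fin n → F) (hα : Function.Injective α)
    (hq : (r + 1) * (2 * n + 1) < Fintype.card F) : Nonempty (Spec α) := by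
  classical
  -- special points
  have ht : ∃ t : Fin r × Fin 3 → F, Function.Injective t := by
    have : Fintype.card (Fin r × Fin 3) ≤ Fintype.card F := by
      simp; nlinarith
    obtain ⟨e⟩ := Function.Embedding.nonempty_of_card_le this
    exact ⟨e, e.injective⟩
  obtain ⟨t, ht⟩ := ht
  have key : ∀ i, ∃ (c : F) (g : F[X]) (b : Fin n → F), mp (b + α i) = (X - C c) ^ 2 * g ∧ g.Monic ∧ g.Separable ∧
      g.eval c ≠ 0 ∧ ∀ j, j ≠ i → (mp (b + α j)).Separable := by
    intro i
    let d : Fin r → F[X] := fun j => ∑ k, C ((α j - α i) k) * X ^ (k : ℕ)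
    have hd0 : ∀ j ∈ (Finset.univ.erase i), d j ≠ 0 := by
      intro j hj h
      apply Finset.ne_of_mem_erase hj
      apply hα
      funext k
      have := low_coeff (α j - α i) k
      simp only [d] at h
      rw [h] at this
      simp at this
      exact (sub_eq_zero.1 this.symm)
    have hdd : ∀ j ∈ (Finset.univ.erase i), (d j).natDegree ≤ n := by
      intro j _
      exact natDegree_le_of_degree_le (deg_low (α j - α i)).le
    have hcard : (Finset.univ.erase i).card ≤ r := by
      refine (Finset.card_le_univ _).trans (by simp)
    obtain ⟨c, hc⟩ := choose_c (n := n) _ d hd0 hdd (by nlinarith)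
    obtain ⟨g, hg1, hg2, hg3, hg4, hg5⟩ := choose_g hn c _ d hc hdd (by nlinarith)
    obtain ⟨b, hb⟩ := exists_with (α i) ((X - C c) ^ 2 * g) (((monic_X_sub_C c).pow 2).mul hg1) (by
      rw [((monic_X_sub_C c).pow 2).natDegree_mul hg1, natDegree_pow, natDegree_X_sub_C, hg2]; omega)
    refine ⟨c, g, b, hb, hg1, hg4, hg3, ?_⟩
    intro j hj
    have : b + α j = (b + α i) + (α j - α i) := by abel
    rw [this, mp_add', hb]
    exact hg5 j (by simp [hj])
  choose c g b2 k1 k2 k3 k4 k5 using key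
  have e0 : ∀ i, ∃ b, mp (b + α i) = X ^ n := fun i => exists_with _ _ (monic_X_pow n) (natDegree_X_pow n)
  have e1 : ∀ i, ∃ b, mp (b + α i) = X ^ (n - 1) * (X - C 1) := fun i => exists_with _ _
    ((monic_X_pow _).mul (monic_X_sub_C _)) (by
      rw [(monic_X_pow _).natDegree_mul (monic_X_sub_C _), natDegree_X_pow, natDegree_X_sub_C]; omega)
  choose b0 hb0 using e0
  choose b1 hb1 using e1
  exact ⟨⟨t, ht, fun ik => ![b0 ik.1, b1 ik.1, b2 ik.1] ik.2, c, g, hb0, hb1, k1, k2, k3, k4, k5⟩⟩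

namespace Spec
variable {α : Fin r → Fin n → F} (S : Spec α)

noncomputable def w (t₀ : F) : Fin n → F := fun j =>
  (Lagrange.interpolate Finset.univ S.t (fun ik => S.b ik j)).eval t₀

noncomputable def nod : F[X] := Lagrange.nodal Finset.univ S.t

noncomputable def cf (v : Fin n → F) (j : Fin n) : F[X] :=
  Lagrange.interpolate Finset.univ S.t (fun ik => S.b ik j) + C (v j) * S.nod

lemma cf_eval (v : Fin n → F) (t₀ : F) : (fun j => (S.cf v j).eval t₀) = S.w t₀ + (S.nod.eval t₀) • v := by
  funext j
  simp [cf, w, mul_comm]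

lemma nod_eval (ik) : S.nod.eval (S.t ik) = 0 := Lagrange.eval_nodal_at_node (Finset.mem_univ _)

lemma nod_ne (t₀ : F) (h : ∀ ik, t₀ ≠ S.t ik) : S.nod.eval t₀ ≠ 0 := by
  rw [nod, Lagrange.eval_nodal, Finset.prod_ne_zero_iff]
  intro ik _
  exact sub_ne_zero.2 (h ik)

lemma nod_der (ik) : (derivative S.nod).eval (S.t ik) ≠ 0 := by
  classical
  rw [nod, Lagrange.eval_nodal_derivative_eval_node_eq (Finset.mem_univ _), Lagrange.eval_nodal, Finset.prod_ne_zero_iff]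
  intro x hx
  exact sub_ne_zero.2 (fun h => Finset.ne_of_mem_erase hx (S.ht h).symm)

lemma cf_node (v : Fin n → F) (ik) : (fun j => (S.cf v j).eval (S.t ik)) = S.b ik := by
  classical
  rw [cf_eval, nod_eval, zero_smul, add_zero]
  funext j
  exact Lagrange.eval_interpolate_at_node _ (S.ht.injOn) (Finset.mem_univ _)

lemma cf_deg (v : Fin n → F) (j) : (S.cf v j).natDegree ≤ 3 * r := by
  classical
  have hc : (Finset.univ : Finset (Fin r × Fin 3)).card = 3 * r := by simp [mul_comm]
  refine (natDegree_add_le _ _).trans (max_le ?_ ?_)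
  · apply natDegree_le_of_degree_le
    rw [← hc]
    exact (Lagrange.degree_interpolate_lt _ S.ht.injOn).le
  · refine (natDegree_C_mul_le _ _).trans ?_
    rw [nod, Lagrange.natDegree_nodal, hc]

noncomputable def cc (ik : Fin r × Fin 3) : F := if ik.2 = 2 then S.c ik.1 else 0

/-- transversality -/
def Good (v : Fin n → F) : Prop := ∀ ik, ∑ j, (derivative (S.cf v j)).eval (S.t ik) * S.cc ik ^ (j : ℕ) ≠ 0

lemma card_bad (hn : 1 ≤ n) (B : Finset (Fin n → F)) (hB : ∀ v ∈ B, ¬ S.Good v) :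
    Fintype.card F * B.card ≤ (3 * r) * Fintype.card F ^ n := by
  classical
  let j0 : Fin n := ⟨0, by omega⟩
  have h1 : ∀ ik, Fintype.card F * (Finset.univ.filter fun v : Fin n → F =>
      ∑ j, (derivative (S.cf v j)).eval (S.t ik) * S.cc ik ^ (j : ℕ) = 0).card ≤ 1 * Fintype.card F ^ n := by
    intro ik
    apply dcount _ (Pi.single j0 1)
    intro v
    have hlin : ∀ s : F, ∑ j, (derivative (S.cf (v + s • Pi.single j0 1) j)).eval (S.t ik) * S.cc ik ^ (j : ℕ) =
        ∑ j, (derivative (S.cf v j)).eval (S.t ik) * S.cc ik ^ (j : ℕ) + s * (derivative S.nod).eval (S.t ik) := by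
      intro s
      have : ∀ j, (derivative (S.cf (v + s • Pi.single j0 1) j)).eval (S.t ik) * S.cc ik ^ (j : ℕ) =
        (derivative (S.cf v j)).eval (S.t ik) * S.cc ik ^ (j : ℕ) +
          if j = j0 then s * (derivative S.nod).eval (S.t ik) else 0 := by
        intro j
        by_cases hj : j = j0
        · subst hj
          simp [cf, j0]
          ring
        · simp [cf, hj]
      rw [Finset.sum_congr rfl fun j _ => this j, Finset.sum_add_distrib]
      simp
    rw [Finset.card_le_one]
    intro a ha b hb
    have ha := (Finset.mem_filter.1 ha).2
    have hb := (Finset.mem_filter.1 hb).2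
    rw [hlin] at ha hb
    have : (a - b) * (derivative S.nod).eval (S.t ik) = 0 := by linear_combination ha - hb
    rcases mul_eq_zero.1 this with h | h
    · exact sub_eq_zero.1 h
    · exact absurd h (S.nod_der ik)
  have h2 : B ⊆ Finset.univ.biUnion fun ik => (Finset.univ.filter fun v : Fin n → F =>
      ∑ j, (derivative (S.cf v j)).eval (S.t ik) * S.cc ik ^ (j : ℕ) = 0) := by
    intro v hv
    have := hB v hv
    unfold Good at this
    push Not at this
    obtain ⟨ik, h⟩ := this
    exact Finset.mem_biUnion.2 ⟨ik, Finset.mem_univ _, by simpa using h⟩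
  have h3 := (Finset.card_le_card h2).trans Finset.card_biUnion_le
  calc _ ≤ _ := Nat.mul_le_mul_left _ h3
    _ = _ := Finset.mul_sum _ _ _
    _ ≤ _ := Finset.sum_le_card_nsmul _ _ _ fun ik _ => h1 ik
    _ = _ := by simp; ring

variable (K : Type) [Field K] [IsAlgClosed K] [Algebra F K]

noncomputable def crv (v : Fin n → F) (i : Fin r) : K[X][X] :=
  mp (fun j => (S.cf v j + C (α i j)).map (algebraMap F K))

lemma crv_spec (v : Fin n → F) (i : Fin r) (t₀ : F) :
    (S.crv K v i).map (evalRingHom (algebraMap F K t₀)) =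
      (mp ((fun j => (S.cf v j).eval t₀) + α i)).map (algebraMap F K) := by
  rw [crv, mp_map, mp_map]
  congr 1
  funext j
  simp [eval_map_algebraMap, aeval_algebraMap_apply]

lemma crv_coeff (v : Fin n → F) (i : Fin r) (m : ℕ) :
    ∃ p : F[X], p.natDegree ≤ 3 * r ∧ (S.crv K v i).coeff m = p.map (algebraMap F K) := by
  by_cases hm : m < n
  · refine ⟨S.cf v ⟨m, hm⟩ + C (α i ⟨m, hm⟩), ?_, mp_coeff _ ⟨m, hm⟩⟩
    exact (natDegree_add_le _ _).trans (max_le (S.cf_deg _ _) (by simp))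
  · rcases (not_lt.1 hm).eq_or_lt with h | h
    · refine ⟨1, by simp, ?_⟩
      have h1 := mp_monic (fun j => (S.cf v j + C (α i j)).map (algebraMap F K))
      have h2 := mp_natDegree (fun j => (S.cf v j + C (α i j)).map (algebraMap F K))
      rw [Polynomial.map_one, ← h1.coeff_natDegree, h2, crv, ← h]
    · refine ⟨0, by simp, ?_⟩
      rw [Polynomial.map_zero]
      apply coeff_eq_zero_of_natDegree_lt
      rw [crv, mp_natDegree]; exact h

lemma crv_der (v : Fin n → F) (i : Fin r) (c t₀ : F)  :
    ((S.crv K v i).eval (C (algebraMap F K c))).derivative.eval (algebraMap F K t₀) =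
      algebraMap F K (∑ j, (derivative (S.cf v j)).eval t₀ * c ^ (j : ℕ)) := by
  rw [crv, mp_eval, derivative_add, ← C_pow, derivative_C, zero_add, derivative_sum, eval_finsetSum, map_sum]
  refine Finset.sum_congr rfl fun j _ => ?_
  rw [← C_pow, derivative_mul, derivative_C, mul_zero, add_zero, derivative_map]
  simp [eval_map_algebraMap, aeval_algebraMap_apply]

theorem geo (hr : 2 ≤ r) (hn : 4 ≤ n) (v : Fin n → F) (hv : S.Good v) :
    Nonempty (Geo K r n (3 * r) (S.crv K v)) := by
  have hcond : ∀ i j, j ≠ i → ∃ D' : Finset K,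
      (S.crv K v j).map (evalRingHom (algebraMap F K (S.t (i, 2)))) = ∏ d ∈ D', (X - C d) := by
    intro i j hj
    rw [crv_spec, cf_node]
    exact sep_finset _ ((mp_monic _).map _) ((S.h3 i j hj).map)
  have hder : ∀ ik : Fin r × Fin 3, ((S.crv K v ik.1).eval (C (algebraMap F K (S.cc ik)))).derivative.eval (algebraMap F K (S.t ik)) ≠ 0 := by
    intro ik
    rw [crv_der]
    intro h
    exact hv ik ((map_eq_zero _).1 h)
  apply exists_geo (by omega)
  · intro i; exact mp_monic _
  · intro i; exact mp_natDegree _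
  · intro i m
    obtain ⟨p, hp, e⟩ := S.crv_coeff K v i m
    rw [e]; exact natDegree_map_le.trans hp
  · intro i
    have : ∃ j : Fin r, i ≠ j := by
      by_cases h : i = ⟨0, by omega⟩
      · exact ⟨⟨1, by omega⟩, by subst h; simp⟩
      · exact ⟨_, h⟩
    obtain ⟨j, hj⟩ := this
    exact ⟨_, hcond j i hj⟩
  · intro i
    refine ⟨algebraMap F K (S.t (i, 0)), algebraMap F K (S.cc (i, 0)), by simp, ?_, hder (i, 0)⟩
    rw [crv_spec, cf_node, S.h0]
    simp [cc]
  · intro i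
    refine ⟨algebraMap F K (S.t (i, 1)), algebraMap F K (S.cc (i, 1)), 1, by simp [cc], ?_, hder (i, 1)⟩
    rw [crv_spec, cf_node, S.h1]
    simp [cc]
  · intro i
    obtain ⟨D, hD⟩ := sep_finset _ ((S.hg i).map (algebraMap F K)) ((S.hgs i).map)
    refine ⟨algebraMap F K (S.t (i, 2)), algebraMap F K (S.cc (i, 2)), D, ⟨?_, ?_, hder (i, 2)⟩, fun j hj => hcond i j hj⟩
    · intro hmem
      apply S.hgc i
      have : ((S.g i).map (algebraMap F K)).eval (algebraMap F K (S.c i)) = 0 := by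
        rw [hD, eval_prod, Finset.prod_eq_zero hmem]
        simp [cc]
      rw [eval_map_algebraMap, aeval_algebraMap_apply] at this
      simpa using this
    · rw [crv_spec, cf_node, S.h2, ← hD]
      simp [cc]

end Spec
end curve
end Pf

set_option linter.unusedSectionVars false

namespace Pf
open Classical in
/-- event set in the symmetric groups -/
noncomputable def Ev (r n : ℕ) (P : (Fin r → ℕ) → Prop) : Finset (Fin r → Equiv.Perm (Fin n)) :=
  Finset.univ.filter fun g => P fun i => cyc (g i)

lemma Ev_conj {r n : ℕ} (P : (Fin r → ℕ) → Prop) (g s : Fin r → Equiv.Perm (Fin n)) (h : s ∈ Ev r n P) :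
    g⁻¹ * s * g ∈ Ev r n P := by
  simp only [Ev, Finset.mem_filter, Finset.mem_univ, true_and] at h ⊢
  convert h using 2
  exact cyc_conj _ _

/-- bound for one good curve -/
theorem curve_bound (r n : ℕ) (hr : 2 ≤ r) (hn : 4 ≤ n) (P : (Fin r → ℕ) → Prop) (ε : ℝ) (hε : 0 < ε) :
    ∃ Q : ℕ, ∀ (F : Type) [Field F] [Fintype F], Q < Fintype.card F →
      ∀ (α : Fin r → Fin n → F) (S : Spec α) (v : Fin n → F), S.Good v →
      ∀ T : Finset F, (∀ t ∈ T, (∀ i, (mp ((fun j => (S.cf v j).eval t) + α i)).Separable) ∧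
        P (fun i => omegaPoly (mp ((fun j => (S.cf v j).eval t) + α i)))) →
      (n.factorial ^ r : ℕ) * (T.card : ℝ) ≤ (1 + ε) * (Fintype.card F : ℕ) * (Ev r n P).card := by
  obtain ⟨Q, hQ⟩ := equidist_upper r n (3 * r) (by omega) ε hε
  refine ⟨Q, ?_⟩
  intro F _ _ hF α S v hv T hT
  classical
  let K := AlgebraicClosure F
  let p := ringChar F
  have : CharP F p := ringChar.charP F
  obtain ⟨k, hp, hk⟩ := FiniteField.card F p
  have : Fact p.Prime := ⟨hp⟩
  have : CharP K p := charP_of_injective_algebraMap (algebraMap F K).injective p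
  obtain ⟨G⟩ := S.geo K hr hn v hv
  let T' : Finset K := T.image (algebraMap F K)
  have key : ∀ x ∈ T', ∃ (ℓ : Fin r → Fin n → K) (τ : Fin r → Equiv.Perm (Fin n)),
      x ^ (Fintype.card F) = x ∧ (∀ i, Function.Injective (ℓ i)) ∧
      (∀ i, (S.crv K v i).map (evalRingHom x) = ∏ j, (X - C (ℓ i j))) ∧
      (∀ i j, ℓ i (τ i j) ^ (Fintype.card F) = ℓ i j) ∧ τ ∈ Ev r n P := by
    intro x hx
    obtain ⟨t, ht, rfl⟩ := Finset.mem_image.1 hx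
    obtain ⟨hs, hP⟩ := hT t ht
    have h1 : ∀ i, ∃ ℓ : Fin n → K, (mp ((fun j => (S.cf v j).eval t) + α i)).map (algebraMap F K) = ∏ j, (X - C (ℓ j)) := by
      intro i
      exact exists_roots_fin _ ((mp_monic _).map _) n (by rw [natDegree_map, mp_natDegree]) (IsAlgClosed.splits _)
    choose ℓ hℓ using h1
    have hinj : ∀ i, Function.Injective (ℓ i) := by
      intro i
      rw [← separable_prod_X_sub_C_iff, ← hℓ]
      exact (hs i).map
    have h2 := fun i => exists_frob_perm _ (ℓ i) (hinj i) (hℓ i)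
    choose τ hτ using h2
    refine ⟨ℓ, τ, ?_, hinj, ?_, hτ, ?_⟩
    · rw [← map_pow, FiniteField.pow_card]
    · intro i; rw [S.crv_spec, hℓ]
    · simp only [Ev, Finset.mem_filter, Finset.mem_univ, true_and]
      convert hP using 2 with i
      exact (omega_eq _ (ℓ i) (mp_monic _) (hinj i) (hℓ i) (τ i) (hτ i)).symm
  choose! ℓ τ k1 k2 k3 k4 k5 using key
  rw [hk] at k1 k4 hF
  have := hQ K p k (S.crv K v) G hF (fun i => (mp_natDegree _).le) (by
      intro i m
      obtain ⟨f, hf, e⟩ := S.crv_coeff K v i m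
      rw [e]; exact natDegree_map_le.trans hf) (by
      intro i m a
      obtain ⟨f, hf, e⟩ := S.crv_coeff K v i m
      rw [e, coeff_map, ← map_pow, ← hk, FiniteField.pow_card]) T' ℓ τ k1 k2 k3 k4 (Ev r n P) (Ev_conj P)
  rw [Finset.filter_true_of_mem k5, Finset.card_image_of_injective _ (algebraMap F K).injective] at this
  rw [hk]
  exact this

/-- one-sided estimate -/
theorem one_sided (r n : ℕ) (hr : 2 ≤ r) (hn : 4 ≤ n) (P : (Fin r → ℕ) → Prop) (ε : ℝ) (hε : 0 < ε) :
    ∃ Q : ℕ, ∀ (F : Type) [Field F] [Fintype F], Q < Fintype.card F →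
      ∀ (α : Fin r → Fin n → F), Function.Injective α → ∀ A : Finset (Fin n → F),
      (∀ v ∈ A, P (fun i => omegaPoly (mp (v + α i)))) →
      (n.factorial ^ r : ℕ) * (A.card : ℝ) ≤ ((Ev r n P).card + ε) * (Fintype.card F : ℝ) ^ n := by
  classical
  set M : ℕ := n.factorial ^ r with hM
  have hMpos : 0 < M := by positivity
  have hE : (Ev r n P).card ≤ M := by
    refine (Finset.card_le_univ _).trans ?_
    simp [Fintype.card_perm, hM]
  obtain ⟨Q₁, hQ₁⟩ := curve_bound r n hr hn P (ε / (2 * M)) (by positivity)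
  set B : ℕ := 6 * r + r * (n + 1) with hB
  obtain ⟨Q₂, hQ₂⟩ := exists_nat_gt (2 * M * B / ε)
  refine ⟨max (max Q₁ Q₂) ((r + 1) * (2 * n + 1)), ?_⟩
  intro F _ _ hF α hα A hA
  have hF1 : Q₁ < Fintype.card F := lt_of_le_of_lt (le_max_left _ _ |>.trans (le_max_left _ _)) hF
  have hF2 : Q₂ < Fintype.card F := lt_of_le_of_lt (le_max_right _ _ |>.trans (le_max_left _ _)) hF
  have hF3 : (r + 1) * (2 * n + 1) < Fintype.card F := lt_of_le_of_lt (le_max_right _ _) hF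
  obtain ⟨S⟩ := exists_spec hn α hα hF3
  set q := Fintype.card F with hq
  have hqpos : 0 < q := Fintype.card_pos
  -- nonspecial points
  let U : Finset F := Finset.univ.filter fun t => ∀ ik, t ≠ S.t ik
  have hU : q ≤ U.card + 3 * r := by
    have h1 : (Finset.univ : Finset F) ⊆ U ∪ Finset.univ.image S.t := by
      intro t _
      by_cases h : ∀ ik, t ≠ S.t ik
      · exact Finset.mem_union_left _ (by simp [U, h])
      · push Not at h
        obtain ⟨ik, h⟩ := h
        exact Finset.mem_union_right _ (Finset.mem_image.2 ⟨ik, Finset.mem_univ _, h.symm⟩)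
    have h2 := (Finset.card_le_card h1).trans (Finset.card_union_le _ _)
    have h3 : (Finset.univ.image S.t).card ≤ 3 * r := by
      refine Finset.card_image_le.trans ?_
      simp [mul_comm]
    rw [Finset.card_univ] at h2
    omega
  let fv : (Fin n → F) → F → (Fin n → F) := fun v t j => (S.cf v j).eval t
  have hbij : ∀ t ∈ U, ∀ A' : Finset (Fin n → F), (Finset.univ.filter fun v => fv v t ∈ A').card = A'.card := by
    intro t ht A'
    have hne : S.nod.eval t ≠ 0 := S.nod_ne t (by simpa [U] using ht)
    have hinj : Function.Injective (fun v => fv v t) := by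
      intro v v' h
      simp only [fv] at h
      rw [S.cf_eval, S.cf_eval] at h
      exact smul_right_injective _ hne (add_left_cancel h)
    have hbj : Function.Bijective (fun v => fv v t) := hinj.bijective_of_finite
    refine Finset.card_bij (fun v _ => fv v t) (by simp) (fun v _ v' _ h => hinj h) ?_
    intro w hw
    obtain ⟨v, hv⟩ := hbj.2 w
    exact ⟨v, by simp only [Finset.mem_filter, Finset.mem_univ, true_and]; simp only at hv; rw [hv]; exact hw, hv⟩
  -- inseparable
  let I : Finset (Fin n → F) := Finset.univ.filter fun w => ∃ i, ¬ (mp (w + α i)).Separable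
  have hI : q * I.card ≤ r * (n + 1) * q ^ n := by
    have h1 : I ⊆ Finset.univ.biUnion fun i : Fin r => Finset.univ.filter fun w => ¬ (mp (w + α i)).Separable := by
      intro w hw
      obtain ⟨i, hi⟩ := (Finset.mem_filter.1 hw).2
      exact Finset.mem_biUnion.2 ⟨i, Finset.mem_univ _, by simp [hi]⟩
    have h2 := (Finset.card_le_card h1).trans Finset.card_biUnion_le
    have h3 : ∀ i : Fin r, q * (Finset.univ.filter fun w => ¬ (mp (w + α i)).Separable).card ≤ (n + 1) * q ^ n := by
      intro i
      have := card_insep (n := n) (by omega) ((Finset.univ.filter fun w => ¬ (mp (w + α i)).Separable).image (· + α i)) (by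
        intro v hv
        obtain ⟨w, hw, rfl⟩ := Finset.mem_image.1 hv
        exact (Finset.mem_filter.1 hw).2)
      rwa [Finset.card_image_of_injective _ (add_left_injective (α i))] at this
    calc _ ≤ _ := Nat.mul_le_mul_left _ h2
      _ = _ := Finset.mul_sum _ _ _
      _ ≤ _ := Finset.sum_le_card_nsmul _ _ _ fun ik _ => h3 ik
      _ = _ := by simp; ring
  -- double counts
  have d1 : ∀ A' : Finset (Fin n → F), ∑ v, (U.filter fun t => fv v t ∈ A').card = U.card * A'.card := by
    intro A'
    simp only [Finset.card_filter]
    rw [Finset.sum_comm]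
    rw [Finset.sum_congr rfl fun t ht => ?_]
    · exact (Finset.sum_const _).trans (by rw [smul_eq_mul])
    · rw [← Finset.card_filter]; exact hbij t ht A'
  -- bad v
  let Bd : Finset (Fin n → F) := Finset.univ.filter fun v => ¬ S.Good v
  have hBd : q * Bd.card ≤ 3 * r * q ^ n := S.card_bad (by omega) Bd (by intro v hv; exact (Finset.mem_filter.1 hv).2)
  have hv1 : ∀ v, (M : ℝ) * ((U.filter fun t => fv v t ∈ A).card : ℝ) ≤ (1 + ε / (2 * M)) * q * (Ev r n P).card +
      M * ((U.filter fun t => fv v t ∈ I).card : ℝ) + (if S.Good v then 0 else (M : ℝ) * q) := by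
    intro v
    have h1 : (U.filter fun t => fv v t ∈ A).card ≤ (U.filter fun t => fv v t ∈ A ∧ fv v t ∉ I).card +
        (U.filter fun t => fv v t ∈ I).card := by
      refine (Finset.card_le_card ?_).trans (Finset.card_union_le _ _)
      intro t ht
      rw [Finset.mem_filter] at ht
      by_cases h : fv v t ∈ I
      · exact Finset.mem_union_right _ (Finset.mem_filter.2 ⟨ht.1, h⟩)
      · exact Finset.mem_union_left _ (Finset.mem_filter.2 ⟨ht.1, ht.2, h⟩)
    have h1' : ((U.filter fun t => fv v t ∈ A).card : ℝ) ≤ ((U.filter fun t => fv v t ∈ A ∧ fv v t ∉ I).card : ℝ) +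
        ((U.filter fun t => fv v t ∈ I).card : ℝ) := by exact_mod_cast h1
    have h2 : (M : ℝ) * ((U.filter fun t => fv v t ∈ A ∧ fv v t ∉ I).card : ℝ) ≤
        (1 + ε / (2 * M)) * q * (Ev r n P).card + (if S.Good v then 0 else (M : ℝ) * q) := by
      split_ifs with hg
      · have := hQ₁ F hF1 α S v hg (U.filter fun t => fv v t ∈ A ∧ fv v t ∉ I) (by
          intro t ht
          obtain ⟨-, ht1, ht2⟩ := Finset.mem_filter.1 ht
          refine ⟨?_, hA _ ht1⟩
          intro i
          by_contra hns
          exact ht2 (Finset.mem_filter.2 ⟨Finset.mem_univ _, i, hns⟩))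
        rw [add_zero]; exact this
      · have h3 : ((U.filter fun t => fv v t ∈ A ∧ fv v t ∉ I).card : ℝ) ≤ q := by
          exact_mod_cast Finset.card_le_univ _
        have h4 : 0 ≤ (1 + ε / (2 * M)) * q * ((Ev r n P).card : ℝ) := by positivity
        have h5 : (0 : ℝ) < M := by exact_mod_cast hMpos
        nlinarith
    have h5 : (0 : ℝ) < M := by exact_mod_cast hMpos
    nlinarith
  have hsum := Finset.sum_le_sum (s := Finset.univ) fun v _ => hv1 v
  simp only [Finset.sum_add_distrib, ← Finset.mul_sum] at hsum
  have e1 := d1 A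
  have e2 := d1 I
  have e1' : (∑ v, ((U.filter fun t => fv v t ∈ A).card : ℝ)) = U.card * A.card := by exact_mod_cast e1
  have e2' : (∑ v, ((U.filter fun t => fv v t ∈ I).card : ℝ)) = U.card * I.card := by exact_mod_cast e2
  have e3 : ∑ v : Fin n → F, (if S.Good v then 0 else (M : ℝ) * q) = M * q * Bd.card := by
    rw [Finset.sum_ite, Finset.sum_const_zero, zero_add, Finset.sum_const]
    simp only [nsmul_eq_mul, Bd]
    ring
  rw [e1', e2', e3, Finset.sum_const, Finset.card_univ, nsmul_eq_mul] at hsum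
  have hcardv : (Fintype.card (Fin n → F) : ℝ) = (q : ℝ) ^ n := by simp [hq]
  rw [hcardv] at hsum
  have hUq : (U.card : ℝ) ≤ q := by exact_mod_cast Finset.card_le_univ _
  have hU' : (q : ℝ) ≤ U.card + 3 * r := by exact_mod_cast hU
  have hI' : (q : ℝ) * I.card ≤ r * (n + 1) * (q : ℝ) ^ n := by exact_mod_cast hI
  have hBd' : (q : ℝ) * Bd.card ≤ 3 * r * (q : ℝ) ^ n := by exact_mod_cast hBd
  have hAq : (A.card : ℝ) ≤ (q : ℝ) ^ n := by rw [← hcardv]; exact_mod_cast Finset.card_le_univ _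
  have hM0 : (0 : ℝ) < M := by exact_mod_cast hMpos
  have hq0 : (0 : ℝ) < q := by exact_mod_cast hqpos
  have hqn : (0 : ℝ) < (q : ℝ) ^ n := by positivity
  have hI2 : (U.card : ℝ) * I.card ≤ r * (n + 1) * (q : ℝ) ^ n := 
    (mul_le_mul_of_nonneg_right hUq (by positivity)).trans hI'
  -- combine
  have hfin : (M : ℝ) * (q * A.card) ≤ (q : ℝ) ^ n * ((1 + ε / (2 * M)) * q * (Ev r n P).card) + M * B * (q : ℝ) ^ n := by
    have a1 : (q : ℝ) * A.card ≤ U.card * A.card + 3 * r * (q : ℝ) ^ n := by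
      calc (q : ℝ) * A.card ≤ (U.card + 3 * r) * A.card := mul_le_mul_of_nonneg_right hU' (by positivity)
        _ = U.card * A.card + 3 * r * A.card := by ring
        _ ≤ _ := by gcongr
    have a2 : (M : ℝ) * (q * A.card) ≤ M * (U.card * A.card) + M * (3 * r * (q : ℝ) ^ n) := by
      rw [← mul_add]; gcongr
    have a3 := mul_le_mul_of_nonneg_left hI2 hM0.le
    have a4 := mul_le_mul_of_nonneg_left hBd' hM0.le
    have a5 : (B : ℝ) = 6 * r + r * (n + 1) := by rw [hB]; push_cast; ring
    rw [a5]
    nlinarith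
  have hBq : (M : ℝ) * B ≤ ε / 2 * q := by
    have : (2 * M * B / ε : ℝ) < q := hQ₂.trans (by exact_mod_cast hF2)
    rw [div_lt_iff₀ hε] at this
    linarith
  have hEr : ((Ev r n P).card : ℝ) ≤ M := by exact_mod_cast hE
  have hE2 : ε / (2 * M) * (Ev r n P).card ≤ ε / 2 := by
    calc ε / (2 * M) * (Ev r n P).card ≤ ε / (2 * M) * M := by gcongr
      _ = ε / 2 := by field_simp
  have hfin2 : (q : ℝ) * (M * A.card) ≤ q * (((Ev r n P).card + ε) * (q : ℝ) ^ n) := by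
    calc (q : ℝ) * (M * A.card) = M * (q * A.card) := by ring
      _ ≤ _ := hfin
      _ = q * (q : ℝ) ^ n * ((Ev r n P).card + ε / (2 * M) * (Ev r n P).card) + (M * B) * (q : ℝ) ^ n := by ring
      _ ≤ q * (q : ℝ) ^ n * ((Ev r n P).card + ε / 2) + (ε / 2 * q) * (q : ℝ) ^ n := by gcongr
      _ = _ := by ring
  exact le_of_mul_le_mul_left hfin2 hq0

end Pf

set_option linter.unusedSectionVars false

namespace Pf

lemma Ev_compl (r n : ℕ) (P : (Fin r → ℕ) → Prop) :
    (Ev r n P).card + (Ev r n (fun x => ¬ P x)).card = n.factorial ^ r := by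
  classical
  have h := Finset.card_filter_add_card_filter_not (s := (Finset.univ : Finset (Fin r → Equiv.Perm (Fin n))))
    (fun g => P fun i => cyc (g i))
  have h2 : (Finset.univ : Finset (Fin r → Equiv.Perm (Fin n))).card = n.factorial ^ r := by
    simp [Fintype.card_perm]
  rw [h2] at h
  rw [← h]
  unfold Ev
  congr!

theorem partB (r n : ℕ) (hr : 2 ≤ r) (hn : 4 ≤ n) (ε : ℝ) (hε : 0 < ε) :
    ∃ Q : ℕ, ∀ (F : Type) [Field F] [Fintype F], Q < Fintype.card F →
      ∀ a : Fin r → F[X], Function.Injective a → (∀ i, (a i).degree < (n : WithBot ℕ)) →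
      |(Fintype.card F : ℝ)⁻¹ ^ n *
                (Nat.card {f : F[X] // f.Monic ∧ f.natDegree = n ∧
                  ∀ i j, omegaPoly (f + a i) = omegaPoly (f + a j)} : ℝ)
        - ((Ev r n (fun x => ∀ i j, x i = x j)).card : ℝ) / (n.factorial ^ r : ℕ)| ≤ ε := by
  classical
  set P : (Fin r → ℕ) → Prop := fun x => ∀ i j, x i = x j with hP
  obtain ⟨Q₁, h₁⟩ := one_sided r n hr hn P ε hε
  obtain ⟨Q₂, h₂⟩ := one_sided r n hr hn (fun x => ¬ P x) ε hε
  refine ⟨max Q₁ Q₂, ?_⟩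
  intro F _ _ hF a ha hdeg
  let α : Fin r → Fin n → F := fun i j => (a i).coeff j
  have hmp : ∀ v i, mp v + a i = mp (v + α i) := fun v i => mp_add v (a i) (hdeg i)
  have hα : Function.Injective α := by
    intro i j h
    apply ha
    rw [← low_eq (a i) (hdeg i), ← low_eq (a j) (hdeg j)]
    exact Finset.sum_congr rfl fun k _ => by rw [show (a i).coeff k = (a j).coeff k from congrFun h k]
  let A : Finset (Fin n → F) := Finset.univ.filter fun v => P (fun i => omegaPoly (mp (v + α i)))
  let A' : Finset (Fin n → F) := Finset.univ.filter fun v => ¬ P (fun i => omegaPoly (mp (v + α i)))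
  have hAA : (A.card : ℝ) + A'.card = (Fintype.card F : ℝ) ^ n := by
    have h := Finset.card_filter_add_card_filter_not (s := (Finset.univ : Finset (Fin n → F)))
      (fun v => P (fun i => omegaPoly (mp (v + α i))))
    have h2 : (Finset.univ : Finset (Fin n → F)).card = Fintype.card F ^ n := by simp
    rw [h2] at h
    exact_mod_cast h
  have hcard : Nat.card {f : F[X] // f.Monic ∧ f.natDegree = n ∧
                  ∀ i j, omegaPoly (f + a i) = omegaPoly (f + a j)} = A.card := by
    rw [← Nat.card_eq_finsetCard]
    symm
    refine Nat.card_congr (Equiv.ofBijective (fun v : A => ⟨mp v.1, mp_monic _, mp_natDegree _, ?_⟩) ⟨?_, ?_⟩)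
    · have := (Finset.mem_filter.1 v.2).2
      intro i j
      rw [hmp, hmp]
      exact this i j
    · intro v w h
      exact Subtype.ext (mp_inj (congrArg Subtype.val h))
    · rintro ⟨f, hf1, hf2, hf3⟩
      obtain ⟨v, rfl⟩ := exists_mp f hf1 hf2
      refine ⟨⟨v, Finset.mem_filter.2 ⟨Finset.mem_univ _, ?_⟩⟩, rfl⟩
      intro i j
      have := hf3 i j
      rwa [hmp, hmp] at this
  rw [hcard]
  have k1 := h₁ F (lt_of_le_of_lt (le_max_left _ _) hF) α hα A (fun v hv => (Finset.mem_filter.1 hv).2)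
  have k2 := h₂ F (lt_of_le_of_lt (le_max_right _ _) hF) α hα A' (fun v hv => (Finset.mem_filter.1 hv).2)
  have hE : ((Ev r n P).card : ℝ) + (Ev r n (fun x => ¬ P x)).card = (n.factorial ^ r : ℕ) := by
    exact_mod_cast Ev_compl r n P
  set M : ℕ := n.factorial ^ r
  have hM1 : (1 : ℝ) ≤ M := by
    have : 0 < M := by positivity
    exact_mod_cast this
  have hq : (0 : ℝ) < (Fintype.card F : ℝ) ^ n := by
    have : 0 < Fintype.card F := Fintype.card_pos
    positivity
  set q : ℝ := (Fintype.card F : ℝ) ^ n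
  rw [inv_pow, inv_mul_eq_div, div_sub_div _ _ hq.ne' (by positivity), abs_le]
  have hMq : 0 < q * M := by positivity
  have hle : ε * q ≤ ε * (q * M) := by
    have := mul_le_mul_of_nonneg_left hM1 hq.le
    nlinarith
  constructor
  · rw [le_div_iff₀ hMq]
    have e : (A'.card : ℝ) = q - A.card := by linarith
    have e2 : ((Ev r n (fun x => ¬ P x)).card : ℝ) = M - (Ev r n P).card := by linarith
    rw [e, e2] at k2
    nlinarith
  · rw [div_le_iff₀ hMq]
    nlinarith

end Pf

set_option linter.unusedSectionVars false

namespace Pf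

/-- colourings fixed by a permutation -/
def Fx {n : ℕ} (z : ℕ) (σ : Equiv.Perm (Fin n)) : Type := {c : Fin n → Fin z // ∀ x, c (σ x) = c x}

instance {n : ℕ} (z : ℕ) (σ : Equiv.Perm (Fin n)) : Finite (Fx z σ) := Subtype.finite

lemma card_Fx {n : ℕ} (z : ℕ) (σ : Equiv.Perm (Fin n)) : Nat.card (Fx z σ) = z ^ cyc σ := by
  have e : (Quotient (Equiv.Perm.SameCycle.setoid σ) → Fin z) ≃ Fx z σ := by
    refine Equiv.ofBijective (fun f => ⟨fun x => f (Quotient.mk _ x), fun x => ?_⟩) ⟨?_, ?_⟩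
    · refine congrArg f (Quotient.sound ?_)
      exact (Equiv.Perm.sameCycle_apply_left).2 (Equiv.Perm.SameCycle.refl _ _)
    · intro f g h
      funext x
      induction x using Quotient.inductionOn with
      | h x => exact congrFun (congrArg Subtype.val h) x
    · rintro ⟨c, hc⟩
      have hinv : ∀ x, c (σ⁻¹ x) = c x := by
        intro x
        have := hc (σ⁻¹ x)
        rw [← Equiv.Perm.mul_apply, mul_inv_cancel] at this
        exact this.symm
      have hn : ∀ (k : ℕ) x, c ((σ ^ k) x) = c x := by
        intro k
        induction k with
        | zero => intro x; rfl
        | succ k ih => intro x; rw [pow_succ, Equiv.Perm.mul_apply, ih, hc]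
      have hn' : ∀ (k : ℕ) x, c ((σ⁻¹ ^ k) x) = c x := by
        intro k
        induction k with
        | zero => intro x; rfl
        | succ k ih => intro x; rw [pow_succ, Equiv.Perm.mul_apply, ih, hinv]
      refine ⟨fun y => Quotient.lift c ?_ y, rfl⟩
      rintro a b ⟨k, rfl⟩
      rcases k with k | k
      · exact (hn k a).symm
      · rw [zpow_negSucc, ← inv_pow]
        exact (hn' _ a).symm
  rw [← Nat.card_congr e, Nat.card_fun, Nat.card_eq_fintype_card (α := Fin z), Fintype.card_fin, cyc]

lemma swap_fix {n z : ℕ} (c : Fin n → Fin z) (a b : Fin n) (h : c b = c a) (y : Fin n) : c (Equiv.swap a b y) = c y := by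
  rcases eq_or_ne y a with rfl | h1
  · simp [h]
  · rcases eq_or_ne y b with rfl | h2
    · simp [h]
    · rw [Equiv.swap_apply_of_ne_of_ne h1 h2]

lemma fx_iff {n z : ℕ} (p : Fin (n + 1)) (e : Equiv.Perm (Fin n)) (c : Fin (n + 1) → Fin z) :
    (∀ x, c (Equiv.Perm.decomposeFin.symm (p, e) x) = c x) ↔ c p = c 0 ∧ ∀ x, c (e x).succ = c x.succ := by
  rw [Fin.forall_fin_succ, Equiv.Perm.decomposeFin_symm_apply_zero]
  refine and_congr_right fun h => forall_congr' fun x => ?_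
  rw [Equiv.Perm.decomposeFin_symm_apply_succ, swap_fix c 0 p h]

lemma card_Fx_zero {n z : ℕ} (e : Equiv.Perm (Fin n)) :
    Nat.card (Fx z (Equiv.Perm.decomposeFin.symm (0, e))) = z * Nat.card (Fx z e) := by
  have e : Fx z (Equiv.Perm.decomposeFin.symm (0, e)) ≃ Fin z × Fx z e :=
    { toFun := fun c => (c.1 0, ⟨fun x => c.1 x.succ, ((fx_iff _ _ _).1 c.2).2⟩)
      invFun := fun d => ⟨Fin.cons d.1 d.2.1, (fx_iff _ _ _).2 ⟨rfl, fun x => by simpa using d.2.2 x⟩⟩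
      left_inv := fun c => Subtype.ext (by
        funext x
        refine Fin.cases ?_ (fun x => ?_) x <;> simp)
      right_inv := fun d => by
        refine Prod.ext ?_ (Subtype.ext ?_)
        · simp
        · funext x; simp }
  rw [Nat.card_congr e, Nat.card_prod, Nat.card_eq_fintype_card (α := Fin z), Fintype.card_fin]

lemma card_Fx_succ {n z : ℕ} (y : Fin n) (e : Equiv.Perm (Fin n)) :
    Nat.card (Fx z (Equiv.Perm.decomposeFin.symm (y.succ, e))) = Nat.card (Fx z e) := by
  refine Nat.card_congr
    { toFun := fun c => ⟨fun x => c.1 x.succ, ((fx_iff _ _ _).1 c.2).2⟩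
      invFun := fun d => ⟨Fin.cons (d.1 y) d.1, (fx_iff _ _ _).2 ⟨by simp, fun x => by simpa using d.2 x⟩⟩
      left_inv := fun c => Subtype.ext (by
        have h := ((fx_iff _ _ _).1 c.2).1
        funext x
        refine Fin.cases ?_ (fun x => ?_) x
        · simpa using h
        · simp)
      right_inv := fun d => by
        refine (Subtype.ext ?_)
        funext x; simp }

lemma sum_pow_cyc_nat (n z : ℕ) : ∑ σ : Equiv.Perm (Fin n), z ^ cyc σ = ∏ j ∈ Finset.range n, (z + j) := by
  simp only [← card_Fx]
  induction n with
  | zero =>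
    simp only [Finset.range_zero, Finset.prod_empty]
    rw [Fintype.sum_unique, card_Fx, cyc]
    have : IsEmpty (Quotient (Equiv.Perm.SameCycle.setoid (default : Equiv.Perm (Fin 0)))) :=
      ⟨fun x => Quotient.inductionOn x fun x => x.elim0⟩
    simp
  | succ n ih =>
    rw [← Equiv.sum_comp Equiv.Perm.decomposeFin.symm, Fintype.sum_prod_type, Fin.sum_univ_succ]
    simp only [card_Fx_zero, card_Fx_succ]
    rw [← Finset.mul_sum, Finset.sum_const, Finset.prod_range_succ, ih]
    simp
    ring

lemma sum_pow_cyc (n : ℕ) (w : ℂ) : ∑ σ : Equiv.Perm (Fin n), w ^ cyc σ = ∏ j ∈ Finset.range n, (w + j) := by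
  have h : (∑ σ : Equiv.Perm (Fin n), X ^ cyc σ : ℂ[X]) = ∏ j ∈ Finset.range n, (X + C (j : ℂ)) := by
    apply Polynomial.eq_of_infinite_eval_eq
    refine Set.Infinite.mono ?_ (Set.infinite_range_of_injective (Nat.cast_injective (R := ℂ)))
    rintro _ ⟨z, rfl⟩
    rw [Set.mem_ofPred_eq, eval_finsetSum, eval_prod]
    simp only [eval_pow, eval_X, eval_add, eval_C]
    exact_mod_cast sum_pow_cyc_nat n z
  have := congrArg (Polynomial.eval w) h
  simpa [eval_finsetSum, eval_prod] using this

/-- probability of `k` cycles -/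
noncomputable def pc (n k : ℕ) : ℝ := (Finset.univ.filter fun σ : Equiv.Perm (Fin n) => cyc σ = k).card / n.factorial

lemma cyc_le {n : ℕ} (σ : Equiv.Perm (Fin n)) : cyc σ ≤ n := by
  unfold cyc
  have := Nat.card_le_card_of_surjective (Quotient.mk (Equiv.Perm.SameCycle.setoid σ)) Quotient.mk_surjective
  simpa using this

lemma pc_nonneg (n k : ℕ) : 0 ≤ pc n k := by unfold pc; positivity

lemma pc_gf (n : ℕ) (w : ℂ) : ∑ k ∈ Finset.range (n + 1), (pc n k : ℂ) * w ^ k =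
    (∏ j ∈ Finset.range n, (w + j)) / n.factorial := by
  rw [← sum_pow_cyc, ← Finset.sum_fiberwise_of_maps_to (s := Finset.univ) (t := Finset.range (n + 1)) (g := fun σ : Equiv.Perm (Fin n) => cyc σ)
    (fun σ _ => Finset.mem_range.2 (Nat.lt_succ_of_le (cyc_le σ))), Finset.sum_div]
  refine Finset.sum_congr rfl fun k _ => ?_
  rw [Finset.sum_congr rfl (g := fun _ => w ^ k) (fun σ hσ => by rw [(Finset.mem_filter.1 hσ).2]), Finset.sum_const, pc]
  push_cast
  rw [nsmul_eq_mul]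
  ring

lemma pc_sum (n : ℕ) : ∑ k ∈ Finset.range (n + 1), pc n k = 1 := by
  have h := pc_gf n 1
  have h2 : (∏ j ∈ Finset.range n, ((1 : ℂ) + j)) = n.factorial := by
    rw [← Finset.prod_range_add_one_eq_factorial]
    push_cast
    exact Finset.prod_congr rfl fun j _ => by ring
  rw [h2, div_self (by exact_mod_cast n.factorial_ne_zero)] at h
  simp only [one_pow, mul_one] at h
  exact_mod_cast h

lemma Ev_eq (r n : ℕ) (hr : 1 ≤ r) : ((Ev r n (fun x => ∀ i j, x i = x j)).card : ℝ) / (n.factorial ^ r : ℕ) =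
    ∑ k ∈ Finset.range (n + 1), pc n k ^ r := by
  classical
  have h1 : Ev r n (fun x => ∀ i j, x i = x j) = (Finset.range (n + 1)).biUnion fun k =>
      Fintype.piFinset fun _ : Fin r => Finset.univ.filter fun σ : Equiv.Perm (Fin n) => cyc σ = k := by
    ext g
    simp only [Ev, Finset.mem_filter, Finset.mem_univ, true_and, Finset.mem_biUnion, Fintype.mem_piFinset]
    constructor
    · intro h
      exact ⟨cyc (g ⟨0, by omega⟩), Finset.mem_range.2 (Nat.lt_succ_of_le (cyc_le _)), fun i => h _ _⟩
    · rintro ⟨k, -, hk⟩ i j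
      rw [hk, hk]
  rw [h1, Finset.card_biUnion]
  · simp only [Fintype.card_piFinset, Finset.prod_const, Finset.card_univ, Fintype.card_fin]
    push_cast
    rw [Finset.sum_div]
    exact Finset.sum_congr rfl fun k _ => by rw [pc, div_pow]
  · intro k _ k' _ hkk
    rw [Function.onFun, Finset.disjoint_left]
    intro g hg hg'
    rw [Fintype.mem_piFinset] at hg hg'
    have a := (Finset.mem_filter.1 (hg ⟨0, by omega⟩)).2
    have b := (Finset.mem_filter.1 (hg' ⟨0, by omega⟩)).2
    exact hkk (a.symm.trans b)

end Pf

namespace Pf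
open Filter Topology MeasureTheory

noncomputable def Hm (n : ℕ) : ℝ := ∑ j ∈ Finset.range n, (1 : ℝ) / (j + 1)

lemma Hm_eq (n : ℕ) : Hm n = (harmonic n : ℝ) := by
  unfold Hm harmonic
  push_cast
  exact Finset.sum_congr rfl fun j _ => by rw [one_div]

lemma log_le_Hm (n : ℕ) : Real.log n ≤ Hm n := by
  rw [Hm_eq]
  rcases Nat.eq_zero_or_pos n with rfl | hn
  · simp
  refine le_trans ?_ (log_add_one_le_harmonic n)
  apply Real.log_le_log
  · exact_mod_cast hn
  · push_cast; linarith

lemma Hm_le (n : ℕ) : Hm n ≤ 1 + Real.log n := by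
  rw [Hm_eq]
  exact harmonic_le_one_add_log n

lemma sum_sq_le (n : ℕ) : ∑ j ∈ Finset.range n, ((1 : ℝ) / (j + 1)) ^ 2 ≤ 2 := by
  have : ∑ j ∈ Finset.range n, ((1 : ℝ) / (j + 1)) ^ 2 ≤ 2 - 1 / (n : ℝ) := by
    induction n with
    | zero => simp
    | succ n ih =>
      rw [Finset.sum_range_succ]
      rcases Nat.eq_zero_or_pos n with rfl | hn
      · norm_num
      have h : (0 : ℝ) < n := by exact_mod_cast hn
      have : ((1 : ℝ) / (n + 1)) ^ 2 ≤ 1 / n - 1 / (n + 1) := by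
        rw [div_sub_div _ _ h.ne' (by positivity), div_pow, div_le_div_iff₀ (by positivity) (by positivity)]
        nlinarith
      push_cast
      linarith
  refine this.trans ?_
  have : (0 : ℝ) ≤ 1 / (n : ℝ) := by positivity
  linarith

/-- factor -/
noncomputable def fac (t : ℝ) (j : ℕ) : ℂ := 1 + (Complex.exp (Complex.I * t) - 1) * ((1 / (j + 1) : ℝ) : ℂ)

lemma fac_norm (t : ℝ) (j : ℕ) : ‖fac t j‖ ≤
    Real.exp (-((1 / (j + 1)) - (1 / (j + 1)) ^ 2) * (1 - Real.cos t)) := by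
  set a : ℝ := 1 / (j + 1) with ha
  have h1 : fac t j = ((1 - a + a * Real.cos t : ℝ) : ℂ) + ((a * Real.sin t : ℝ) : ℂ) * Complex.I := by
    rw [fac, ← ha, mul_comm Complex.I, Complex.exp_mul_I]
    push_cast
    ring
  have h2 : ‖fac t j‖ ^ 2 = 1 - 2 * (a - a ^ 2) * (1 - Real.cos t) := by
    rw [← Complex.normSq_eq_norm_sq, h1, Complex.normSq_add_mul_I]
    have := Real.sin_sq_add_cos_sq t
    linear_combination a ^ 2 * this
  rw [← abs_of_nonneg (norm_nonneg (fac t j))]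
  apply abs_le_of_sq_le_sq _ (Real.exp_pos _).le
  rw [h2, ← Real.exp_nat_mul]
  have := Real.add_one_le_exp (((2 : ℕ) : ℝ) * (-(a - a ^ 2) * (1 - Real.cos t)))
  push_cast at this ⊢
  linarith

lemma fac_le_one (t : ℝ) (j : ℕ) : ‖fac t j‖ ≤ 1 := by
  refine (fac_norm t j).trans ?_
  rw [Real.exp_le_one_iff]
  have h1 : (1 : ℝ) / (j + 1) ≤ 1 := by
    rw [div_le_one (by positivity)]; linarith [(Nat.cast_nonneg j : (0 : ℝ) ≤ j)]
  have h0 : (0 : ℝ) ≤ 1 / (j + 1) := by positivity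
  have h2 := Real.cos_le_one t
  have : 0 ≤ ((1 : ℝ) / (j + 1)) - (1 / (j + 1)) ^ 2 := by nlinarith
  nlinarith

noncomputable def chi (n : ℕ) (t : ℝ) : ℂ := ∏ j ∈ Finset.range n, fac t j

lemma chi_le_one (n : ℕ) (t : ℝ) : ‖chi n t‖ ≤ 1 := by
  rw [chi, norm_prod]
  exact Finset.prod_le_one (fun _ _ => norm_nonneg _) fun j _ => fac_le_one t j

lemma chi_bound (n : ℕ) (t : ℝ) (ht : |t| ≤ Real.pi) (hn : 4 ≤ Real.log n) :
    ‖chi n t‖ ≤ Real.exp (-(t ^ 2 * Real.log n / Real.pi ^ 2)) := by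
  have h1 : ‖chi n t‖ ≤ ∏ j ∈ Finset.range n, Real.exp (-((1 / (j + 1)) - (1 / (j + 1)) ^ 2) * (1 - Real.cos t)) := by
    rw [chi, norm_prod]
    exact Finset.prod_le_prod (fun _ _ => norm_nonneg _) fun j _ => fac_norm t j
  refine h1.trans ?_
  rw [← Real.exp_sum, Real.exp_le_exp, ← Finset.sum_mul, Finset.sum_neg_distrib, Finset.sum_sub_distrib]
  have h2 := Real.cos_le_one_sub_mul_cos_sq ht
  have h3 := sum_sq_le n
  have h4 := log_le_Hm n
  unfold Hm at h4
  set A := ∑ j ∈ Finset.range n, (1 : ℝ) / (j + 1)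
  set B := ∑ j ∈ Finset.range n, ((1 : ℝ) / (j + 1)) ^ 2
  have h5 : Real.log n / 2 ≤ A - B := by linarith
  have h6 : 2 / Real.pi ^ 2 * t ^ 2 ≤ 1 - Real.cos t := by linarith
  have h7 : 0 ≤ 2 / Real.pi ^ 2 * t ^ 2 := by positivity
  have h8 : Real.log n / 2 * (2 / Real.pi ^ 2 * t ^ 2) ≤ (A - B) * (1 - Real.cos t) := by
    apply mul_le_mul h5 h6 h7; linarith
  have h9 : Real.log n / 2 * (2 / Real.pi ^ 2 * t ^ 2) = t ^ 2 * Real.log n / Real.pi ^ 2 := by ring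
  linarith

lemma prod_diff (a b : ℕ → ℂ) (ha : ∀ j, ‖a j‖ ≤ 1) (hb : ∀ j, ‖b j‖ ≤ 1) (n : ℕ) :
    ‖∏ j ∈ Finset.range n, a j - ∏ j ∈ Finset.range n, b j‖ ≤ ∑ j ∈ Finset.range n, ‖a j - b j‖ := by
  induction n with
  | zero => simp
  | succ n ih =>
    rw [Finset.prod_range_succ, Finset.prod_range_succ, Finset.sum_range_succ]
    have e : (∏ j ∈ Finset.range n, a j) * a n - (∏ j ∈ Finset.range n, b j) * b n =
      (∏ j ∈ Finset.range n, a j - ∏ j ∈ Finset.range n, b j) * a n + (∏ j ∈ Finset.range n, b j) * (a n - b n) := by ring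
    rw [e]
    refine (norm_add_le _ _).trans ?_
    rw [norm_mul, norm_mul]
    have h1 : ‖∏ j ∈ Finset.range n, b j‖ ≤ 1 := by
      rw [norm_prod]
      exact Finset.prod_le_one (fun _ _ => norm_nonneg _) fun j _ => hb j
    have h2 := mul_le_of_le_one_right (norm_nonneg (∏ j ∈ Finset.range n, a j - ∏ j ∈ Finset.range n, b j)) (ha n)
    have h3 := mul_le_of_le_one_left (norm_nonneg (a n - b n)) h1
    linarith

lemma norm_expI_sub_one (t : ℝ) : ‖Complex.exp (Complex.I * t) - 1‖ ≤ |t| := by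
  have := Real.norm_exp_I_mul_ofReal_sub_one_le (x := t)
  simpa using this

lemma chi_approx (n : ℕ) (t : ℝ) (ht : |t| ≤ 1) :
    ‖chi n t - Complex.exp ((Complex.exp (Complex.I * t) - 1) * (Hm n : ℂ))‖ ≤ 2 * t ^ 2 := by
  set w := Complex.exp (Complex.I * t) - 1 with hw
  have hwt : ‖w‖ ≤ |t| := norm_expI_sub_one t
  have hre : w.re ≤ 0 := by
    rw [hw, Complex.sub_re, mul_comm, Complex.exp_ofReal_mul_I_re, Complex.one_re]
    linarith [Real.cos_le_one t]
  have h1 : Complex.exp (w * (Hm n : ℂ)) = ∏ j ∈ Finset.range n, Complex.exp (w * ((1 / (j + 1) : ℝ) : ℂ)) := by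
    rw [← Complex.exp_sum, ← Finset.mul_sum, Hm, Complex.ofReal_sum]
  rw [h1, chi]
  refine (prod_diff _ _ (fac_le_one t) ?_ n).trans ?_
  · intro j
    rw [Complex.norm_exp, Real.exp_le_one_iff, Complex.re_mul_ofReal]
    exact mul_nonpos_of_nonpos_of_nonneg hre (by positivity)
  · have h2 : ∀ j ∈ Finset.range n, ‖fac t j - Complex.exp (w * ((1 / (j + 1) : ℝ) : ℂ))‖ ≤ t ^ 2 * (1 / (j + 1)) ^ 2 := by
      intro j _
      have ha : (1 : ℝ) / (j + 1) ≤ 1 := by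
        rw [div_le_one (by positivity)]; linarith [(Nat.cast_nonneg j : (0 : ℝ) ≤ j)]
      have h0 : (0 : ℝ) ≤ 1 / (j + 1) := by positivity
      have hn : ‖w * ((1 / (j + 1) : ℝ) : ℂ)‖ = ‖w‖ * (1 / (j + 1)) := by
        rw [norm_mul, Complex.norm_real, Real.norm_of_nonneg h0]
      have := Complex.norm_exp_sub_one_sub_id_le (x := w * ((1 / (j + 1) : ℝ) : ℂ)) (by
        rw [hn]; nlinarith [norm_nonneg w])
      rw [hn] at this
      rw [norm_sub_rev, fac, ← hw]
      have e : Complex.exp (w * ((1 / (j + 1) : ℝ) : ℂ)) - (1 + w * ((1 / (j + 1) : ℝ) : ℂ)) = 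
        Complex.exp (w * ((1 / (j + 1) : ℝ) : ℂ)) - 1 - w * ((1 / (j + 1) : ℝ) : ℂ) := by ring
      rw [e]
      refine this.trans ?_
      rw [mul_pow]
      apply mul_le_mul_of_nonneg_right _ (by positivity)
      rw [← sq_abs t]
      exact pow_le_pow_left₀ (norm_nonneg _) hwt 2
    refine (Finset.sum_le_sum h2).trans ?_
    rw [← Finset.mul_sum]
    have := sum_sq_le n
    nlinarith [sq_nonneg t]

end Pf

namespace Pf
open Filter Topology MeasureTheory

noncomputable def sg (n : ℕ) : ℝ := Real.sqrt (Real.log n)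

lemma log_tendsto : Tendsto (fun n : ℕ => Real.log n) atTop atTop :=
  Real.tendsto_log_atTop.comp tendsto_natCast_atTop_atTop

lemma sg_tendsto : Tendsto sg atTop atTop := Real.tendsto_sqrt_atTop.comp log_tendsto

lemma sg_sq (n : ℕ) (h : 0 < sg n) : sg n ^ 2 = Real.log n := by
  apply Real.sq_sqrt
  exact (Real.sqrt_pos.1 h).le

noncomputable def hh (n : ℕ) (u : ℝ) : ℂ := Complex.exp (-(Complex.I * u * sg n)) * chi n (u / sg n)

noncomputable def xk (n k : ℕ) : ℝ := (k - Real.log n) / sg n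

lemma chi_sum (n : ℕ) (t : ℝ) : chi n t = ∑ k ∈ Finset.range (n + 1), (pc n k : ℂ) * Complex.exp (Complex.I * t) ^ k := by
  rw [pc_gf, chi, ← Finset.prod_range_add_one_eq_factorial, Nat.cast_prod, ← Finset.prod_div_distrib]
  refine Finset.prod_congr rfl fun j _ => ?_
  rw [fac]
  have : ((j : ℂ) + 1) ≠ 0 := by exact_mod_cast j.succ_ne_zero
  push_cast
  field_simp
  ring

lemma hh_sum (n : ℕ) (hn : 0 < sg n) (u : ℝ) :
    hh n u = ∑ k ∈ Finset.range (n + 1), (pc n k : ℂ) * Complex.exp (Complex.I * u * xk n k) := by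
  rw [hh, chi_sum, Finset.mul_sum]
  refine Finset.sum_congr rfl fun k _ => ?_
  rw [← Complex.exp_nat_mul, mul_left_comm, ← Complex.exp_add]
  congr 2
  have : (sg n : ℂ) ≠ 0 := by exact_mod_cast hn.ne'
  rw [xk, ← sg_sq n hn]
  push_cast
  field_simp
  ring

lemma hh_norm_le_one (n : ℕ) (u : ℝ) : ‖hh n u‖ ≤ 1 := by
  rw [hh, norm_mul, Complex.norm_exp]
  have : (-(Complex.I * u * sg n)).re = 0 := by
    rw [mul_assoc, ← Complex.ofReal_mul]; simp
  rw [this, Real.exp_zero, one_mul]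
  exact chi_le_one _ _

lemma hh_norm_bound (n : ℕ) (hn : 4 ≤ Real.log n) (u : ℝ) (hu : |u| ≤ Real.pi * sg n) :
    ‖hh n u‖ ≤ Real.exp (-(1 / Real.pi ^ 2) * u ^ 2) := by
  have hs : 0 < sg n := Real.sqrt_pos.2 (by linarith)
  rw [hh, norm_mul, Complex.norm_exp]
  have : (-(Complex.I * u * sg n)).re = 0 := by
    rw [mul_assoc, ← Complex.ofReal_mul]; simp
  rw [this, Real.exp_zero, one_mul]
  refine (chi_bound n (u / sg n) ?_ hn).trans_eq ?_
  · rw [abs_div, abs_of_pos hs, div_le_iff₀ hs]; exact hu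
  · congr 1
    rw [← sg_sq n hs]
    field_simp

lemma exp_three (t : ℝ) (ht : |t| ≤ 1) :
    ‖Complex.exp (Complex.I * t) - 1 - Complex.I * t + (t : ℂ) ^ 2 / 2‖ ≤ |t| ^ 3 := by
  have h := Complex.exp_bound (x := Complex.I * t) (by simpa using ht) (n := 3) (by norm_num)
  have e : Complex.exp (Complex.I * t) - ∑ m ∈ Finset.range 3, (Complex.I * t) ^ m / (m.factorial : ℂ) =
      Complex.exp (Complex.I * t) - 1 - Complex.I * t + (t : ℂ) ^ 2 / 2 := by
    simp [Finset.sum_range_succ, mul_pow, Nat.factorial]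
    ring
  rw [e] at h
  refine h.trans ?_
  have e2 : ‖Complex.I * (t : ℂ)‖ = |t| := by simp
  rw [e2]
  apply mul_le_of_le_one_right (by positivity)
  norm_num [Nat.factorial]

lemma expo_bound (n : ℕ) (hn : 0 < sg n) (u : ℝ) (hu : |u / sg n| ≤ 1) :
    ‖-(Complex.I * u * sg n) + (Complex.exp (Complex.I * (u / sg n : ℝ)) - 1) * (Hm n : ℂ) - (-((u : ℂ) ^ 2 / 2))‖ ≤
      (|u| ^ 3 + |u|) / sg n := by
  set t : ℝ := u / sg n with ht
  have hut : u = t * sg n := by rw [ht]; field_simp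
  have e : -(Complex.I * u * sg n) + (Complex.exp (Complex.I * t) - 1) * (Hm n : ℂ) - (-((u : ℂ) ^ 2 / 2)) =
      (Complex.exp (Complex.I * t) - 1 - Complex.I * t + (t : ℂ) ^ 2 / 2) * ((sg n ^ 2 : ℝ) : ℂ) +
      (Complex.exp (Complex.I * t) - 1) * ((Hm n - Real.log n : ℝ) : ℂ) := by
    rw [← sg_sq n hn, hut]
    push_cast
    ring
  rw [e]
  refine (norm_add_le _ _).trans ?_
  rw [norm_mul, norm_mul, Complex.norm_real, Complex.norm_real, Real.norm_of_nonneg (by positivity)]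
  have h1 := exp_three t hu
  have h2 := norm_expI_sub_one t
  have h3 : ‖Hm n - Real.log n‖ ≤ 1 := by
    rw [Real.norm_eq_abs, abs_le]
    constructor <;> linarith [log_le_Hm n, Hm_le n]
  have hu' : |u| = |t| * sg n := by rw [hut, abs_mul, abs_of_pos hn]
  have e3 : (|u| ^ 3 + |u|) / sg n = |t| ^ 3 * sg n ^ 2 + |t| * 1 := by
    rw [hu']; field_simp
  rw [e3]
  gcongr

lemma hh_tendsto (u : ℝ) : Tendsto (fun n => hh n u) atTop (𝓝 (Complex.exp (-((u : ℂ) ^ 2 / 2)))) := by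
  have hinv : Tendsto (fun n => (sg n)⁻¹) atTop (𝓝 0) := tendsto_inv_atTop_zero.comp sg_tendsto
  have ht : Tendsto (fun n => u / sg n) atTop (𝓝 0) := by
    simpa [div_eq_mul_inv] using hinv.const_mul u
  have hev : ∀ᶠ n in atTop, 0 < sg n ∧ |u / sg n| ≤ 1 := by
    have h1 := sg_tendsto.eventually_gt_atTop 0
    have h2 : ∀ᶠ n in atTop, |u / sg n| < 1 := by
      have := (tendsto_order.1 (by simpa using ht.abs : Tendsto (fun n => |u / sg n|) atTop (𝓝 0))).2 1 one_pos
      exact this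
    filter_upwards [h1, h2] with n a b using ⟨a, b.le⟩
  let ex : ℕ → ℂ := fun n => -(Complex.I * u * sg n) + (Complex.exp (Complex.I * (u / sg n : ℝ)) - 1) * (Hm n : ℂ)
  have hex : Tendsto ex atTop (𝓝 (-((u : ℂ) ^ 2 / 2))) := by
    rw [tendsto_iff_norm_sub_tendsto_zero]
    have hz : Tendsto (fun n => (|u| ^ 3 + |u|) / sg n) atTop (𝓝 0) := by
      simpa [div_eq_mul_inv] using hinv.const_mul (|u| ^ 3 + |u|)
    refine tendsto_of_tendsto_of_tendsto_of_le_of_le' tendsto_const_nhds hz (Eventually.of_forall fun _ => norm_nonneg _) ?_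
    filter_upwards [hev] with n hn
    exact expo_bound n hn.1 u hn.2
  have hexp : Tendsto (fun n => Complex.exp (ex n)) atTop (𝓝 (Complex.exp (-((u : ℂ) ^ 2 / 2)))) :=
    (Complex.continuous_exp.tendsto _).comp hex
  have hdiff : Tendsto (fun n => hh n u - Complex.exp (ex n)) atTop (𝓝 0) := by
    apply squeeze_zero_norm' (a := fun n => 2 * (u / sg n) ^ 2)
    · filter_upwards [hev] with n hn
      have := chi_approx n (u / sg n) hn.2
      rw [hh]
      simp only [ex]
      rw [Complex.exp_add, ← mul_sub, norm_mul, Complex.norm_exp]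
      have h0 : (-(Complex.I * u * sg n)).re = 0 := by
        rw [mul_assoc, ← Complex.ofReal_mul]; simp
      rw [h0, Real.exp_zero, one_mul]
      exact this
    · simpa using (ht.pow 2).const_mul 2
  simpa using hdiff.add hexp

end Pf

namespace Pf
open Filter Topology MeasureTheory

lemma gauss (b : ℝ) (hb : 0 < b) (x : ℝ) :
    ∫ u : ℝ, Complex.exp (Complex.I * x * u) * Complex.exp (-b * u ^ 2) =
      ((Real.sqrt (Real.pi / b) * Real.exp (-x ^ 2 / (4 * b)) : ℝ) : ℂ) := by
  have h := fourierIntegral_gaussian (b := (b : ℂ)) (by simpa using hb) (x : ℂ)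
  rw [h]
  have h1 : (Real.pi / b : ℂ) ^ (1 / 2 : ℂ) = ((Real.sqrt (Real.pi / b) : ℝ) : ℂ) := by
    rw [Real.sqrt_eq_rpow, Complex.ofReal_cpow (by positivity)]
    push_cast
    rfl
  rw [h1]
  push_cast
  rfl

lemma hh_cont (n : ℕ) : Continuous (hh n) := by
  unfold hh chi fac
  fun_prop

noncomputable def psi (u : ℝ) : ℂ := Complex.exp (-((u : ℂ) ^ 2 / 2))

lemma psi_cont : Continuous psi := by unfold psi; fun_prop

lemma psi_norm (u : ℝ) : ‖psi u‖ = Real.exp (-(1 / 2) * u ^ 2) := by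
  rw [psi, Complex.norm_exp]
  congr 1
  have : (-((u : ℂ) ^ 2 / 2)) = ((-(1 / 2) * u ^ 2 : ℝ) : ℂ) := by push_cast; ring
  rw [this, Complex.ofReal_re]

lemma psi_int : Integrable psi := by
  refine Integrable.mono' (integrable_exp_neg_mul_sq (b := 1 / 2) (by norm_num)) psi_cont.aestronglyMeasurable ?_
  exact Eventually.of_forall fun u => (psi_norm u).le

noncomputable def ff (n : ℕ) : ℝ → ℂ := (Set.Ioc (-(Real.pi * sg n)) (Real.pi * sg n)).indicator (hh n)

lemma ff_norm (n : ℕ) (hn : 4 ≤ Real.log n) (u : ℝ) : ‖ff n u‖ ≤ Real.exp (-(1 / Real.pi ^ 2) * u ^ 2) := by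
  unfold ff
  by_cases h : u ∈ Set.Ioc (-(Real.pi * sg n)) (Real.pi * sg n)
  · rw [Set.indicator_of_mem h]
    exact hh_norm_bound n hn u (abs_le.2 ⟨h.1.le, h.2⟩)
  · rw [Set.indicator_of_notMem h, norm_zero]
    exact (Real.exp_pos _).le

lemma ff_meas (n : ℕ) : AEStronglyMeasurable (ff n) volume :=
  ((hh_cont n).aestronglyMeasurable).indicator measurableSet_Ioc

lemma ff_int (n : ℕ) (hn : 4 ≤ Real.log n) : Integrable (ff n) := by
  refine Integrable.mono' (integrable_exp_neg_mul_sq (b := 1 / Real.pi ^ 2) (by positivity)) (ff_meas n) ?_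
  exact Eventually.of_forall (ff_norm n hn)

lemma ff_tendsto (u : ℝ) : Tendsto (fun n => ff n u) atTop (𝓝 (psi u)) := by
  refine (hh_tendsto u).congr' ?_
  filter_upwards [(sg_tendsto.const_mul_atTop Real.pi_pos).eventually_gt_atTop |u|] with n hn
  rw [ff, Set.indicator_of_mem]
  exact ⟨(abs_lt.1 hn).1, (abs_lt.1 hn).2.le⟩

noncomputable def del (n : ℕ) : ℝ := (1 / (2 * Real.pi)) * ∫ u, ‖ff n u - psi u‖

lemma del_nonneg (n : ℕ) : 0 ≤ del n := by
  unfold del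
  have : 0 ≤ ∫ u, ‖ff n u - psi u‖ := integral_nonneg fun _ => norm_nonneg _
  positivity

lemma del_tendsto : Tendsto del atTop (𝓝 0) := by
  have h : Tendsto (fun n => ∫ u, ‖ff n u - psi u‖) atTop (𝓝 (∫ _ : ℝ, (0 : ℝ))) := by
    apply tendsto_integral_filter_of_dominated_convergence
      (fun u => Real.exp (-(1 / Real.pi ^ 2) * u ^ 2) + Real.exp (-(1 / 2) * u ^ 2))
    · exact Eventually.of_forall fun n => ((ff_meas n).sub psi_cont.aestronglyMeasurable).norm
    · filter_upwards [log_tendsto.eventually_ge_atTop 4] with n hn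
      refine Eventually.of_forall fun u => ?_
      rw [norm_norm]
      exact (norm_sub_le _ _).trans (add_le_add (ff_norm n hn u) (psi_norm u).le)
    · exact (integrable_exp_neg_mul_sq (by positivity)).add (integrable_exp_neg_mul_sq (by norm_num))
    · refine Eventually.of_forall fun u => ?_
      have := ((ff_tendsto u).sub_const (psi u)).norm
      simpa using this
  have h2 := h.const_mul (1 / (2 * Real.pi))
  rw [integral_zero, mul_zero] at h2
  exact h2

noncomputable def phi (x : ℝ) : ℝ := Real.exp (-x ^ 2 / 2) / Real.sqrt (2 * Real.pi)

lemma phi_eq (x : ℝ) : (phi x : ℂ) = (1 / (2 * Real.pi) : ℝ) * ∫ u : ℝ, psi u * Complex.exp (-(Complex.I * u * x)) := by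
  have h := gauss (1 / 2) (by norm_num) (-x)
  have e : ∫ u : ℝ, psi u * Complex.exp (-(Complex.I * u * x)) =
      ∫ u : ℝ, Complex.exp (Complex.I * ((-x : ℝ) : ℂ) * u) * Complex.exp (-((1 / 2 : ℝ) : ℂ) * u ^ 2) := by
    congr 1
    funext u
    rw [psi, mul_comm]
    congr 2
    · push_cast; ring
    · push_cast; ring
  rw [e, h, ← Complex.ofReal_mul, Complex.ofReal_inj, phi]
  have e2 : Real.pi / (1 / 2) = 2 * Real.pi := by ring
  have e3 : -(-x) ^ 2 / (4 * (1 / 2)) = -x ^ 2 / 2 := by ring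
  rw [e2, e3]
  have e4 : 2 * Real.pi = Real.sqrt (2 * Real.pi) * Real.sqrt (2 * Real.pi) := (Real.mul_self_sqrt (by positivity)).symm
  have e5 : 0 < Real.sqrt (2 * Real.pi) := by positivity
  field_simp
  rw [sq, ← e4]; 

lemma orth (s : ℝ) (hs : 0 < s) (l k : ℕ) :
    ∫ u in (-(Real.pi * s))..(Real.pi * s), Complex.exp (Complex.I * ((l - k : ℝ) / s : ℝ) * u) =
      if l = k then ((2 * Real.pi * s : ℝ) : ℂ) else 0 := by
  split_ifs with h
  · subst h
    simp
    ring
  · have hc : Complex.I * ((l - k : ℝ) / s : ℝ) ≠ 0 := by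
      apply mul_ne_zero Complex.I_ne_zero
      rw [Complex.ofReal_ne_zero]
      apply div_ne_zero _ hs.ne'
      rw [sub_ne_zero]
      exact_mod_cast h
    rw [integral_exp_mul_complex hc, div_eq_zero_iff]
    left
    rw [sub_eq_zero, Complex.exp_eq_exp_iff_exists_int]
    refine ⟨(l : ℤ) - k, ?_⟩
    have : (s : ℂ) ≠ 0 := by exact_mod_cast hs.ne'
    push_cast
    field_simp
    ring

lemma inversion (n : ℕ) (hn : 0 < sg n) (k : ℕ) (hk : k ∈ Finset.range (n + 1)) :
    ((sg n * pc n k : ℝ) : ℂ) = (1 / (2 * Real.pi) : ℝ) * ∫ u : ℝ, ff n u * Complex.exp (-(Complex.I * u * xk n k)) := by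
  have e1 : (fun u : ℝ => ff n u * Complex.exp (-(Complex.I * u * xk n k))) =
      (Set.Ioc (-(Real.pi * sg n)) (Real.pi * sg n)).indicator (fun u : ℝ => hh n u * Complex.exp (-(Complex.I * u * xk n k))) := by
    funext u
    rw [ff, Set.indicator_mul_left]
  have hle : -(Real.pi * sg n) ≤ Real.pi * sg n := by
    have : 0 < Real.pi * sg n := by positivity
    linarith
  rw [e1, integral_indicator measurableSet_Ioc, ← intervalIntegral.integral_of_le hle]
  have e2 : ∀ u : ℝ, hh n u * Complex.exp (-(Complex.I * u * xk n k)) =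
      ∑ l ∈ Finset.range (n + 1), (pc n l : ℂ) * Complex.exp (Complex.I * ((l - k : ℝ) / sg n : ℝ) * u) := by
    intro u
    rw [hh_sum n hn, Finset.sum_mul]
    refine Finset.sum_congr rfl fun l _ => ?_
    rw [mul_assoc, ← Complex.exp_add]
    congr 2
    rw [xk, xk]
    push_cast
    ring
  simp only [e2]
  rw [intervalIntegral.integral_finsetSum (fun l _ => by
    apply Continuous.intervalIntegrable; fun_prop)]
  simp only [intervalIntegral.integral_const_mul, orth _ hn]
  rw [Finset.sum_eq_single k]
  · rw [if_pos rfl]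
    push_cast
    have : (Real.pi : ℂ) ≠ 0 := by exact_mod_cast Real.pi_ne_zero
    field_simp
  · intro l _ hl
    rw [if_neg hl, mul_zero]
  · intro h; exact absurd hk h

lemma norm_expI_one (u x : ℝ) : ‖Complex.exp (-(Complex.I * u * x))‖ = 1 := by
  rw [Complex.norm_exp]
  have h0 : (-(Complex.I * u * x)).re = 0 := by
    rw [mul_assoc, ← Complex.ofReal_mul]; simp
  rw [h0, Real.exp_zero]

lemma llt (n : ℕ) (hn : 4 ≤ Real.log n) (k : ℕ) (hk : k ∈ Finset.range (n + 1)) :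
    |sg n * pc n k - phi (xk n k)| ≤ del n := by
  have hs : 0 < sg n := Real.sqrt_pos.2 (by linarith)
  have hm : ∀ g : ℝ → ℂ, Integrable g → Integrable fun u : ℝ => g u * Complex.exp (-(Complex.I * u * xk n k)) := by
    intro g hg
    refine Integrable.mono hg (hg.1.mul (Continuous.aestronglyMeasurable (by fun_prop))) ?_
    refine Eventually.of_forall fun u => ?_
    rw [norm_mul, norm_expI_one, mul_one]
  rw [← Real.norm_eq_abs, ← Complex.norm_real, Complex.ofReal_sub, inversion n hs k hk, phi_eq, ← mul_sub,
    ← integral_sub (hm _ (ff_int n hn)) (hm _ psi_int), norm_mul, Complex.norm_real, Real.norm_of_nonneg (by positivity), del]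
  apply mul_le_mul_of_nonneg_left _ (by positivity)
  refine (norm_integral_le_integral_norm _).trans_eq ?_
  congr 1
  funext u
  rw [← sub_mul, norm_mul, norm_expI_one, mul_one]

end Pf

namespace Pf
open Filter Topology MeasureTheory

lemma phi_nonneg (x : ℝ) : 0 ≤ phi x := by unfold phi; positivity

lemma phi_le_one (x : ℝ) : phi x ≤ 1 := by
  unfold phi
  rw [div_le_one (by positivity)]
  have h1 : Real.exp (-x ^ 2 / 2) ≤ 1 := by
    rw [Real.exp_le_one_iff]; nlinarith [sq_nonneg x]
  refine h1.trans ?_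
  rw [Real.one_le_sqrt]
  linarith [Real.pi_gt_three]

lemma gsum_eq (m n : ℕ) (hm : 1 ≤ m) (hn : 0 < sg n) :
    ∫ u : ℝ, hh n u * Complex.exp (-((1 / (2 * m) : ℝ) : ℂ) * u ^ 2) =
      ((Real.sqrt (2 * Real.pi * m) * ∑ k ∈ Finset.range (n + 1), pc n k * Real.exp (-(m * xk n k ^ 2 / 2)) : ℝ) : ℂ) := by
  have hm0 : (0 : ℝ) < m := by exact_mod_cast hm
  have hb : (0 : ℝ) < 1 / (2 * m) := by positivity
  have e : ∀ u : ℝ, hh n u * Complex.exp (-((1 / (2 * m) : ℝ) : ℂ) * u ^ 2) =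
      ∑ k ∈ Finset.range (n + 1), (pc n k : ℂ) * (Complex.exp (Complex.I * xk n k * u) * Complex.exp (-((1 / (2 * m) : ℝ) : ℂ) * u ^ 2)) := by
    intro u
    rw [hh_sum n hn, Finset.sum_mul]
    refine Finset.sum_congr rfl fun k _ => ?_
    rw [mul_assoc]
    congr 3
    ring_nf
  simp only [e]
  rw [integral_finsetSum]
  · simp only [integral_const_mul]
    simp only [gauss _ hb]
    rw [Finset.mul_sum]
    push_cast
    refine Finset.sum_congr rfl fun k _ => ?_
    have e1 : Real.pi / (1 / (2 * m)) = 2 * Real.pi * m := by field_simp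
    have e2 : -(xk n k : ℂ) ^ 2 / (4 * (1 / (2 * m))) = -(m * (xk n k : ℂ) ^ 2 / 2) := by
      have : (m : ℂ) ≠ 0 := by exact_mod_cast hm0.ne'
      field_simp
      norm_num
    rw [e1, e2]
    ring
  · intro k _
    apply Integrable.const_mul
    refine Integrable.mono' (integrable_exp_neg_mul_sq hb) (Continuous.aestronglyMeasurable (by fun_prop)) ?_
    refine Eventually.of_forall fun u => ?_
    rw [norm_mul, Complex.norm_exp, Complex.norm_exp]
    have h0 : (Complex.I * xk n k * u).re = 0 := by
      rw [mul_assoc, ← Complex.ofReal_mul]; simp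
    have h1 : (-((1 / (2 * m) : ℝ) : ℂ) * u ^ 2).re = -(1 / (2 * m)) * u ^ 2 := by
      rw [← Complex.ofReal_neg, ← Complex.ofReal_pow, ← Complex.ofReal_mul, Complex.ofReal_re]
    rw [h0, h1, Real.exp_zero, one_mul]

lemma gsum_tendsto (m : ℕ) (hm : 1 ≤ m) :
    Tendsto (fun n => ∑ k ∈ Finset.range (n + 1), pc n k * Real.exp (-(m * xk n k ^ 2 / 2))) atTop
      (𝓝 (1 / Real.sqrt (m + 1))) := by
  have hm0 : (0 : ℝ) < m := by exact_mod_cast hm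
  have hb : (0 : ℝ) < 1 / (2 * m) := by positivity
  have h1 : Tendsto (fun n => ∫ u : ℝ, hh n u * Complex.exp (-((1 / (2 * m) : ℝ) : ℂ) * u ^ 2)) atTop
      (𝓝 (∫ u : ℝ, psi u * Complex.exp (-((1 / (2 * m) : ℝ) : ℂ) * u ^ 2))) := by
    apply tendsto_integral_of_dominated_convergence (fun u => Real.exp (-(1 / (2 * m)) * u ^ 2))
    · intro n
      exact (hh_cont n).aestronglyMeasurable.mul (Continuous.aestronglyMeasurable (by fun_prop))
    · exact integrable_exp_neg_mul_sq hb
    · intro n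
      refine Eventually.of_forall fun u => ?_
      rw [norm_mul, Complex.norm_exp]
      have h1 : (-((1 / (2 * m) : ℝ) : ℂ) * u ^ 2).re = -(1 / (2 * m)) * u ^ 2 := by
        rw [← Complex.ofReal_neg, ← Complex.ofReal_pow, ← Complex.ofReal_mul, Complex.ofReal_re]
      rw [h1]
      exact mul_le_of_le_one_left (Real.exp_pos _).le (hh_norm_le_one n u)
    · exact Eventually.of_forall fun u => (hh_tendsto u).mul_const _
  have h2 : ∫ u : ℝ, psi u * Complex.exp (-((1 / (2 * m) : ℝ) : ℂ) * u ^ 2) =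
      ((Real.sqrt (2 * Real.pi * m) * (1 / Real.sqrt (m + 1)) : ℝ) : ℂ) := by
    have h3 := gauss (1 / (2 * m) + 1 / 2) (by positivity) 0
    have e : ∀ u : ℝ, psi u * Complex.exp (-((1 / (2 * m) : ℝ) : ℂ) * u ^ 2) =
        Complex.exp (Complex.I * (0 : ℝ) * u) * Complex.exp (-((1 / (2 * m) + 1 / 2 : ℝ) : ℂ) * u ^ 2) := by
      intro u
      rw [psi, ← Complex.exp_add, ← Complex.exp_add]
      congr 1
      push_cast
      ring
    simp only [e]
    rw [h3, Complex.ofReal_inj]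
    have e1 : Real.pi / (1 / (2 * m) + 1 / 2) = (2 * Real.pi * m) / (m + 1) := by field_simp; ring
    rw [e1, Real.sqrt_div (by positivity)]
    simp
    ring
  rw [h2] at h1
  have h4 : Tendsto (fun n => ((Real.sqrt (2 * Real.pi * m) *
      ∑ k ∈ Finset.range (n + 1), pc n k * Real.exp (-(m * xk n k ^ 2 / 2)) : ℝ) : ℂ)) atTop
      (𝓝 ((Real.sqrt (2 * Real.pi * m) * (1 / Real.sqrt (m + 1)) : ℝ) : ℂ)) := by
    refine h1.congr' ?_
    filter_upwards [sg_tendsto.eventually_gt_atTop 0] with n hn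
    exact gsum_eq m n hm hn
  have h5 := (Complex.continuous_re.tendsto _).comp h4
  simp only [Function.comp_def, Complex.ofReal_re] at h5
  have hc : Real.sqrt (2 * Real.pi * m) ≠ 0 := by positivity
  have h6 := h5.const_mul (Real.sqrt (2 * Real.pi * m))⁻¹
  simpa only [inv_mul_cancel_left₀ hc] using h6

lemma phisum_tendsto (m : ℕ) (hm : 1 ≤ m) :
    Tendsto (fun n => ∑ k ∈ Finset.range (n + 1), pc n k * phi (xk n k) ^ m) atTop
      (𝓝 (1 / (Real.sqrt (2 * Real.pi) ^ m * Real.sqrt (m + 1)))) := by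
  have h := (gsum_tendsto m hm).const_mul (1 / Real.sqrt (2 * Real.pi) ^ m)
  rw [one_div_mul_one_div] at h
  refine h.congr fun n => ?_
  rw [Finset.mul_sum]
  refine Finset.sum_congr rfl fun k _ => ?_
  rw [phi, div_pow, ← Real.exp_nat_mul]
  have : (m : ℝ) * (-xk n k ^ 2 / 2) = -(m * xk n k ^ 2 / 2) := by ring
  rw [this]
  ring

lemma main_diff (m n : ℕ) (hn : 4 ≤ Real.log n) :
    |sg n ^ m * ∑ k ∈ Finset.range (n + 1), pc n k ^ (m + 1) - ∑ k ∈ Finset.range (n + 1), pc n k * phi (xk n k) ^ m|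
      ≤ del n * m * (1 + del n) ^ (m - 1) := by
  rw [Finset.mul_sum, ← Finset.sum_sub_distrib]
  refine (Finset.abs_sum_le_sum_abs _ _).trans ?_
  have : ∀ k ∈ Finset.range (n + 1), |sg n ^ m * pc n k ^ (m + 1) - pc n k * phi (xk n k) ^ m| ≤
      pc n k * (del n * m * (1 + del n) ^ (m - 1)) := by
    intro k hk
    have e : sg n ^ m * pc n k ^ (m + 1) - pc n k * phi (xk n k) ^ m = pc n k * ((sg n * pc n k) ^ m - phi (xk n k) ^ m) := by
      ring
    rw [e, abs_mul, abs_of_nonneg (pc_nonneg n k)]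
    apply mul_le_mul_of_nonneg_left _ (pc_nonneg n k)
    refine (abs_pow_sub_pow_le _ _ _).trans ?_
    have h1 := llt n hn k hk
    have h2 := phi_le_one (xk n k)
    have h3 := phi_nonneg (xk n k)
    have h4 := del_nonneg n
    have h5 : |phi (xk n k)| ≤ 1 + del n := by rw [abs_of_nonneg h3]; linarith
    have h6 : |sg n * pc n k| ≤ 1 + del n := by
      have := abs_add_le (sg n * pc n k - phi (xk n k)) (phi (xk n k))
      rw [sub_add_cancel, abs_of_nonneg h3] at this
      linarith
    gcongr
    exact max_le h6 h5
  refine (Finset.sum_le_sum this).trans_eq ?_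
  rw [← Finset.sum_mul, pc_sum, one_mul]

theorem partA (m : ℕ) (hm : 1 ≤ m) :
    Tendsto (fun n => sg n ^ m * ∑ k ∈ Finset.range (n + 1), pc n k ^ (m + 1)) atTop
      (𝓝 (1 / (Real.sqrt (2 * Real.pi) ^ m * Real.sqrt (m + 1)))) := by
  have h1 : Tendsto (fun n => sg n ^ m * ∑ k ∈ Finset.range (n + 1), pc n k ^ (m + 1) -
      ∑ k ∈ Finset.range (n + 1), pc n k * phi (xk n k) ^ m) atTop (𝓝 0) := by
    apply squeeze_zero_norm' (a := fun n => del n * m * (1 + del n) ^ (m - 1))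
    · filter_upwards [log_tendsto.eventually_ge_atTop 4] with n hn
      exact main_diff m n hn
    · have := (del_tendsto.mul_const (m : ℝ)).mul ((del_tendsto.const_add 1).pow (m - 1))
      simpa using this
  simpa using h1.add (phisum_tendsto m hm)

end Pf

theorem stmt_4 (r : ℕ) (hr : 2 ≤ r)
    (cr : ℝ) (hcr : cr = 1 / ((2 * Real.pi) ^ (((r : ℝ) - 1) / 2) * Real.sqrt r)) :
    ∀ ε : ℝ, 0 < ε → ∃ N : ℕ, ∀ n : ℕ, N ≤ n → ∃ Q : ℕ,
      ∀ (F : Type) [Field F] [Fintype F], Q < Fintype.card F →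
        ∀ a : Fin r → F[X], Function.Injective a →
          (∀ i, (a i).degree < (n : WithBot ℕ)) →
          |(Fintype.card F : ℝ)⁻¹ ^ n *
                (Nat.card {f : F[X] // f.Monic ∧ f.natDegree = n ∧
                  ∀ i j, omegaPoly (f + a i) = omegaPoly (f + a j)} : ℝ)
              - cr / (Real.log n) ^ (((r : ℝ) - 1) / 2)|
            ≤ ε / (Real.log n) ^ (((r : ℝ) - 1) / 2) := by
  intro ε hε
  obtain ⟨m, rfl⟩ : ∃ m, r = m + 1 := ⟨r - 1, by omega⟩
  have hsq : ∀ x : ℝ, 0 < x → x ^ ((((m + 1 : ℕ) : ℝ) - 1) / 2) = Real.sqrt x ^ m := by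
    intro x hx
    rw [Real.sqrt_eq_rpow, ← Real.rpow_natCast, ← Real.rpow_mul hx.le]
    congr 1
    push_cast
    ring
  have hA := Pf.partA m (by omega)
  have hcr' : cr = 1 / (Real.sqrt (2 * Real.pi) ^ m * Real.sqrt (m + 1)) := by
    rw [hcr, hsq _ (by positivity)]
    push_cast
    rfl
  rw [← hcr'] at hA
  have hev := (Metric.tendsto_nhds.1 hA (ε / 2) (by positivity)).and
    ((Pf.log_tendsto.eventually_gt_atTop 0).and (Filter.eventually_ge_atTop 4))
  obtain ⟨N, hN⟩ := Filter.eventually_atTop.1 hev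
  refine ⟨N, fun n hn => ?_⟩
  obtain ⟨h1, hlog, hn4⟩ := hN n hn
  rw [hsq _ hlog]
  have hs : Real.sqrt (Real.log n) = Pf.sg n := rfl
  rw [hs]
  have hsg : 0 < Pf.sg n := Real.sqrt_pos.2 hlog
  set L : ℝ := Pf.sg n ^ m with hL
  have hLpos : 0 < L := by positivity
  obtain ⟨Q, hQ⟩ := Pf.partB (m + 1) n hr hn4 (ε / 2 / L) (by positivity)
  refine ⟨Q, ?_⟩
  intro F _ _ hF a ha hdeg
  have h2 := hQ F hF a ha hdeg
  rw [Pf.Ev_eq (m + 1) n (by omega)] at h2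
  rw [Real.dist_eq] at h1
  set S := ∑ k ∈ Finset.range (n + 1), Pf.pc n k ^ (m + 1)
  have h3 : |S - cr / L| ≤ ε / 2 / L := by
    have : S - cr / L = (L * S - cr) / L := by field_simp
    rw [this, abs_div, abs_of_pos hLpos]
    gcongr
  have h4 := abs_sub_le ((Fintype.card F : ℝ)⁻¹ ^ n *
                (Nat.card {f : F[X] // f.Monic ∧ f.natDegree = n ∧
                  ∀ i j, omegaPoly (f + a i) = omegaPoly (f + a j)} : ℝ)) S (cr / L)
  have h5 : ε / L = ε / 2 / L + ε / 2 / L := by ring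
  linarith
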